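/- Let (A, 𝔪_A, k) be a commutative Noetherian local ring, let f₁, …, f_c ∈ 𝔪_A be an A-regular sequence, and set B = A/(f₁, …, f_c), a Noetherian local ring with maximal ideal 𝔪 and residue field k. Let M be a finitely generated B-module such that M admits a finite free resolution over A and M is maximal Cohen–Macaulay over B, and set M^∨ = Hom_B(M, B). Fix minimal free resolutions of M and of M^∨ over B, with i-th Betti numbers β_i(M) and β_i(M^∨) (the ranks of the i-th free modules). Then for every natural number n, limsup_{i→∞} β_i(M)/iⁿ = limsup_{i→∞} β_i(M^∨)/iⁿ as elements of [0, ∞]. In particular, the complexity of M (the least b such that β_i(M) is eventually bounded by a polynomial of degree b − 1) equals that of M^∨, and the leading terms of the quasi-polynomials eventually modeling β_i(M) and β_i(M^∨) agree, i.e. the Betti degrees of M and M^∨ coincide. -/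

import Mathlib

open IsLocalRing Filter

/-- `β : ℕ → ℕ` is the sequence of ranks of a free resolution
`⋯ → R^{β 1} → R^{β 0} → M → 0` of `M` over `R`. -/
def IsFreeResolutionBetti (R : Type) [CommRing R] (M : Type) [AddCommGroup M]
    [Module R M] (β : ℕ → ℕ) : Prop :=
  ∃ (d : ∀ i : ℕ, (Fin (β (i + 1)) → R) →ₗ[R] (Fin (β i) → R))
    (ε : (Fin (β 0) → R) →ₗ[R] M),
      Function.Surjective ε ∧
      LinearMap.ker ε = LinearMap.range (d 0) ∧
      (∀ i, LinearMap.ker (d i) = LinearMap.range (d (i + 1)))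

/-- `β : ℕ → ℕ` is the sequence of Betti numbers of a *minimal* free resolution of `M`
over the local ring `B`, i.e. a free resolution with `d(F_{i+1}) ⊆ 𝔪·F_i`. -/
def IsMinimalFreeResolutionBetti (B : Type) [CommRing B] [IsLocalRing B] (M : Type)
    [AddCommGroup M] [Module B M] (β : ℕ → ℕ) : Prop :=
  ∃ (d : ∀ i : ℕ, (Fin (β (i + 1)) → B) →ₗ[B] (Fin (β i) → B))
    (ε : (Fin (β 0) → B) →ₗ[B] M),
      Function.Surjective ε ∧
      LinearMap.ker ε = LinearMap.range (d 0) ∧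
      (∀ i, LinearMap.ker (d i) = LinearMap.range (d (i + 1))) ∧
      (∀ i, LinearMap.range (d i) ≤
        (maximalIdeal B) • (⊤ : Submodule B (Fin (β i) → B)))

section

open Module Topology TensorProduct

section LinearAlgebraRank

variable {K E F G : Type*} [Field K] [AddCommGroup E] [Module K E] [AddCommGroup F] [Module K F]
  [AddCommGroup G] [Module K G]

/-- Two linear maps with the same kernel on `T` have images of `T` of the same dimension. -/
lemma finrank_map_eq_of_ker_iff (T : Submodule K E) (f : E →ₗ[K] F) (g : E →ₗ[K] G)
    (h : ∀ z ∈ T, f z = 0 ↔ g z = 0) :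
    finrank K (T.map f) = finrank K (T.map g) := by
  have hk : LinearMap.ker (f.domRestrict T) = LinearMap.ker (g.domRestrict T) := by
    ext ⟨z, hz⟩
    simpa using h z hz
  rw [← LinearMap.range_domRestrict, ← LinearMap.range_domRestrict]
  exact LinearEquiv.finrank_eq ((f.domRestrict T).quotKerEquivRange.symm.trans
    ((Submodule.quotEquivOfEq _ _ hk).trans (g.domRestrict T).quotKerEquivRange))

end LinearAlgebraRank

section GradedMatrices

variable {K R : Type*} [Field K] [CommRing R] [Algebra K R]
variable {ι ι' : Type*}

/-- The degree `n` piece of the graded free module with generators of degrees `w`. -/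
def gradedPiece (𝒜 : ℤ → Submodule K R) (w : ι → ℤ) (n : ℤ) : Submodule K (ι → R) :=
  Submodule.pi Set.univ fun i => 𝒜 (n - w i)

lemma mem_gradedPiece {𝒜 : ℤ → Submodule K R} {w : ι → ℤ} {n : ℤ} {v : ι → R} :
    v ∈ gradedPiece 𝒜 w n ↔ ∀ i, v i ∈ 𝒜 (n - w i) := by
  simp [gradedPiece, Submodule.mem_pi]

variable [Fintype ι]

/-- Matrix multiplication as a linear map over the ground field. -/
def mulVecK (K : Type*) [Field K] [Algebra K R] (X : Matrix ι' ι R) : (ι → R) →ₗ[K] (ι' → R) :=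
  X.mulVecLin.restrictScalars K

@[simp] lemma mulVecK_apply (X : Matrix ι' ι R) (v : ι → R) : mulVecK K X v = X.mulVec v := rfl

/-- `X` is a homogeneous matrix from generators of degrees `w` to generators of degrees `w'`. -/
def IsHomogeneousMatrix (𝒜 : ℤ → Submodule K R) (w' : ι' → ℤ) (w : ι → ℤ)
    (X : Matrix ι' ι R) : Prop :=
  ∀ i j, X i j ∈ 𝒜 (w j - w' i)

/-- The rank of a matrix on the degree `n` piece. -/
noncomputable def gradedRank (𝒜 : ℤ → Submodule K R) (X : Matrix ι' ι R) (w : ι → ℤ) (n : ℤ) :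
    ℕ :=
  finrank K ((gradedPiece 𝒜 w n).map (mulVecK K X))

/-- The graded piece is the product of the graded pieces of its summands. -/
noncomputable def gradedPieceEquiv (𝒜 : ℤ → Submodule K R) (w : ι → ℤ) (n : ℤ) :
    gradedPiece 𝒜 w n ≃ₗ[K] (∀ i, 𝒜 (n - w i)) where
  toFun v i := ⟨v.1 i, mem_gradedPiece.mp v.2 i⟩
  invFun v := ⟨fun i => v i, mem_gradedPiece.mpr fun i => (v i).2⟩
  map_add' _ _ := rfl
  map_smul' _ _ := rfl
  left_inv _ := rfl
  right_inv _ := rfl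

instance gradedPiece_finite (𝒜 : ℤ → Submodule K R) [∀ n, FiniteDimensional K (𝒜 n)]
    (w : ι → ℤ) (n : ℤ) : FiniteDimensional K (gradedPiece 𝒜 w n) :=
  Module.Finite.equiv (gradedPieceEquiv 𝒜 w n).symm

lemma finrank_gradedPiece (𝒜 : ℤ → Submodule K R) [∀ n, FiniteDimensional K (𝒜 n)]
    (w : ι → ℤ) (n : ℤ) :
    finrank K (gradedPiece 𝒜 w n) = ∑ i, finrank K (𝒜 (n - w i)) := by
  rw [(gradedPieceEquiv 𝒜 w n).finrank_eq, Module.finrank_pi_fintype]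

lemma mulVec_mem_gradedPiece {𝒜 : ℤ → Submodule K R} [SetLike.GradedMonoid 𝒜]
    {w' : ι' → ℤ} {w : ι → ℤ} {X : Matrix ι' ι R}
    (hX : IsHomogeneousMatrix 𝒜 w' w X) {n : ℤ} {v : ι → R} (hv : v ∈ gradedPiece 𝒜 w n) :
    X.mulVec v ∈ gradedPiece 𝒜 w' n := by
  refine mem_gradedPiece.mpr fun i => Submodule.sum_mem _ fun j _ => ?_
  have := SetLike.mul_mem_graded (hX i j) (mem_gradedPiece.mp hv j)
  rwa [show w j - w' i + (n - w j) = n - w' i by ring] at this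

end GradedMatrices

section ParityAsymptotics

/-- `a n / n ^ N` is asymptotic to a function of the parity of `n`. -/
def ParityAsymptotic (N : ℕ) (a : ℤ → ℝ) (r : ZMod 2 → ℝ) : Prop :=
  Tendsto (fun n : ℤ => a n / (n : ℝ) ^ N - r (n : ZMod 2)) atTop (𝓝 0)

variable {N : ℕ} {a b : ℤ → ℝ} {r s : ZMod 2 → ℝ}

lemma ParityAsymptotic.add (ha : ParityAsymptotic N a r) (hb : ParityAsymptotic N b s) :
    ParityAsymptotic N (fun n => a n + b n) (fun e => r e + s e) := by
  have := Tendsto.add ha hb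
  rw [add_zero] at this
  exact this.congr fun n => by ring

lemma ParityAsymptotic.sub (ha : ParityAsymptotic N a r) (hb : ParityAsymptotic N b s) :
    ParityAsymptotic N (fun n => a n - b n) (fun e => r e - s e) := by
  have := Tendsto.sub ha hb
  rw [sub_zero] at this
  exact this.congr fun n => by ring

lemma ParityAsymptotic.zero : ParityAsymptotic N (fun _ => 0) (fun _ => 0) := by
  simp [ParityAsymptotic]

lemma ParityAsymptotic.sum {ι : Type*} (S : Finset ι) {a : ι → ℤ → ℝ} {r : ι → ZMod 2 → ℝ}
    (h : ∀ i ∈ S, ParityAsymptotic N (a i) (r i)) :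
    ParityAsymptotic N (fun n => ∑ i ∈ S, a i n) (fun e => ∑ i ∈ S, r i e) := by
  classical
  induction S using Finset.induction_on with
  | empty => simpa using ParityAsymptotic.zero
  | insert i S hi ih =>
    simp only [Finset.sum_insert hi]
    exact (h i (Finset.mem_insert_self _ _)).add (ih fun k hk => h k (Finset.mem_insert_of_mem hk))

lemma tendsto_shift_ratio (k : ℤ) :
    Tendsto (fun n : ℤ => (((n + k : ℤ) : ℝ) / (n : ℝ)) ^ N) atTop (𝓝 1) := by
  have h : Tendsto (fun n : ℤ => 1 + (k : ℝ) / (n : ℝ)) atTop (𝓝 (1 + 0)) :=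
    tendsto_const_nhds.add (tendsto_const_nhds.div_atTop tendsto_intCast_atTop_atTop)
  rw [add_zero] at h
  have h2 := h.pow N
  rw [one_pow] at h2
  refine h2.congr' ?_
  filter_upwards [eventually_gt_atTop 0] with n hn
  have : (n : ℝ) ≠ 0 := by exact_mod_cast hn.ne'
  congr 1
  push_cast
  field_simp

lemma ParityAsymptotic.shift (ha : ParityAsymptotic N a r) (k : ℤ) :
    ParityAsymptotic N (fun n => a (n + k)) (fun e => r (e + k)) := by
  have h1 : Tendsto (fun n : ℤ => a (n + k) / ((n + k : ℤ) : ℝ) ^ N - r ((n + k : ℤ) : ZMod 2))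
      atTop (𝓝 0) :=
    Tendsto.comp ha (tendsto_atTop_add_const_right atTop k tendsto_id)
  have h2 := h1.mul (tendsto_shift_ratio (N := N) k)
  have h3 : Tendsto (fun n : ℤ => r ((n + k : ℤ) : ZMod 2) *
      ((((n + k : ℤ) : ℝ) / (n : ℝ)) ^ N - 1)) atTop (𝓝 0) := by
    have h4 := (tendsto_shift_ratio (N := N) k).sub_const 1
    rw [sub_self] at h4
    refine bdd_le_mul_tendsto_zero' (max |r 0| |r 1|) (Eventually.of_forall fun n => ?_) h4
    generalize ((n + k : ℤ) : ZMod 2) = e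
    fin_cases e
    · exact le_max_left _ _
    · exact le_max_right _ _
  have h5 := h2.add h3
  rw [zero_mul, zero_add] at h5
  refine h5.congr' ?_
  filter_upwards [eventually_gt_atTop 0, eventually_gt_atTop (-k)] with n hn hk
  have hn0 : (n : ℝ) ≠ 0 := by exact_mod_cast hn.ne'
  have hk0 : ((n + k : ℤ) : ℝ) ≠ 0 := by exact_mod_cast (by omega : n + k ≠ 0)
  rw [div_pow, Int.cast_add n k (R := ZMod 2)]
  field_simp
  ring

lemma tendsto_two_mul_add (e : ℤ) : Tendsto (fun n : ℤ => 2 * n + e) atTop atTop :=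
  tendsto_atTop_add_const_right _ _ (tendsto_id.const_mul_atTop' (by norm_num))

lemma ParityAsymptotic.unique (ha : ParityAsymptotic N a r) (ha' : ParityAsymptotic N a s) :
    r = s := by
  funext e
  obtain ⟨k, rfl⟩ : ∃ k : ℤ, (k : ZMod 2) = e := ⟨e.val, by simp⟩
  have h := (Tendsto.sub ha ha').comp (tendsto_two_mul_add k)
  have h2 : Tendsto (fun _ : ℤ => s k - r k) atTop (𝓝 (0 - 0)) := by
    refine h.congr fun n => ?_
    have : ((2 * n + k : ℤ) : ZMod 2) = k := by
      push_cast
      rw [show (2 : ZMod 2) = 0 from rfl, zero_mul, zero_add]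
    simp only [Function.comp, this]
    ring
  have := tendsto_nhds_unique h2 tendsto_const_nhds
  linarith

/-- Squeeze principle, one parity at a time. -/
lemma ParityAsymptotic.squeeze
    (h : ∀ e : ZMod 2, ∃ (lo hi : ℤ → ℝ) (rlo rhi : ZMod 2 → ℝ), ParityAsymptotic N lo rlo ∧
      ParityAsymptotic N hi rhi ∧ rlo e = r e ∧ rhi e = r e ∧
      ∀ n : ℤ, (n : ZMod 2) = e → lo n ≤ a n ∧ a n ≤ hi n) :
    ParityAsymptotic N a r := by
  choose lo hi rlo rhi hlo hhi e1 e2 hb using h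
  have hg : Tendsto (fun n : ℤ => ∑ e : ZMod 2, (|lo e n / (n : ℝ) ^ N - rlo e n| +
      |hi e n / (n : ℝ) ^ N - rhi e n|)) atTop (𝓝 (∑ e : ZMod 2, (|0| + |0|))) :=
    tendsto_finsetSum _ fun e _ => (Tendsto.abs (hlo e)).add (Tendsto.abs (hhi e))
  simp only [abs_zero, add_zero, Finset.sum_const_zero] at hg
  refine squeeze_zero_norm' ?_ hg
  filter_upwards [eventually_gt_atTop 0] with n hn
  have hn0 : (0 : ℝ) < (n : ℝ) ^ N := pow_pos (by exact_mod_cast hn) N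
  obtain ⟨h1, h2⟩ := hb n n rfl
  have h3 : lo n n / (n : ℝ) ^ N ≤ a n / (n : ℝ) ^ N := by gcongr
  have h4 : a n / (n : ℝ) ^ N ≤ hi n n / (n : ℝ) ^ N := by gcongr
  refine le_trans ?_ (Finset.single_le_sum (f := fun e : ZMod 2 =>
    (|lo e n / (n : ℝ) ^ N - rlo e n| + |hi e n / (n : ℝ) ^ N - rhi e n|))
    (fun e _ => by positivity) (Finset.mem_univ (n : ZMod 2)))
  simp only [e1, e2]
  rw [Real.norm_eq_abs, abs_le]
  constructor
  · linarith [neg_abs_le (lo n n / (n : ℝ) ^ N - r n), abs_nonneg (hi n n / (n : ℝ) ^ N - r n)]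
  · linarith [le_abs_self (hi n n / (n : ℝ) ^ N - r n), abs_nonneg (lo n n / (n : ℝ) ^ N - r n)]

/-- `a n` is eventually bounded by a multiple of `n ^ N`. -/
def PolynomiallyBounded (N : ℕ) (a : ℤ → ℝ) : Prop :=
  ∃ C : ℝ, ∀ᶠ n : ℤ in atTop, a n ≤ C * (n : ℝ) ^ N

lemma PolynomiallyBounded.asymptotic_zero (ha : PolynomiallyBounded N a) (h0 : ∀ n, 0 ≤ a n)
    {d : ℕ} (hd : N < d) : ParityAsymptotic d a (fun _ => 0) := by
  obtain ⟨C, hC⟩ := ha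
  have h1 : Tendsto (fun n : ℤ => C * ((n : ℝ) ^ (d - N))⁻¹) atTop (𝓝 (C * 0)) :=
    tendsto_const_nhds.mul (tendsto_inv_atTop_zero.comp
      ((tendsto_pow_atTop (by omega)).comp tendsto_intCast_atTop_atTop))
  rw [mul_zero] at h1
  unfold ParityAsymptotic
  simp only [sub_zero]
  refine squeeze_zero' ?_ ?_ h1
  · filter_upwards [eventually_gt_atTop 0] with n hn
    have hn0 : (0 : ℝ) < (n : ℝ) := by exact_mod_cast hn
    have := h0 n
    positivity
  · filter_upwards [eventually_gt_atTop 0, hC] with n hn hn'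
    have hn0 : (0 : ℝ) < (n : ℝ) := by exact_mod_cast hn
    rw [div_le_iff₀ (by positivity), mul_assoc]
    refine hn'.trans_eq ?_
    congr 1
    rw [eq_inv_mul_iff_mul_eq₀ (by positivity), ← pow_add]
    congr 1
    omega

end ParityAsymptotics

section RankAsymptotics

variable {K R : Type*} [Field K] [CommRing R] [Algebra K R] {ι ι' : Type*} [Fintype ι]

/-- The parity `e` block of a homogeneous matrix, over the fraction field. -/
noncomputable def parityBlock (X : Matrix ι' ι R) (w : ι → ℤ) (e : ZMod 2) :
    Matrix ι' ι (FractionRing R) :=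
  Matrix.of fun i j => if (w j : ZMod 2) = e then algebraMap R (FractionRing R) (X i j) else 0

lemma map_mulVec_eq_parityBlock [IsDomain R] {𝒜 : ℤ → Submodule K R}
    (hodd : ∀ n : ℤ, (n : ZMod 2) ≠ 0 → 𝒜 n = ⊥) (X : Matrix ι' ι R) (w : ι → ℤ) (n : ℤ)
    {v : ι → R} (hv : v ∈ gradedPiece 𝒜 w n) (i : ι') :
    algebraMap R (FractionRing R) (X.mulVec v i) =
      (parityBlock X w n).mulVec (fun j => algebraMap R (FractionRing R) (v j)) i := by
  simp only [Matrix.mulVec, dotProduct, map_sum, map_mul, parityBlock, Matrix.of_apply]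
  refine Finset.sum_congr rfl fun j _ => ?_
  split_ifs with h
  · rfl
  · have : v j = 0 := by
      have h1 := mem_gradedPiece.mp hv j
      rw [hodd _ (by push_cast; exact fun h' => h (sub_eq_zero.mp h').symm)] at h1
      simpa using h1
    simp [this]

/-- Hilbert function lower bound for the rank of a homogeneous matrix. -/
lemma exists_le_gradedRank [IsDomain R] {𝒜 : ℤ → Submodule K R} [∀ n, FiniteDimensional K (𝒜 n)]
    (X : Matrix ι' ι R) (w : ι → ℤ) (e : ZMod 2) :
    ∃ J : Finset ι, J.card = (parityBlock X w e).rank ∧ (∀ j ∈ J, (w j : ZMod 2) = e) ∧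
      ∀ n : ℤ, (n : ZMod 2) = e → ∑ j ∈ J, finrank K (𝒜 (n - w j)) ≤ gradedRank 𝒜 X w n := by
  classical
  obtain ⟨κ, a, ha, hspan, hli⟩ := exists_linearIndependent' (FractionRing R)
    (parityBlock X w e).col
  have : Fintype κ := Fintype.ofInjective a ha
  have hw : ∀ k, (w (a k) : ZMod 2) = e := fun k => by
    by_contra h
    refine hli.ne_zero k ?_
    funext i
    simp [Matrix.col, parityBlock, Function.comp, h]
  refine ⟨Finset.univ.map ⟨a, ha⟩, ?_, ?_, fun n hn => ?_⟩
  · rw [Finset.card_map, Matrix.rank_eq_finrank_span_cols, ← hspan, finrank_span_eq_card hli,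
      Finset.card_univ]
  · simpa using hw
  · rw [Finset.sum_map]
    change ∑ k, finrank K (𝒜 (n - (w ∘ a) k)) ≤ _
    rw [← finrank_gradedPiece 𝒜 (w ∘ a) n]
    let Ex : (κ → R) →ₗ[K] (ι → R) :=
      { toFun := fun v => fun j => ∑ k, if a k = j then v k else 0
        map_add' := fun u v => by
          funext j
          simp only [Pi.add_apply, ← Finset.sum_add_distrib]
          exact Finset.sum_congr rfl fun k _ => by split_ifs <;> simp
        map_smul' := fun c v => by
          funext j
          simp only [Pi.smul_apply, RingHom.id_apply, Finset.smul_sum]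
          exact Finset.sum_congr rfl fun k _ => by split_ifs <;> simp }
    have hEx : ∀ v k, Ex v (a k) = v k := fun v k => by
      simp [Ex, ha.eq_iff]
    have hX : ∀ v i, (mulVecK K X (Ex v)) i = ∑ k, X i (a k) * v k := fun v i => by
      simp only [mulVecK_apply, Matrix.mulVec, dotProduct, Ex, LinearMap.coe_mk, AddHom.coe_mk,
        Finset.mul_sum, mul_ite, mul_zero]
      rw [Finset.sum_comm]
      simp
    have hinj : Function.Injective (mulVecK K X ∘ₗ Ex) := by
      rw [← LinearMap.ker_eq_bot, LinearMap.ker_eq_bot']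
      intro v hv
      have h1 : ∑ k, algebraMap R (FractionRing R) (v k) • (parityBlock X w e).col (a k) = 0 := by
        funext i
        have h2 := congrArg (algebraMap R (FractionRing R)) (congrFun hv i)
        rw [LinearMap.comp_apply, hX] at h2
        simp only [Finset.sum_apply, Pi.smul_apply, Matrix.col, Matrix.transpose_apply,
          parityBlock, Matrix.of_apply, hw, if_true, smul_eq_mul, Pi.zero_apply]
        rw [map_sum] at h2
        simpa [mul_comm] using h2
      funext k
      have := Fintype.linearIndependent_iff.mp hli _ h1 k
      exact (IsFractionRing.injective R (FractionRing R)) (by simpa using this)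
    rw [LinearEquiv.finrank_eq (Submodule.equivMapOfInjective _ hinj (gradedPiece 𝒜 (w ∘ a) n)),
      Submodule.map_comp]
    refine Submodule.finrank_mono (Submodule.map_mono ?_)
    rintro _ ⟨v, hv, rfl⟩
    refine mem_gradedPiece.mpr fun j => ?_
    refine Submodule.sum_mem _ fun k _ => ?_
    split_ifs with h
    · subst h
      exact mem_gradedPiece.mp hv k
    · exact Submodule.zero_mem _

variable [Fintype ι']

/-- Hilbert function upper bound for the rank of a homogeneous matrix. -/
lemma exists_gradedRank_le [IsDomain R] {𝒜 : ℤ → Submodule K R} [∀ n, FiniteDimensional K (𝒜 n)]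
    [SetLike.GradedMonoid 𝒜] (hodd : ∀ n : ℤ, (n : ZMod 2) ≠ 0 → 𝒜 n = ⊥)
    {X : Matrix ι' ι R} {w' : ι' → ℤ} {w : ι → ℤ} (hX : IsHomogeneousMatrix 𝒜 w' w X)
    (e : ZMod 2) :
    ∃ I : Finset ι', I.card = (parityBlock X w e).rank ∧ (∀ i ∈ I, (w' i : ZMod 2) = e) ∧
      ∀ n : ℤ, (n : ZMod 2) = e → gradedRank 𝒜 X w n ≤ ∑ i ∈ I, finrank K (𝒜 (n - w' i)) := by
  classical
  obtain ⟨κ, a, ha, hspan, hli⟩ := exists_linearIndependent' (FractionRing R)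
    (parityBlock X w e).row
  have : Fintype κ := Fintype.ofInjective a ha
  have hw : ∀ k, (w' (a k) : ZMod 2) = e := fun k => by
    by_contra h
    refine hli.ne_zero k ?_
    funext j
    simp only [Matrix.row, parityBlock, Function.comp, Matrix.of_apply, Pi.zero_apply]
    split_ifs with hj
    · have h1 := hX (a k) j
      rw [hodd _ (by
        push_cast
        rw [hj]
        exact fun h' => h (sub_eq_zero.mp h').symm)] at h1
      rw [(Submodule.mem_bot K).mp h1, map_zero]
    · rfl
  refine ⟨Finset.univ.map ⟨a, ha⟩, ?_, ?_, fun n hn => ?_⟩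
  · rw [Finset.card_map, Matrix.rank_eq_finrank_span_row, ← hspan, finrank_span_eq_card hli,
      Finset.card_univ]
  · simpa using hw
  · rw [Finset.sum_map]
    change _ ≤ ∑ k, finrank K (𝒜 (n - (w' ∘ a) k))
    rw [← finrank_gradedPiece 𝒜 (w' ∘ a) n]
    have hker : ∀ z ∈ gradedPiece 𝒜 w n, mulVecK K X z = 0 ↔
        (LinearMap.funLeft K R a ∘ₗ mulVecK K X) z = 0 := by
      intro z hz
      refine ⟨fun h => by rw [LinearMap.comp_apply, h, map_zero], fun h => ?_⟩
      funext i
      apply IsFractionRing.injective R (FractionRing R)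
      rw [mulVecK_apply, map_mulVec_eq_parityBlock hodd X w n hz, hn, Pi.zero_apply, map_zero]
      let ev : (ι → FractionRing R) →ₗ[FractionRing R] FractionRing R :=
        ∑ j, (algebraMap R (FractionRing R) (z j)) • LinearMap.proj j
      have hev : ∀ i, ev ((parityBlock X w e).row i) =
          (parityBlock X w e).mulVec (fun j => algebraMap R (FractionRing R) (z j)) i := by
        intro i
        simp [ev, Matrix.mulVec, dotProduct, Matrix.row, Algebra.smul_def, mul_comm]
      rw [← hev]
      have hle : Submodule.span (FractionRing R) (Set.range ((parityBlock X w e).row)) ≤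
          LinearMap.ker ev := by
        rw [← hspan, Submodule.span_le]
        rintro _ ⟨k, rfl⟩
        have h3 := congrArg (algebraMap R (FractionRing R)) (congrFun h k)
        simp only [LinearMap.comp_apply, LinearMap.funLeft_apply, mulVecK_apply,
          Pi.zero_apply, map_zero] at h3
        rw [map_mulVec_eq_parityBlock hodd X w n hz, hn, ← hev] at h3
        exact h3
      exact hle (Submodule.subset_span ⟨i, rfl⟩)
    rw [gradedRank, finrank_map_eq_of_ker_iff _ _ _ hker]
    refine Submodule.finrank_mono ?_
    rintro _ ⟨v, hv, rfl⟩
    have := mulVec_mem_gradedPiece hX hv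
    exact mem_gradedPiece.mpr fun k => mem_gradedPiece.mp this (a k)

/-- Asymptotics of the rank of a homogeneous matrix over a graded domain. -/
lemma gradedRank_asymptotic [IsDomain R] {𝒜 : ℤ → Submodule K R}
    [∀ n, FiniteDimensional K (𝒜 n)] [SetLike.GradedMonoid 𝒜]
    (hodd : ∀ n : ℤ, (n : ZMod 2) ≠ 0 → 𝒜 n = ⊥) {N : ℕ} {q : ZMod 2 → ℝ}
    (hilb : ParityAsymptotic N (fun n => (finrank K (𝒜 n) : ℝ)) q)
    {X : Matrix ι' ι R} {w' : ι' → ℤ} {w : ι → ℤ} (hX : IsHomogeneousMatrix 𝒜 w' w X) :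
    ParityAsymptotic N (fun n => (gradedRank 𝒜 X w n : ℝ))
      (fun e => q 0 * (parityBlock X w e).rank) := by
  refine ParityAsymptotic.squeeze fun e => ?_
  obtain ⟨J, hJ, hJw, hlo⟩ := exists_le_gradedRank (𝒜 := 𝒜) X w e
  obtain ⟨I, hI, hIw, hhi⟩ := exists_gradedRank_le hodd hX e
  refine ⟨_, _, _, _,
    ParityAsymptotic.sum J fun j _ => hilb.shift (-w j),
    ParityAsymptotic.sum I fun i _ => hilb.shift (-w' i), ?_, ?_, fun n hn => ⟨?_, ?_⟩⟩
  · rw [Finset.sum_congr rfl fun j hj => by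
      rw [Int.cast_neg, hJw j hj, add_neg_cancel], Finset.sum_const, hJ, nsmul_eq_mul, mul_comm]
  · rw [Finset.sum_congr rfl fun j hj => by
      rw [Int.cast_neg, hIw j hj, add_neg_cancel], Finset.sum_const, hI, nsmul_eq_mul, mul_comm]
  · exact_mod_cast hlo n hn
  · exact_mod_cast hhi n hn

end RankAsymptotics

section HomologyDimension

variable {K R : Type*} [Field K] [CommRing R] [Algebra K R] {ι ι' : Type*}

lemma parityBlock_transpose {𝒜 : ℤ → Submodule K R}
    (hodd : ∀ n : ℤ, (n : ZMod 2) ≠ 0 → 𝒜 n = ⊥)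
    {X : Matrix ι' ι R} {w' : ι' → ℤ} {w : ι → ℤ} (hX : IsHomogeneousMatrix 𝒜 w' w X)
    (e : ZMod 2) :
    parityBlock X.transpose (fun i => -w' i) e = (parityBlock X w e).transpose := by
  ext j i
  simp only [parityBlock, Matrix.of_apply, Matrix.transpose_apply, Int.cast_neg,
    ZMod.neg_eq_self_mod_two]
  by_cases h : (w j : ZMod 2) = w' i
  · rw [h]
  · have h1 := hX i j
    rw [hodd _ (by push_cast; exact fun h' => h (sub_eq_zero.mp h'))] at h1
    rw [(Submodule.mem_bot K).mp h1]
    simp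

lemma parityBlock_add_weight (X : Matrix ι' ι R) (w : ι → ℤ) (k : ℤ) (e : ZMod 2) :
    parityBlock X (fun i => w i + k) e = parityBlock X w (e - k) := by
  ext i j
  simp [parityBlock, eq_sub_iff_add_eq]

/-- `D` is homogeneous of degree one. -/
def IsHomogeneousDifferential (𝒜 : ℤ → Submodule K R) (w : ι → ℤ) (D : Matrix ι ι R) : Prop :=
  IsHomogeneousMatrix 𝒜 (fun i => w i - 1) w D

lemma IsHomogeneousDifferential.transpose {𝒜 : ℤ → Submodule K R} {D : Matrix ι ι R} {w : ι → ℤ}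
    (hD : IsHomogeneousDifferential 𝒜 w D) (k : ℤ) :
    IsHomogeneousDifferential 𝒜 (fun i => k - w i) D.transpose := fun i j => by
  have := hD j i
  rwa [show w i - (w j - 1) = k - w j - (k - w i - 1) by ring] at this

lemma one_isHomogeneousMatrix [DecidableEq ι] {𝒜 : ℤ → Submodule K R} [SetLike.GradedMonoid 𝒜]
    (w : ι → ℤ) : IsHomogeneousMatrix 𝒜 w w (1 : Matrix ι ι R) := fun i j => by
  by_cases h : i = j
  · subst h
    rw [Matrix.one_apply_eq, sub_self]
    exact SetLike.one_mem_graded 𝒜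
  · rw [Matrix.one_apply_ne h]
    exact Submodule.zero_mem _

variable [Fintype ι]

/-- The dimension of the degree `n` homology of the graded free module with generators of degrees
`w` and differential `D`. -/
noncomputable def homologyDim (𝒜 : ℤ → Submodule K R) (D : Matrix ι ι R) (w : ι → ℤ) (n : ℤ) : ℝ :=
  finrank K (gradedPiece 𝒜 w n) - gradedRank 𝒜 D w (n - 1) - gradedRank 𝒜 D w n

lemma rank_parityBlock_transpose {𝒜 : ℤ → Submodule K R}
    (hodd : ∀ n : ℤ, (n : ZMod 2) ≠ 0 → 𝒜 n = ⊥) {D : Matrix ι ι R} {w : ι → ℤ}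
    {w' : ι → ℤ} (hD : IsHomogeneousMatrix 𝒜 w' w D) {k : ℤ} (e : ZMod 2) [IsDomain R] :
    (parityBlock D.transpose (fun i => k - w' i) e).rank = (parityBlock D w (e - k)).rank := by
  rw [← Matrix.rank_transpose (parityBlock D w _), ← parityBlock_transpose hodd hD,
    ← parityBlock_add_weight]
  simp only [neg_add_eq_sub]

lemma homologyDim_asymptotic [IsDomain R] [DecidableEq ι] {𝒜 : ℤ → Submodule K R}
    [∀ n, FiniteDimensional K (𝒜 n)] [SetLike.GradedMonoid 𝒜]
    (hodd : ∀ n : ℤ, (n : ZMod 2) ≠ 0 → 𝒜 n = ⊥) {N : ℕ} {q : ZMod 2 → ℝ}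
    (hilb : ParityAsymptotic N (fun n => (finrank K (𝒜 n) : ℝ)) q)
    {w : ι → ℤ} {D : Matrix ι ι R} (hD : IsHomogeneousDifferential 𝒜 w D) :
    ParityAsymptotic N (homologyDim 𝒜 D w) (fun e =>
      q 0 * (parityBlock (1 : Matrix ι ι R) w e).rank
        - q 0 * (parityBlock D w (e - 1)).rank - q 0 * (parityBlock D w e).rank) := by
  have h1 := gradedRank_asymptotic hodd hilb (one_isHomogeneousMatrix (𝒜 := 𝒜) w)
  have h3 := gradedRank_asymptotic hodd hilb hD
  have h4 := (h1.sub (h3.shift (-1))).sub h3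
  simp only [Int.cast_neg, Int.cast_one, ← sub_eq_add_neg] at h4
  convert h4 using 2 with n
  have h5 : mulVecK K (1 : Matrix ι ι R) = LinearMap.id := LinearMap.ext fun v => by simp
  rw [homologyDim, gradedRank, gradedRank, gradedRank, h5, Submodule.map_id]

/-- When the ring has dimension at most `N + 1`, the homology of a complex and of its transpose
have the same asymptotics up to a shift. -/
lemma homologyDim_transpose_asymptotic [IsDomain R] {𝒜 : ℤ → Submodule K R}
    [∀ n, FiniteDimensional K (𝒜 n)] [SetLike.GradedMonoid 𝒜]
    (hodd : ∀ n : ℤ, (n : ZMod 2) ≠ 0 → 𝒜 n = ⊥) {N : ℕ} {q : ZMod 2 → ℝ}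
    (hilb : ParityAsymptotic N (fun n => (finrank K (𝒜 n) : ℝ)) q)
    {w : ι → ℤ} {D : Matrix ι ι R} (hD : IsHomogeneousDifferential 𝒜 w D) (k : ℤ) :
    ∃ r : ZMod 2 → ℝ, ParityAsymptotic N (homologyDim 𝒜 D w) r ∧
      ParityAsymptotic N (homologyDim 𝒜 D.transpose (fun i => k - w i)) (fun e => r (e - k)) := by
  classical
  refine ⟨_, homologyDim_asymptotic hodd hilb hD, ?_⟩
  convert homologyDim_asymptotic hodd hilb (hD.transpose k) using 2 with e
  have e1 := rank_parityBlock_transpose hodd (one_isHomogeneousMatrix (𝒜 := 𝒜) w) (k := k) e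
  rw [Matrix.transpose_one] at e1
  have e2 : ∀ e, (parityBlock D.transpose (fun i => k - w i) (e - 1)).rank =
      (parityBlock D w (e - k)).rank := fun e => by
    rw [← rank_parityBlock_transpose hodd hD, ← Int.cast_one, ← parityBlock_add_weight]
    simp only [sub_sub_eq_add_sub, sub_add_eq_add_sub]
  have e3 := e2 (e + 1)
  have h2 : e - k - 1 = e + 1 - k := by
    have : ∀ e k : ZMod 2, e - k - 1 = e + 1 - k := by decide
    exact this e k
  rw [add_sub_cancel_right] at e3
  rw [e1, e2, e3, h2]
  ring

end HomologyDimension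

section NullHomotopy

variable {K R : Type*} [Field K] [CommRing R] [Algebra K R] {ι : Type*} [Fintype ι]

/-- A square-zero endomorphism of half-dimensional rank over a field is contractible. -/
lemma exists_contraction {F V : Type*} [Field F] [AddCommGroup V] [Module F V]
    [FiniteDimensional F V] (d : V →ₗ[F] V) (hd : d ∘ₗ d = 0)
    (h : finrank F V ≤ 2 * finrank F (LinearMap.range d)) :
    ∃ s : V →ₗ[F] V, d ∘ₗ s + s ∘ₗ d = LinearMap.id := by
  have hle : LinearMap.range d ≤ LinearMap.ker d := by
    rintro _ ⟨v, rfl⟩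
    exact LinearMap.congr_fun hd v
  have hrn := LinearMap.finrank_range_add_finrank_ker d
  have heq : LinearMap.range d = LinearMap.ker d :=
    Submodule.eq_of_le_of_finrank_le hle (by omega)
  obtain ⟨σ, hσ⟩ := d.rangeRestrict.exists_rightInverse_of_surjective d.range_rangeRestrict
  have hσ' : ∀ x : LinearMap.range d, d (σ x) = x := fun x =>
    congrArg Subtype.val (LinearMap.congr_fun hσ x)
  have hmem : ∀ v, v - σ (d.rangeRestrict v) ∈ LinearMap.range d := fun v => by
    refine heq.ge (show _ ∈ LinearMap.ker d from ?_)
    rw [LinearMap.mem_ker, map_sub, hσ']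
    simp
  let π : V →ₗ[F] LinearMap.range d :=
    LinearMap.codRestrict _ (LinearMap.id - σ ∘ₗ d.rangeRestrict) hmem
  refine ⟨σ ∘ₗ π, ?_⟩
  ext v
  have h2 : π (d v) = d.rangeRestrict v := by
    apply Subtype.ext
    have h3 : d.rangeRestrict (d v) = 0 := Subtype.ext (LinearMap.congr_fun hd v)
    change d v - σ (d.rangeRestrict (d v)) = d v
    rw [h3, map_zero, sub_zero]
  simp only [LinearMap.add_apply, LinearMap.comp_apply, hσ', h2, LinearMap.id_apply]
  change v - σ (d.rangeRestrict v) + _ = v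
  rw [sub_add_cancel]

/-- The ranks of the parity blocks of a homogeneous matrix add up to at most its rank. -/
lemma rank_parityBlock_add_le [IsDomain R] {ι' : Type*} [Fintype ι'] {𝒜 : ℤ → Submodule K R}
    (hodd : ∀ n : ℤ, (n : ZMod 2) ≠ 0 → 𝒜 n = ⊥)
    {X : Matrix ι' ι R} {w' : ι' → ℤ} {w : ι → ℤ} (hX : IsHomogeneousMatrix 𝒜 w' w X) :
    (parityBlock X w 0).rank + (parityBlock X w 1).rank ≤
      (X.map (algebraMap R (FractionRing R))).rank := by
  have hle : ∀ e, LinearMap.range (parityBlock X w e).mulVecLin ≤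
      LinearMap.range (X.map (algebraMap R (FractionRing R))).mulVecLin := by
    rintro e _ ⟨v, rfl⟩
    refine ⟨fun j => if (w j : ZMod 2) = e then v j else 0, ?_⟩
    funext i
    simp only [Matrix.mulVecLin_apply, Matrix.mulVec, dotProduct, parityBlock, Matrix.of_apply,
      Matrix.map_apply]
    exact Finset.sum_congr rfl fun j _ => by split_ifs <;> simp
  have hsupp : ∀ e v i, (w' i : ZMod 2) ≠ e → (parityBlock X w e).mulVec v i = 0 := by
    intro e v i hi
    refine Finset.sum_eq_zero fun j _ => ?_
    simp only [parityBlock, Matrix.of_apply]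
    split_ifs with hj
    · have h1 := hX i j
      rw [hodd _ (by push_cast; rw [hj]; exact fun h' => hi (sub_eq_zero.mp h').symm)] at h1
      rw [(Submodule.mem_bot K).mp h1, map_zero, zero_mul]
    · rw [zero_mul]
  have hinf : LinearMap.range (parityBlock X w 0).mulVecLin ⊓
      LinearMap.range (parityBlock X w 1).mulVecLin = ⊥ := by
    rw [eq_bot_iff]
    rintro _ ⟨⟨v, rfl⟩, ⟨u, hu⟩⟩
    funext i
    by_cases hi : (w' i : ZMod 2) = 0
    · rw [← hu]
      exact hsupp 1 u i (by rw [hi]; decide)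
    · exact hsupp 0 v i hi
  have h := Submodule.finrank_sup_add_finrank_inf_eq
    (LinearMap.range (parityBlock X w 0).mulVecLin) (LinearMap.range (parityBlock X w 1).mulVecLin)
  rw [hinf, finrank_bot, add_zero] at h
  rw [Matrix.rank, Matrix.rank, ← h]
  exact Submodule.finrank_mono (sup_le (hle 0) (hle 1))

/-- If the homology of a complex grows slower than the Hilbert function of the ring, some nonzero
element of the ring is null-homotopic. -/
lemma exists_nullHomotopic [IsDomain R] [DecidableEq ι] {𝒜 : ℤ → Submodule K R}
    [∀ n, FiniteDimensional K (𝒜 n)] [SetLike.GradedMonoid 𝒜]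
    (hodd : ∀ n : ℤ, (n : ZMod 2) ≠ 0 → 𝒜 n = ⊥) {N : ℕ} {q : ZMod 2 → ℝ}
    (hilb : ParityAsymptotic N (fun n => (finrank K (𝒜 n) : ℝ)) q) (hq : q 0 ≠ 0)
    {w : ι → ℤ} {D : Matrix ι ι R} (hD : IsHomogeneousDifferential 𝒜 w D) (hDD : D * D = 0)
    (hh : ParityAsymptotic N (homologyDim 𝒜 D w) (fun _ => 0)) :
    ∃ p : R, p ≠ 0 ∧ ∃ H : Matrix ι ι R, D * H + H * D = p • (1 : Matrix ι ι R) := by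
  have h3 := (homologyDim_asymptotic hodd hilb hD).unique hh
  have h4 : ∀ e, ((parityBlock (1 : Matrix ι ι R) w e).rank : ℝ) =
      (parityBlock D w (e - 1)).rank + (parityBlock D w e).rank := fun e => by
    have := congrFun h3 e
    refine mul_left_cancel₀ hq ?_
    rw [mul_add]
    linarith
  have h5 : ∀ e, (parityBlock (1 : Matrix ι ι R) w e).rank =
      (parityBlock D w (e - 1)).rank + (parityBlock D w e).rank := fun e => by
    exact_mod_cast h4 e
  set F := FractionRing R
  set DF : Matrix ι ι F := D.map (algebraMap R F) with hDF
  have h6 : Fintype.card ι ≤ 2 * DF.rank := by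
    have e1 : _ ≤ DF.rank := rank_parityBlock_add_le hodd hD
    have e2 : (1 : Matrix ι ι F) = parityBlock (1 : Matrix ι ι R) w 0 +
        parityBlock (1 : Matrix ι ι R) w 1 := by
      ext i j
      have : (w j : ZMod 2) = 0 ∨ (w j : ZMod 2) = 1 := by
        generalize (w j : ZMod 2) = e
        revert e
        decide
      rcases this with h | h <;> by_cases hij : i = j <;>
        simp [parityBlock, h, hij, Matrix.one_apply]
    have e3 : (1 : Matrix ι ι F).rank ≤ (parityBlock (1 : Matrix ι ι R) w 0).rank +
        (parityBlock (1 : Matrix ι ι R) w 1).rank := by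
      rw [e2, Matrix.rank, Matrix.mulVecLin_add]
      exact (Submodule.finrank_mono (LinearMap.range_add_le _ _)).trans
        (Submodule.finrank_add_le_finrank_add_finrank _ _)
    rw [Matrix.rank_one, h5, h5] at e3
    have e4 : (0 : ZMod 2) - 1 = 1 := rfl
    have e5 : (1 : ZMod 2) - 1 = 0 := rfl
    rw [e4, e5] at e3
    omega
  obtain ⟨s, hs⟩ := exists_contraction DF.mulVecLin (by
    rw [← Matrix.mulVecLin_mul, hDF, ← Matrix.map_mul, hDD]
    simp) (by simpa [Matrix.rank] using h6)
  have hs' : DF * LinearMap.toMatrix' s + LinearMap.toMatrix' s * DF = 1 := by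
    have := congrArg LinearMap.toMatrix' hs
    rw [map_add, LinearMap.toMatrix'_comp, LinearMap.toMatrix'_comp, LinearMap.toMatrix'_id,
      ← Matrix.toLin'_apply', LinearMap.toMatrix'_toLin'] at this
    exact this
  obtain ⟨p, hp⟩ := IsLocalization.exist_integer_multiples_of_finite (nonZeroDivisors R)
    (fun ij : ι × ι => LinearMap.toMatrix' s ij.1 ij.2)
  choose H hH using hp
  refine ⟨p, nonZeroDivisors.ne_zero p.2, Matrix.of fun i j => H (i, j), ?_⟩
  apply Matrix.map_injective (IsFractionRing.injective R F)
  have hHF : (Matrix.of fun i j => H (i, j)).map (algebraMap R F) =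
      algebraMap R F p • LinearMap.toMatrix' s := by
    ext i j
    have := hH (i, j)
    simp only [Matrix.map_apply, Matrix.of_apply, Matrix.smul_apply, smul_eq_mul]
    rw [this, Algebra.smul_def]
  change Matrix.map _ _ = Matrix.map _ _
  rw [Matrix.map_add _ (map_add _), Matrix.map_mul, Matrix.map_mul, hHF, Matrix.mul_smul,
    Matrix.smul_mul, ← smul_add, hs']
  ext i j
  by_cases hij : i = j <;> simp [hij]

/-- A null-homotopy may be chosen homogeneous. -/
lemma exists_homogeneous_nullHomotopic [DecidableEq ι] {𝒜 : ℤ → Submodule K R} [GradedAlgebra 𝒜]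
    {w : ι → ℤ} {D : Matrix ι ι R} (hD : IsHomogeneousDifferential 𝒜 w D)
    {p : R} (hp : p ≠ 0) {H : Matrix ι ι R} (hH : D * H + H * D = p • (1 : Matrix ι ι R)) :
    ∃ (e : ℤ) (p' : R), p' ≠ 0 ∧ p' ∈ 𝒜 e ∧ ∃ H' : Matrix ι ι R,
      IsHomogeneousMatrix 𝒜 (fun i => w i + 1 - e) w H' ∧
      D * H' + H' * D = p' • (1 : Matrix ι ι R) := by
  have hex : ∃ e, (DirectSum.decompose 𝒜 p e : R) ≠ 0 := by
    by_contra! h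
    refine hp ?_
    have : DirectSum.decompose 𝒜 p = 0 := by
      ext e
      simpa using h e
    exact (DirectSum.decompose 𝒜).injective (this.trans (DirectSum.decompose_zero 𝒜).symm)
  obtain ⟨e, he⟩ := hex
  refine ⟨e, _, he, SetLike.coe_mem _, Matrix.of fun i j =>
    (DirectSum.decompose 𝒜 (H i j) (w j - (w i + 1 - e)) : R), fun i j => SetLike.coe_mem _, ?_⟩
  let π : ℤ → R →+ R := fun n =>
    { toFun := fun x => (DirectSum.decompose 𝒜 x n : R)
      map_zero' := by simp
      map_add' := fun x y => by simp }
  ext i j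
  have e1 : ∀ k, π (e + w j - w i) (D i k * H k j) = D i k * π (w j - (w k + 1 - e)) (H k j) :=
    fun k => by
      rw [show e + w j - w i = w k - (w i - 1) + (w j - (w k + 1 - e)) by ring]
      exact DirectSum.coe_decompose_mul_add_of_left_mem 𝒜 (hD i k)
  have e2 : ∀ k, π (e + w j - w i) (H i k * D k j) = π (w k - (w i + 1 - e)) (H i k) * D k j :=
    fun k => by
      rw [show e + w j - w i = w k - (w i + 1 - e) + (w j - (w k - 1)) by ring]
      exact DirectSum.coe_decompose_mul_add_of_right_mem 𝒜 (hD k j)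
  have h1 := congrArg (π (e + w j - w i)) (congrFun (congrFun hH i) j)
  rw [Matrix.add_apply, Matrix.mul_apply, Matrix.mul_apply, map_add, map_sum, map_sum] at h1
  simp only [e1, e2] at h1
  rw [Matrix.add_apply, Matrix.mul_apply, Matrix.mul_apply]
  refine h1.trans ?_
  by_cases hij : i = j
  · subst hij
    rw [add_sub_cancel_right]
    simp [π]
  · simp [hij]

end NullHomotopy

section HilbertFunction

variable (K : Type*) [Field K] (c : ℕ)

/-- The grading of a polynomial ring in which every variable has degree two. -/
abbrev evenGrading (S : Type*) [CommRing S] (c : ℕ) (n : ℤ) : Submodule S (MvPolynomial (Fin c) S) :=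
  MvPolynomial.weightedHomogeneousSubmodule S (fun _ => (2 : ℤ)) n

lemma weight_two_eq (a : Fin c →₀ ℕ) : Finsupp.weight (fun _ => (2 : ℤ)) a = 2 * (a.degree : ℤ) := by
  rw [Finsupp.weight_eq_sum, Finsupp.degree_eq_sum]
  push_cast
  rw [Finset.mul_sum]
  exact Finset.sum_congr rfl fun i _ => by simp [mul_comm]

variable {c} in
lemma mem_evenGrading {S : Type*} [CommRing S] {n : ℤ} {p : MvPolynomial (Fin c) S} :
    p ∈ evenGrading S c n ↔ ∀ a, p.coeff a ≠ 0 → 2 * (a.degree : ℤ) = n := by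
  simp only [MvPolynomial.mem_weightedHomogeneousSubmodule, MvPolynomial.IsWeightedHomogeneous,
    weight_two_eq]

lemma evenGrading_odd (n : ℤ) (hn : (n : ZMod 2) ≠ 0) : evenGrading K c n = ⊥ := by
  rw [eq_bot_iff]
  intro p hp
  rw [Submodule.mem_bot]
  ext a
  by_contra h
  refine hn ?_
  rw [← mem_evenGrading.mp hp a h]
  push_cast
  rw [show (2 : ZMod 2) = 0 from rfl, zero_mul]

lemma finite_degree_eq (n : ℤ) : {a : Fin c →₀ ℕ | 2 * (a.degree : ℤ) = n}.Finite :=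
  (Finsupp.finite_of_degree_eq n.toNat.div2).subset fun a (ha : _ = n) => by
    simp only [Set.mem_ofPred_eq, Nat.div2_val]
    omega

/-- The monomial basis of a graded piece of the polynomial ring. -/
noncomputable def evenGradingBasis (n : ℤ) :
    Basis {a : Fin c →₀ ℕ | 2 * (a.degree : ℤ) = n} K (evenGrading K c n) :=
  (MvPolynomial.basisRestrictSupport K _).map (LinearEquiv.ofEq _ _ (by
    simp only [evenGrading, MvPolynomial.weightedHomogeneousSubmodule_eq_finsupp_supported,
      weight_two_eq]
    rfl))

instance evenGrading_finite (n : ℤ) : FiniteDimensional K (evenGrading K c n) :=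
  have := (finite_degree_eq c n).to_subtype
  Module.Finite.of_basis (evenGradingBasis K c n)

lemma finrank_evenGrading (n : ℤ) : finrank K (evenGrading K c n) =
    Nat.card {a : Fin c →₀ ℕ | 2 * (a.degree : ℤ) = n} := by
  have := (finite_degree_eq c n).fintype
  rw [finrank_eq_card_basis (evenGradingBasis K c n), Nat.card_eq_fintype_card]

lemma finrank_evenGrading_two_mul (k : ℕ) :
    finrank K (evenGrading K (c + 1) (2 * k)) = (c + k).choose c := by
  have h : {a : Fin (c + 1) →₀ ℕ | 2 * (a.degree : ℤ) = 2 * k} =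
      (Finset.univ.finsuppAntidiag k : Finset (Fin (c + 1) →₀ ℕ)) := by
    ext a
    simp [Finsupp.degree_eq_sum]
    norm_cast
  rw [finrank_evenGrading, h, Nat.card_coe_set_eq, Set.ncard_coe_finset,
    Finset.card_finsuppAntidiag_nat_eq_choose, Finset.card_univ, Fintype.card_fin,
    show c + 1 + k - 1 = c + k by omega, ← Nat.choose_symm_add]

lemma hilbert_asymptotic : ∃ q : ZMod 2 → ℝ, q 0 ≠ 0 ∧
    ParityAsymptotic c (fun n => (finrank K (evenGrading K (c + 1) n) : ℝ)) q := by
  set r : ℝ := 1 / 2 ^ c / c.factorial with hr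
  have hr0 : 0 < r := by positivity
  refine ⟨fun e => if e = 0 then r else 0, by simp [hr0.ne'], ?_⟩
  have hlim : Tendsto (fun n : ℤ => r * (((n + 2 * c : ℤ) : ℝ) / (n : ℝ)) ^ c - r) atTop (𝓝 0) := by
    have := ((tendsto_shift_ratio (N := c) (2 * c)).const_mul r).sub_const r
    rwa [mul_one, sub_self] at this
  have hbound : ∀ᶠ n : ℤ in atTop,
      0 ≤ (finrank K (evenGrading K (c + 1) n) : ℝ) / (n : ℝ) ^ c -
        (if (n : ZMod 2) = 0 then r else 0) ∧
      (finrank K (evenGrading K (c + 1) n) : ℝ) / (n : ℝ) ^ c -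
        (if (n : ZMod 2) = 0 then r else 0) ≤ r * (((n + 2 * c : ℤ) : ℝ) / (n : ℝ)) ^ c - r := by
    filter_upwards [eventually_gt_atTop 0] with n hn0
    by_cases hn : (n : ZMod 2) = 0
    · obtain ⟨k, rfl⟩ : (2 : ℤ) ∣ n := (ZMod.intCast_zmod_eq_zero_iff_dvd n 2).mp hn
      lift k to ℕ using by omega
      have hk : (0 : ℝ) < k := by exact_mod_cast (by omega : 0 < k)
      rw [finrank_evenGrading_two_mul, if_pos hn]
      have h1 := Nat.pow_le_choose (α := ℝ) c (c + k)
      have h2 := Nat.choose_le_pow_div (α := ℝ) c (c + k)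
      rw [show c + k + 1 - c = k + 1 by omega] at h1
      have h3 : (k : ℝ) ^ c / c.factorial ≤ (c + k).choose c := by
        refine le_trans ?_ h1
        push_cast
        gcongr
        linarith
      constructor
      · rw [sub_nonneg, le_div_iff₀ (by positivity)]
        refine le_trans (le_of_eq ?_) h3
        push_cast
        rw [hr, mul_pow]
        field_simp
      · refine sub_le_sub_right ?_ _
        rw [div_le_iff₀ (by positivity)]
        refine h2.trans (le_of_eq ?_)
        push_cast
        rw [hr, div_pow, show (2 * (k : ℝ) + 2 * c) = 2 * (c + k) by ring, mul_pow, mul_pow]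
        field_simp
    · rw [evenGrading_odd K (c + 1) n hn, finrank_bot, if_neg hn]
      have hnR : (0 : ℝ) < n := by exact_mod_cast hn0
      have : (1 : ℝ) ≤ (((n + 2 * c : ℤ) : ℝ) / (n : ℝ)) ^ c := by
        refine one_le_pow₀ ?_
        rw [one_le_div hnR]
        push_cast
        linarith [(Nat.cast_nonneg c : (0 : ℝ) ≤ c)]
      constructor
      · simp
      · have := mul_le_mul_of_nonneg_left this hr0.le
        simp only [Nat.cast_zero, zero_div, sub_zero]
        linarith
  exact squeeze_zero' (hbound.mono fun _ h => h.1) (hbound.mono fun _ h => h.2) hlim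

/-- The Hilbert function has asymptotics at every exponent at least the number of variables minus
one. -/
lemma exists_hilbert_asymptotic {N : ℕ} (hN : c ≤ N + 1) : ∃ q : ZMod 2 → ℝ,
    ParityAsymptotic N (fun n => (finrank K (evenGrading K c n) : ℝ)) q := by
  rcases c with _ | c
  · refine ⟨fun _ => 0, tendsto_const_nhds.congr' ?_⟩
    filter_upwards [eventually_gt_atTop 0] with n hn
    have : finrank K (evenGrading K 0 n) = 0 := by
      rw [finrank_evenGrading, Nat.card_eq_zero]
      left
      refine ⟨fun a => ?_⟩
      have := a.2
      simp only [Set.mem_ofPred_eq, Subsingleton.elim a.1 0, map_zero] at this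
      simp at this
      omega
    simp [this]
  · obtain ⟨q, -, hq⟩ := hilbert_asymptotic K c
    rcases (by omega : c = N ∨ c < N) with rfl | h
    · exact ⟨q, hq⟩
    · refine ⟨fun _ => 0, PolynomiallyBounded.asymptotic_zero (N := c) ?_ (fun _ => by positivity) h⟩
      refine ⟨max (q 0) (q 1) + 1, ?_⟩
      filter_upwards [eventually_gt_atTop 0, Tendsto.eventually hq (Iio_mem_nhds one_pos)]
        with n hn h
      have hn0 : (0 : ℝ) < (n : ℝ) ^ c := pow_pos (by exact_mod_cast hn) _
      rw [← div_le_iff₀ hn0]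
      have : q n ≤ max (q 0) (q 1) := by
        generalize (n : ZMod 2) = e
        fin_cases e
        · exact le_max_left _ _
        · exact le_max_right _ _
      linarith

end HilbertFunction

section Shamash

variable {A P ι : Type*} [CommRing A] [AddCommGroup P] [Module A P] {c : ℕ}

/-- The ideal generated by the first `j` terms of a sequence. -/
def initialIdeal (f : Fin c → A) (j : ℕ) : Ideal A := Ideal.span (f '' {l | (l : ℕ) < j})

lemma initialIdeal_mono (f : Fin c → A) {j k : ℕ} (h : j ≤ k) :
    initialIdeal f j ≤ initialIdeal f k :=
  Ideal.span_mono (Set.image_mono fun _ hl => lt_of_lt_of_le hl h)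

lemma mem_initialIdeal (f : Fin c → A) {j : ℕ} {l : Fin c} (h : (l : ℕ) < j) :
    f l ∈ initialIdeal f j :=
  Ideal.subset_span ⟨l, h, rfl⟩

lemma initialIdeal_zero (f : Fin c → A) : initialIdeal f 0 = ⊥ := by
  simp [initialIdeal]

lemma initialIdeal_top (f : Fin c → A) : initialIdeal f c = Ideal.span (Set.range f) := by
  simp [initialIdeal]

lemma exists_sub_mul_mem_of_mem_initialIdeal_succ (f : Fin c → A) (j : Fin c) {x : A}
    (hx : x ∈ initialIdeal f (j + 1)) : ∃ y, x - f j * y ∈ initialIdeal f j := by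
  have h : f '' {l | (l : ℕ) < j + 1} = insert (f j) (f '' {l | (l : ℕ) < j}) := by
    rw [← Set.image_insert_eq]
    congr 1
    ext l
    simp only [Set.mem_ofPred_eq, Set.mem_insert_iff, Fin.ext_iff]
    omega
  rw [initialIdeal, h] at hx
  obtain ⟨y, z, hz, rfl⟩ := Ideal.mem_span_insert.mp hx
  exact ⟨y, by rwa [mul_comm y, add_sub_cancel_left]⟩

/-- The degree of a generator times a monomial in variables of degree two. -/
noncomputable abbrev shamashDegree (w : ι → ℤ) (κ : ι × (Fin c →₀ ℕ)) : ℤ := w κ.1 + 2 * (κ.2.degree : ℤ)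

/-- The data of a square root of `∑ f l • χ l` on a free module over a polynomial ring. -/
structure IsHypersurfaceFactorization (f : Fin c → A) (w : ι → ℤ)
    (b : Basis (ι × (Fin c →₀ ℕ)) A P) (χ : Fin c → P →ₗ[A] P) (T : P →ₗ[A] P) : Prop where
  basis_mul : ∀ l i a, χ l (b (i, a)) = b (i, a + Finsupp.single l 1)
  comm : ∀ l p, T (χ l p) = χ l (T p)
  square : ∀ p, T (T p) = ∑ l, f l • χ l p
  homogeneous : ∀ κ, T (b κ) ∈
    Submodule.span A (b '' {κ' | shamashDegree w κ' = shamashDegree w κ + 1})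

variable {f : Fin c → A} {w : ι → ℤ} {b : Basis (ι × (Fin c →₀ ℕ)) A P}
  {χ : Fin c → P →ₗ[A] P} {T : P →ₗ[A] P}

/-- A functional supported in degree `m` and annihilating the variables with index at least `j`. -/
structure IsShamashFunctional (w : ι → ℤ) (b : Basis (ι × (Fin c →₀ ℕ)) A P) (j : ℕ) (m : ℤ)
    (z : P →ₗ[A] A) : Prop where
  degree : ∀ κ, shamashDegree w κ ≠ m → z (b κ) = 0
  kills : ∀ κ (l : Fin c), j ≤ (l : ℕ) → κ.2 l ≠ 0 → z (b κ) = 0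

lemma mem_ideal_of_basis (I : Ideal A) (z : P →ₗ[A] A) (h : ∀ κ, z (b κ) ∈ I) (p : P) :
    z p ∈ I := by
  have : (⊤ : Submodule A P) ≤ Submodule.comap z I := by
    rw [← b.span_eq, Submodule.span_le]
    rintro _ ⟨κ, rfl⟩
    exact h κ
  exact this Submodule.mem_top

lemma exists_eq_mul_basis (hT : IsHypersurfaceFactorization f w b χ T) (κ : ι × (Fin c →₀ ℕ))
    (l : Fin c) (h : κ.2 l ≠ 0) :
    χ l (b (κ.1, κ.2 - Finsupp.single l 1)) = b κ := by
  rw [hT.basis_mul, tsub_add_cancel_of_le (by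
    rw [Finsupp.single_le_iff]
    omega)]

lemma IsShamashFunctional.comp_mul (hT : IsHypersurfaceFactorization f w b χ T) {j : ℕ} {m : ℤ}
    {z : P →ₗ[A] A} (hz : IsShamashFunctional w b j m z) {l : Fin c} (hl : j ≤ (l : ℕ)) (p : P) :
    z (χ l p) = 0 := by
  have : z ∘ₗ χ l = 0 := b.ext fun κ => by
    rw [LinearMap.comp_apply, show κ = (κ.1, κ.2) from rfl, hT.basis_mul]
    exact hz.kills _ l hl (by simp)
  exact LinearMap.congr_fun this p

lemma IsShamashFunctional.comp (hT : IsHypersurfaceFactorization f w b χ T) {j : ℕ} {m : ℤ}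
    {z : P →ₗ[A] A} (hz : IsShamashFunctional w b j (m + 1) z) :
    IsShamashFunctional w b j m (z ∘ₗ T) := by
  constructor
  · intro κ hκ
    have : Submodule.span A (b '' {κ' | shamashDegree w κ' = shamashDegree w κ + 1}) ≤
        LinearMap.ker z := by
      rw [Submodule.span_le]
      rintro _ ⟨κ', h, rfl⟩
      have h : shamashDegree w κ' = shamashDegree w κ + 1 := h
      exact hz.degree κ' (by rw [h]; simpa using hκ)
    exact this (hT.homogeneous κ)
  · intro κ l hl h
    rw [← exists_eq_mul_basis hT κ l h, LinearMap.comp_apply, hT.comm, hz.comp_mul hT hl]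

lemma IsShamashFunctional.sub {j : ℕ} {m : ℤ} {z z' : P →ₗ[A] A}
    (hz : IsShamashFunctional w b j m z) (hz' : IsShamashFunctional w b j m z') :
    IsShamashFunctional w b j m (z - z') :=
  ⟨fun κ h => by simp [hz.degree κ h, hz'.degree κ h],
    fun κ l hl h => by simp [hz.kills κ l hl h, hz'.kills κ l hl h]⟩

lemma IsShamashFunctional.add {j : ℕ} {m : ℤ} {z z' : P →ₗ[A] A}
    (hz : IsShamashFunctional w b j m z) (hz' : IsShamashFunctional w b j m z') :
    IsShamashFunctional w b j m (z + z') :=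
  ⟨fun κ h => by simp [hz.degree κ h, hz'.degree κ h],
    fun κ l hl h => by simp [hz.kills κ l hl h, hz'.kills κ l hl h]⟩

lemma IsShamashFunctional.mono {j k : ℕ} (hjk : j ≤ k) {m : ℤ} {z : P →ₗ[A] A}
    (hz : IsShamashFunctional w b j m z) : IsShamashFunctional w b k m z :=
  ⟨hz.degree, fun κ l hl h => hz.kills κ l (hjk.trans hl) h⟩

/-- Exactness of the Shamash construction, adjoining the variables one at a time. -/
theorem shamash_exact (hT : IsHypersurfaceFactorization f w b χ T)
    (hreg : ∀ (j : Fin c) x, f j * x ∈ initialIdeal f j → x ∈ initialIdeal f j)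
    (hbase : ∀ (m : ℤ) (z : P →ₗ[A] A), 0 < m → IsShamashFunctional w b 0 m z → z ∘ₗ T = 0 →
      ∃ y, IsShamashFunctional w b 0 (m + 1) y ∧ z = y ∘ₗ T)
    (j : ℕ) (hj : j ≤ c) (m : ℤ) (hm : 0 < m) (z : P →ₗ[A] A) (hz : IsShamashFunctional w b j m z)
    (hzT : ∀ p, z (T p) ∈ initialIdeal f j) :
    ∃ y, IsShamashFunctional w b j (m + 1) y ∧ ∀ p, z p - y (T p) ∈ initialIdeal f j := by
  classical
  induction j generalizing z with
  | zero =>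
    simp only [initialIdeal_zero, Submodule.mem_bot] at hzT
    obtain ⟨y, hy, h⟩ := hbase m z hm hz (LinearMap.ext hzT)
    refine ⟨y, hy, fun p => ?_⟩
    rw [h]
    simp
  | succ j ih =>
    obtain ⟨j, rfl⟩ : ∃ j' : Fin c, (j' : ℕ) = j := ⟨⟨j, by omega⟩, rfl⟩
    have hzT' : IsShamashFunctional w b (j + 1) (m - 1) (z ∘ₗ T) :=
      IsShamashFunctional.comp hT (by rwa [sub_add_cancel])
    have hex : ∀ κ, ∃ y, z (T (b κ)) - f j * y ∈ initialIdeal f j ∧ (z (T (b κ)) = 0 → y = 0) := by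
      intro κ
      by_cases h : z (T (b κ)) = 0
      · exact ⟨0, by simp [h], fun _ => rfl⟩
      · obtain ⟨y, hy⟩ := exists_sub_mul_mem_of_mem_initialIdeal_succ f j (hzT (b κ))
        exact ⟨y, hy, fun h' => absurd h' h⟩
    choose y hy hy0 using hex
    set W : P →ₗ[A] A := b.constr A y with hW
    have hWb : ∀ κ, W (b κ) = y κ := fun κ => b.constr_basis A y κ
    have hWs : IsShamashFunctional w b (j + 1) (m - 1) W :=
      ⟨fun κ h => by rw [hWb, hy0 κ (hzT'.degree κ h)],
        fun κ l hl h => by rw [hWb, hy0 κ (hzT'.kills κ l hl h)]⟩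
    have hzW : ∀ p, z (T p) - f j * W p ∈ initialIdeal f j := fun p =>
      mem_ideal_of_basis (b := b) _ (z ∘ₗ T - f j • W) (fun κ => by simpa [hWb] using hy κ) p
    have hsq : ∀ {n : ℤ} (g : P →ₗ[A] A), IsShamashFunctional w b (j + 1) n g → ∀ p,
        g (T (T p)) - f j * g (χ j p) ∈ initialIdeal f j := by
      intro n g hg p
      rw [hT.square, map_sum, ← Finset.sum_erase_add _ _ (Finset.mem_univ j), map_smul,
        smul_eq_mul, add_sub_cancel_right]
      refine Submodule.sum_mem _ fun l hl => ?_
      rw [map_smul, smul_eq_mul]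
      rcases lt_or_ge (l : ℕ) j with h | h
      · exact Ideal.mul_mem_right _ _ (mem_initialIdeal f h)
      · have : (l : ℕ) ≠ j := fun h => Finset.ne_of_mem_erase hl (Fin.ext h)
        rw [hg.comp_mul hT (by omega), mul_zero]
        exact zero_mem _
    have hWz : ∀ p, W (T p) - z (χ j p) ∈ initialIdeal f j := by
      intro p
      apply hreg
      have := sub_mem (hsq z hz p) (hzW (T p))
      convert this using 1
      ring
    set u : P →ₗ[A] A := b.constr A fun κ =>
      if κ.2 j = 0 then 0 else W (b (κ.1, κ.2 - Finsupp.single j 1)) with hu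
    have hub : ∀ κ, u (b κ) = if κ.2 j = 0 then 0 else W (b (κ.1, κ.2 - Finsupp.single j 1)) :=
      fun κ => b.constr_basis A _ κ
    have huχ : ∀ p, u (χ j p) = W p := fun p => by
      have : u ∘ₗ χ j = W := b.ext fun κ => by
        rw [LinearMap.comp_apply, show κ = (κ.1, κ.2) from rfl, hT.basis_mul, hub, if_neg (by simp)]
        simp
      exact LinearMap.congr_fun this p
    have hus : IsShamashFunctional w b (j + 1) (m + 1) u := by
      constructor
      · intro κ h
        rw [hub]
        split_ifs with h0
        · rfl
        · refine hWs.degree _ fun h' => h ?_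
          have : κ.2 = (κ.2 - Finsupp.single j 1) + Finsupp.single j 1 :=
            (tsub_add_cancel_of_le (by rw [Finsupp.single_le_iff]; omega)).symm
          have h2 : κ.2.degree = (κ.2 - Finsupp.single j 1).degree + 1 := by
            conv_lhs => rw [this]
            rw [map_add, Finsupp.degree_single]
          simp only [shamashDegree] at h' ⊢
          rw [h2]
          push_cast
          linarith
      · intro κ l hl h
        rw [hub]
        split_ifs with h0
        · rfl
        · refine hWs.kills _ l hl ?_
          have : j ≠ l := fun h => by simp [h] at hl
          simpa [Finsupp.single_apply, this] using h
    set z' : P →ₗ[A] A := z - u ∘ₗ T with hz'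
    have hz's : IsShamashFunctional w b (j + 1) m z' := hz.sub (hus.comp hT)
    have hz'χ : ∀ p, z' (χ j p) ∈ initialIdeal f j := fun p => by
      rw [hz', LinearMap.sub_apply, LinearMap.comp_apply, hT.comm, huχ, ← neg_sub]
      exact neg_mem (hWz p)
    have hz'T : ∀ p, z' (T p) ∈ initialIdeal f j := fun p => by
      rw [hz', LinearMap.sub_apply, LinearMap.comp_apply]
      have := sub_mem (hzW p) (hsq u hus p)
      rw [huχ] at this
      convert this using 1
      ring
    set v : P →ₗ[A] A := b.constr A fun κ => if κ.2 j = 0 then 0 else z' (b κ) with hv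
    have hvb : ∀ κ, v (b κ) = if κ.2 j = 0 then 0 else z' (b κ) := fun κ => b.constr_basis A _ κ
    have hvI : ∀ p, v p ∈ initialIdeal f j := mem_ideal_of_basis (b := b) _ v fun κ => by
      rw [hvb]
      split_ifs with h
      · exact zero_mem _
      · rw [← exists_eq_mul_basis hT κ j h]
        exact hz'χ _
    have hz''s : IsShamashFunctional w b j m (z' - v) := by
      constructor
      · intro κ h
        simp [hvb, hz's.degree κ h]
      · intro κ l hl h
        rw [LinearMap.sub_apply, hvb]
        split_ifs with h0
        · rw [sub_zero]
          refine hz's.kills κ l ?_ h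
          have : (l : ℕ) ≠ j := fun h' => h (by rw [Fin.ext h', h0])
          omega
        · exact sub_self _
    obtain ⟨y', hy's, hy'⟩ := ih (by omega) (z' - v) hz''s fun p => by
      rw [LinearMap.sub_apply]
      exact sub_mem (hz'T p) (hvI _)
    refine ⟨u + y', hus.add (hy's.mono (Nat.le_succ _)), fun p =>
      initialIdeal_mono f (Nat.le_succ _) ?_⟩
    have := add_mem (hy' p) (hvI p)
    convert this using 1
    simp [hz']
    ring

end Shamash

section Betti

variable {B : Type*} [CommRing B]

/-- Schanuel's lemma. -/
lemma schanuel {P Q L : Type*} [AddCommGroup P] [Module B P] [AddCommGroup Q] [Module B Q]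
    [AddCommGroup L] [Module B L] [Module.Projective B P] [Module.Projective B Q]
    (f : P →ₗ[B] L) (g : Q →ₗ[B] L) (hf : Function.Surjective f) (hg : Function.Surjective g) :
    Nonempty ((LinearMap.ker f × Q) ≃ₗ[B] (LinearMap.ker g × P)) := by
  obtain ⟨h, hh⟩ := Module.projective_lifting_property g f hg
  obtain ⟨k, hk⟩ := Module.projective_lifting_property f g hf
  have hh' : ∀ p, g (h p) = f p := fun p => LinearMap.congr_fun hh p
  have hk' : ∀ q, f (k q) = g q := fun q => LinearMap.congr_fun hk q
  exact ⟨{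
    toFun := fun x => (⟨x.2 - h (x.1 + k x.2), by simp [hh', hk', LinearMap.mem_ker.mp x.1.2]⟩,
      x.1 + k x.2)
    invFun := fun y => (⟨y.2 - k (y.1 + h y.2), by simp [hh', hk', LinearMap.mem_ker.mp y.1.2]⟩,
      y.1 + h y.2)
    map_add' := fun x y => by
      refine Prod.ext (Subtype.ext ?_) ?_
      · simp; abel
      · simp; abel
    map_smul' := fun r x => by
      refine Prod.ext (Subtype.ext ?_) ?_
      · simp [smul_sub]
      · simp
    left_inv := fun x => by
      refine Prod.ext (Subtype.ext ?_) ?_ <;> simp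
    right_inv := fun x => by
      refine Prod.ext (Subtype.ext ?_) ?_ <;> simp }⟩

/-- Adding an identity map does not change the kernel. -/
lemma kerProdMapEquiv {F L U V : Type*} [AddCommGroup F] [Module B F] [AddCommGroup L] [Module B L]
    [AddCommGroup U] [Module B U] [AddCommGroup V] [Module B V] (f : F →ₗ[B] L)
    (e : (L × U) ≃ₗ[B] V) :
    Nonempty (LinearMap.ker f ≃ₗ[B] LinearMap.ker (e.toLinearMap ∘ₗ f.prodMap .id)) :=
  ⟨{ toFun := fun x => ⟨(x, 0), by simp⟩
     invFun := fun y => ⟨y.1.1, by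
       have := y.2
       simp at this
       exact this.1⟩
     map_add' := fun x y => by ext <;> simp
     map_smul' := fun x y => by ext <;> simp
     left_inv := fun x => rfl
     right_inv := fun y => by
       have := y.2
       simp at this
       ext
       · rfl
       · exact this.2.symm }⟩

/-- Syzygies of stably isomorphic modules are stably isomorphic. -/
lemma stable_syzygy [Nontrivial B] {F G L L' : Type*} [AddCommGroup F] [Module B F]
    [AddCommGroup G] [Module B G]
    [AddCommGroup L] [Module B L] [AddCommGroup L'] [Module B L'] [Module.Free B F]
    [Module.Finite B F] [Module.Free B G] [Module.Finite B G] (f : F →ₗ[B] L) (g : G →ₗ[B] L')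
    (hf : Function.Surjective f) (hg : Function.Surjective g) {a b : ℕ}
    (e : (L × (Fin a → B)) ≃ₗ[B] (L' × (Fin b → B))) :
    Nonempty ((LinearMap.ker f × (Fin (finrank B G + b) → B)) ≃ₗ[B]
      (LinearMap.ker g × (Fin (finrank B F + a) → B))) := by
  obtain ⟨e1⟩ := kerProdMapEquiv f e
  obtain ⟨e2⟩ := kerProdMapEquiv g (LinearEquiv.refl B (L' × (Fin b → B)))
  obtain ⟨s⟩ := schanuel (e.toLinearMap ∘ₗ f.prodMap .id)
    ((LinearEquiv.refl B (L' × (Fin b → B))).toLinearMap ∘ₗ g.prodMap .id)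
    (e.surjective.comp (hf.prodMap Function.surjective_id))
    ((LinearEquiv.refl B (L' × (Fin b → B))).surjective.comp
      (hg.prodMap Function.surjective_id))
  have e3 : (Fin (finrank B G + b) → B) ≃ₗ[B] (G × (Fin b → B)) :=
    LinearEquiv.ofFinrankEq _ _ (by simp [finrank_prod])
  have e4 : (F × (Fin a → B)) ≃ₗ[B] (Fin (finrank B F + a) → B) :=
    LinearEquiv.ofFinrankEq _ _ (by simp [finrank_prod])
  exact ⟨(e1.prodCongr e3).trans (s.trans (e2.symm.prodCongr e4))⟩

variable (B) (K : Type*) [Field K] [Algebra B K]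

/-- The number of generators of a module after base change to a field. -/
noncomputable def fieldRank (L : Type*) [AddCommGroup L] [Module B L] : ℕ := finrank K (K ⊗[B] L)

variable {B}

/-- The rank of a linear map after base change to a field. -/
noncomputable def mapFieldRank {F G : Type*} [AddCommGroup F] [Module B F] [AddCommGroup G]
    [Module B G] (d : F →ₗ[B] G) : ℕ := finrank K (LinearMap.range (d.baseChange K))

lemma fieldRank_congr {L L' : Type*} [AddCommGroup L] [Module B L] [AddCommGroup L'] [Module B L']
    (e : L ≃ₗ[B] L') : fieldRank B K L = fieldRank B K L' :=
  (e.baseChange B K L L').finrank_eq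

lemma fieldRank_prod {L : Type*} [AddCommGroup L] [Module B L] [Module.Finite B L] (a : ℕ) :
    fieldRank B K (L × (Fin a → B)) = fieldRank B K L + a := by
  rw [fieldRank, fieldRank, (TensorProduct.prodRight B K K L (Fin a → B)).finrank_eq,
    finrank_prod, (TensorProduct.piScalarRight B K K (Fin a)).finrank_eq]
  simp

lemma fieldRank_add_mapFieldRank [Nontrivial B] {F' F L : Type*} [AddCommGroup F'] [Module B F']
    [AddCommGroup F] [Module B F] [AddCommGroup L] [Module B L] [Module.Free B F]
    [Module.Finite B F] (d : F' →ₗ[B] F) (ε : F →ₗ[B] L) (hε : Function.Surjective ε)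
    (h : LinearMap.ker ε = LinearMap.range d) :
    fieldRank B K L + mapFieldRank K d = finrank B F := by
  have hex : Function.Exact (d.baseChange K) (ε.baseChange K) :=
    lTensor_exact K (LinearMap.exact_iff.mpr h) hε
  have hsurj : Function.Surjective (ε.baseChange K) := LinearMap.lTensor_surjective K hε
  have h1 := (ε.baseChange K).finrank_range_add_finrank_ker
  rw [LinearMap.range_eq_top.mpr hsurj, finrank_top, LinearMap.exact_iff.mp hex,
    finrank_baseChange (R := K) (S := B) (M' := F)] at h1
  exact h1

variable [Nontrivial B] {M : Type*} [AddCommGroup M] [Module B M]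
  {F : ℕ → Type*} {G : ℕ → Type*} [∀ n, AddCommGroup (F n)] [∀ n, Module B (F n)]
  [∀ n, AddCommGroup (G n)] [∀ n, Module B (G n)]
  [∀ n, Module.Free B (F n)] [∀ n, Module.Finite B (F n)]
  [∀ n, Module.Free B (G n)] [∀ n, Module.Finite B (G n)]
  (d : ∀ n, F (n + 1) →ₗ[B] F n) (ε : F 0 →ₗ[B] M) (δ : ∀ n, G (n + 1) →ₗ[B] G n)
  (η : G 0 →ₗ[B] M)

/-- The syzygies in two free resolutions of the same module are stably isomorphic. -/
lemma stable_syzygies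
    (hε : Function.Surjective ε) (hd0 : LinearMap.ker ε = LinearMap.range (d 0))
    (hd : ∀ n, LinearMap.ker (d n) = LinearMap.range (d (n + 1)))
    (hη : Function.Surjective η) (hδ0 : LinearMap.ker η = LinearMap.range (δ 0))
    (hδ : ∀ n, LinearMap.ker (δ n) = LinearMap.range (δ (n + 1))) (n : ℕ) :
    ∃ a b, Nonempty ((LinearMap.range (d n) × (Fin a → B)) ≃ₗ[B]
      (LinearMap.range (δ n) × (Fin b → B))) := by
  induction n with
  | zero =>
    obtain ⟨e⟩ := stable_syzygy ε η hε hη (LinearEquiv.refl B (M × (Fin 0 → B)))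
    rw [hd0, hδ0] at e
    exact ⟨_, _, ⟨e⟩⟩
  | succ n ih =>
    obtain ⟨a, b, ⟨e⟩⟩ := ih
    obtain ⟨e⟩ := stable_syzygy (d n).rangeRestrict (δ n).rangeRestrict
      (d n).surjective_rangeRestrict (δ n).surjective_rangeRestrict e
    rw [LinearMap.ker_rangeRestrict, LinearMap.ker_rangeRestrict, hd, hδ] at e
    exact ⟨_, _, ⟨e⟩⟩

/-- The dimensions of the homology of a free resolution after base change to a field do not depend
on the resolution. -/
theorem betti_comparison
    (hε : Function.Surjective ε) (hd0 : LinearMap.ker ε = LinearMap.range (d 0))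
    (hd : ∀ n, LinearMap.ker (d n) = LinearMap.range (d (n + 1)))
    (hη : Function.Surjective η) (hδ0 : LinearMap.ker η = LinearMap.range (δ 0))
    (hδ : ∀ n, LinearMap.ker (δ n) = LinearMap.range (δ (n + 1))) :
    (finrank B (F 0) + mapFieldRank K (δ 0) = finrank B (G 0) + mapFieldRank K (d 0)) ∧
    ∀ n, finrank B (F (n + 1)) + mapFieldRank K (δ n) + mapFieldRank K (δ (n + 1)) =
      finrank B (G (n + 1)) + mapFieldRank K (d n) + mapFieldRank K (d (n + 1)) := by
  have h0 := fieldRank_add_mapFieldRank K (d 0) ε hε hd0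
  have h0' := fieldRank_add_mapFieldRank K (δ 0) η hη hδ0
  have hs := fun n => fieldRank_add_mapFieldRank K (d (n + 1)) (d n).rangeRestrict
    (d n).surjective_rangeRestrict (by rw [LinearMap.ker_rangeRestrict, hd])
  have hs' := fun n => fieldRank_add_mapFieldRank K (δ (n + 1)) (δ n).rangeRestrict
    (δ n).surjective_rangeRestrict (by rw [LinearMap.ker_rangeRestrict, hδ])
  refine ⟨by omega, fun n => ?_⟩
  rcases n with _ | n
  · obtain ⟨e⟩ := stable_syzygy ε η hε hη (LinearEquiv.refl B (M × (Fin 0 → B)))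
    rw [hd0, hδ0] at e
    have := fieldRank_congr K e
    rw [fieldRank_prod, fieldRank_prod] at this
    have := hs 0
    have := hs' 0
    omega
  · obtain ⟨a, b, ⟨e⟩⟩ := stable_syzygies d ε δ η hε hd0 hd hη hδ0 hδ n
    have h1 := fieldRank_congr K e
    obtain ⟨e'⟩ := stable_syzygy (d n).rangeRestrict (δ n).rangeRestrict
      (d n).surjective_rangeRestrict (δ n).surjective_rangeRestrict e
    rw [LinearMap.ker_rangeRestrict, LinearMap.ker_rangeRestrict, hd, hδ] at e'
    have h2 := fieldRank_congr K e'
    rw [fieldRank_prod, fieldRank_prod] at h1 h2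
    have := hs n
    have := hs' n
    have := hs (n + 1)
    have := hs' (n + 1)
    omega

end Betti

section ShamashMatrix

variable {A ι : Type*} [CommRing A] [Fintype ι] {c : ℕ}

/-- The monomial basis of a free module over a polynomial ring. -/
noncomputable def polyBasis (A ι : Type*) [CommRing A] [Fintype ι] (c : ℕ) :
    Basis (ι × (Fin c →₀ ℕ)) A (ι → MvPolynomial (Fin c) A) :=
  (Pi.basis fun _ => MvPolynomial.basisMonomials (Fin c) A).reindex (Equiv.sigmaEquivProd ι _)

lemma polyBasis_apply [DecidableEq ι] (κ : ι × (Fin c →₀ ℕ)) :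
    polyBasis A ι c κ = Pi.single κ.1 (MvPolynomial.monomial κ.2 1) := by
  classical
  simp only [polyBasis, Basis.reindex_apply, Equiv.sigmaEquivProd_symm_apply, Pi.basis_apply,
    MvPolynomial.coe_basisMonomials]

lemma polyBasis_repr (p : ι → MvPolynomial (Fin c) A) (κ : ι × (Fin c →₀ ℕ)) :
    (polyBasis A ι c).repr p κ = (p κ.1).coeff κ.2 := by
  classical
  simp [polyBasis, Pi.basis_repr]
  rfl

lemma mem_span_polyBasis (s : Set (ι × (Fin c →₀ ℕ))) (p : ι → MvPolynomial (Fin c) A) :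
    p ∈ Submodule.span A (polyBasis A ι c '' s) ↔ ∀ κ, (p κ.1).coeff κ.2 ≠ 0 → κ ∈ s := by
  rw [Basis.mem_span_image]
  simp only [← polyBasis_repr]
  constructor
  · intro h κ hκ
    exact h (by simpa using hκ)
  · intro h κ hκ
    exact h κ (by simpa using hκ)

/-- A square matrix with square `∑ f l * X l` on homogeneous generators. -/
structure IsCurvedDifferential (f : Fin c → A) (w : ι → ℤ)
    (X : Matrix ι ι (MvPolynomial (Fin c) A)) : Prop where
  homogeneous : ∀ i j, X i j ∈ evenGrading A c (w j - w i + 1)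
  square : ∀ p : ι → MvPolynomial (Fin c) A,
    X.mulVec (X.mulVec p) = (∑ l, MvPolynomial.C (f l) * MvPolynomial.X l) • p

lemma IsCurvedDifferential.isHypersurfaceFactorization {f : Fin c → A} {w : ι → ℤ}
    {X : Matrix ι ι (MvPolynomial (Fin c) A)} (hX : IsCurvedDifferential f w X) :
    IsHypersurfaceFactorization f w (polyBasis A ι c)
      (fun l => (LinearMap.lsmul (MvPolynomial (Fin c) A) (ι → MvPolynomial (Fin c) A)
        (MvPolynomial.X l)).restrictScalars A)
      (X.mulVecLin.restrictScalars A) := by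
  classical
  constructor
  · intro l i a
    simp only [polyBasis_apply, LinearMap.coe_restrictScalars, LinearMap.lsmul_apply]
    rw [← Pi.single_smul, smul_eq_mul, MvPolynomial.X, MvPolynomial.monomial_mul, one_mul, add_comm]
  · intro l p
    simp
  · intro p
    simp only [LinearMap.coe_restrictScalars, Matrix.mulVecLin_apply, hX.square,
      LinearMap.lsmul_apply, Finset.sum_smul, ← MvPolynomial.smul_eq_C_mul, smul_assoc]
  · intro κ
    rw [mem_span_polyBasis]
    intro κ' h
    simp only [LinearMap.coe_restrictScalars, Matrix.mulVecLin_apply, polyBasis_apply,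
      Matrix.mulVec_single, Pi.smul_apply, MulOpposite.smul_eq_mul_unop, MulOpposite.unop_op,
      Matrix.col_apply] at h
    rw [MvPolynomial.coeff_mul_monomial'] at h
    split_ifs at h with hle
    · rw [mul_one] at h
      have := mem_evenGrading.mp (hX.homogeneous _ _) _ h
      have h2 : κ'.2.degree = (κ'.2 - κ.2).degree + κ.2.degree := by
        rw [← map_add, tsub_add_cancel_of_le hle]
      simp only [Set.mem_ofPred_eq, shamashDegree]
      rw [h2]
      push_cast
      linarith
    · exact absurd rfl h

end ShamashMatrix

section ShamashResolution

variable {A ι : Type*} [CommRing A] [Fintype ι] {c : ℕ}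

/-- The generators of degree `n` of the Shamash resolution. -/
abbrev ShamashIndex (c : ℕ) (w : ι → ℤ) (n : ℤ) : Type _ :=
  {κ : ι × (Fin c →₀ ℕ) // shamashDegree w κ = n}

instance shamashIndex_finite (w : ι → ℤ) (n : ℤ) : Finite (ShamashIndex c w n) := by
  have hf : (⋃ i : ι, Prod.mk i '' {a : Fin c →₀ ℕ | 2 * (a.degree : ℤ) = n - w i}).Finite :=
    Set.finite_iUnion fun i => (finite_degree_eq c _).image _
  refine (hf.subset ?_).to_subtype
  rintro ⟨i, a⟩ h
  simp only [Set.mem_iUnion]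
  refine ⟨i, a, ?_, rfl⟩
  have h : w i + 2 * (a.degree : ℤ) = n := h
  simp only [Set.mem_ofPred_eq]
  linarith

noncomputable instance (w : ι → ℤ) (n : ℤ) : Fintype (ShamashIndex c w n) := Fintype.ofFinite _

/-- The matrix entry of multiplication by `X` in the monomial bases. -/
noncomputable def shamashEntry (X : Matrix ι ι (MvPolynomial (Fin c) A))
    (κ κ' : ι × (Fin c →₀ ℕ)) : A :=
  (X κ'.1 κ.1 * MvPolynomial.monomial κ.2 1).coeff κ'.2

lemma shamashEntry_eq_repr (X : Matrix ι ι (MvPolynomial (Fin c) A))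
    (κ κ' : ι × (Fin c →₀ ℕ)) :
    shamashEntry X κ κ' =
      (polyBasis A ι c).repr (X.mulVecLin.restrictScalars A (polyBasis A ι c κ)) κ' := by
  classical
  rw [polyBasis_repr, polyBasis_apply]
  simp [shamashEntry]

lemma shamashEntry_map {A' : Type*} [CommRing A'] (g : A →+* A')
    (X : Matrix ι ι (MvPolynomial (Fin c) A)) (κ κ' : ι × (Fin c →₀ ℕ)) :
    shamashEntry (X.map (MvPolynomial.map g)) κ κ' = g (shamashEntry X κ κ') := by
  rw [shamashEntry, shamashEntry, ← MvPolynomial.coeff_map, map_mul, MvPolynomial.map_monomial,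
    g.map_one, Matrix.map_apply]

lemma shamashEntry_eq_zero {f : Fin c → A} {w : ι → ℤ} {X : Matrix ι ι (MvPolynomial (Fin c) A)}
    (hX : IsCurvedDifferential f w X) {κ κ' : ι × (Fin c →₀ ℕ)}
    (h : shamashDegree w κ' ≠ shamashDegree w κ + 1) : shamashEntry X κ κ' = 0 := by
  by_contra h0
  rw [shamashEntry_eq_repr, polyBasis_repr] at h0
  exact h ((mem_span_polyBasis _ _).mp (hX.isHypersurfaceFactorization.homogeneous κ) κ' h0)

/-- The differential of the Shamash resolution. -/
noncomputable def shamashMap (B : Type*) [CommRing B] [Algebra A B] (w : ι → ℤ)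
    (X : Matrix ι ι (MvPolynomial (Fin c) A)) (n m : ℤ) :
    (ShamashIndex c w m → B) →ₗ[B] (ShamashIndex c w n → B) :=
  Matrix.mulVecLin (Matrix.of fun κ κ' => algebraMap A B (shamashEntry X κ.1 κ'.1))

variable {B : Type*} [CommRing B] [Algebra A B] {f : Fin c → A} {w : ι → ℤ}
  {X : Matrix ι ι (MvPolynomial (Fin c) A)}

lemma functional_apply (hX : IsCurvedDifferential f w X) {n m : ℤ} (hm : m = n + 1)
    (y : (ι → MvPolynomial (Fin c) A) →ₗ[A] A) (κ : ShamashIndex c w n) :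
    algebraMap A B (y (X.mulVec (polyBasis A ι c κ.1))) =
      shamashMap B w X n m (fun κ' => algebraMap A B (y (polyBasis A ι c κ'.1))) κ := by
  classical
  have h1 : X.mulVec (polyBasis A ι c κ.1) =
      ∑ κ' : ShamashIndex c w m, shamashEntry X κ.1 κ'.1 • polyBasis A ι c κ'.1 := by
    refine (polyBasis A ι c).repr.injective (Finsupp.ext fun κ' => ?_)
    change (polyBasis A ι c).repr (X.mulVecLin.restrictScalars A (polyBasis A ι c κ.1)) κ' = _
    rw [← shamashEntry_eq_repr]
    simp only [map_sum, map_smul, Basis.repr_self, Finsupp.finsetSum_apply, Finsupp.smul_apply,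
      Finsupp.single_apply, smul_eq_mul, mul_ite, mul_one, mul_zero]
    by_cases h : shamashDegree w κ' = m
    · rw [Finset.sum_eq_single ⟨κ', h⟩]
      · simp
      · intro κ'' _ hne
        exact if_neg fun h' => hne (Subtype.ext h')
      · simp
    · rw [Finset.sum_eq_zero fun κ'' _ => if_neg fun h' : κ''.1 = κ' => h (h' ▸ κ''.2),
        shamashEntry_eq_zero hX (by rw [κ.2, ← hm]; exact h)]
  rw [h1]
  simp [shamashMap, Matrix.mulVec, dotProduct]

/-- Every vector lifts to a functional supported in one degree. -/
lemma exists_functional_lift (hsurj : Function.Surjective (algebraMap A B)) {n : ℤ}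
    (z : ShamashIndex c w n → B) : ∃ y : (ι → MvPolynomial (Fin c) A) →ₗ[A] A,
      IsShamashFunctional w (polyBasis A ι c) c n y ∧
      (fun κ' : ShamashIndex c w n => algebraMap A B (y (polyBasis A ι c κ'.1))) = z := by
  classical
  choose s hs using hsurj
  refine ⟨(polyBasis A ι c).constr A fun κ => if h : shamashDegree w κ = n then s (z ⟨κ, h⟩) else 0,
    ⟨fun κ h => ?_, fun κ l hl => absurd l.2 (not_lt.mpr hl)⟩, ?_⟩
  · rw [Basis.constr_basis, dif_neg h]
  · funext κ
    rw [Basis.constr_basis, dif_pos κ.2, hs]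

/-- A functional annihilating the variables factors through the constant coefficients. -/
lemma functional_apply_of_kills {m : ℤ} {g : (ι → MvPolynomial (Fin c) A) →ₗ[A] A}
    (hg : IsShamashFunctional w (polyBasis A ι c) 0 m g) (p : ι → MvPolynomial (Fin c) A) :
    g p = ∑ j, g (polyBasis A ι c (j, 0)) * (p j).coeff 0 := by
  classical
  have h : ∀ j (q : MvPolynomial (Fin c) A), g (Pi.single j q) =
      g (polyBasis A ι c (j, 0)) * q.coeff 0 := by
    intro j q
    have : g ∘ₗ LinearMap.single A (fun _ => MvPolynomial (Fin c) A) j =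
        g (polyBasis A ι c (j, 0)) • MvPolynomial.lcoeff A 0 := by
      refine (MvPolynomial.basisMonomials (Fin c) A).ext fun a => ?_
      simp only [MvPolynomial.coe_basisMonomials, LinearMap.comp_apply, LinearMap.single_apply,
        LinearMap.smul_apply, MvPolynomial.lcoeff_apply, MvPolynomial.coeff_monomial, smul_eq_mul]
      rw [← polyBasis_apply (j, a)]
      split_ifs with h
      · rw [h, mul_one]
      · obtain ⟨l, hl⟩ := Finsupp.ne_iff.mp h
        rw [mul_zero, hg.kills (j, a) l (Nat.zero_le _) hl]
    exact LinearMap.congr_fun this q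
  conv_lhs => rw [← Finset.univ_sum_single p, map_sum]
  exact Finset.sum_congr rfl fun j _ => h j _

lemma mulVec_polyBasis_zero (i j : ι) :
    X.mulVec (polyBasis A ι c (i, 0)) j = X j i := by
  classical
  rw [polyBasis_apply]
  simp

lemma shamash_base (hX : IsCurvedDifferential f w X)
    (hbase : ∀ (m : ℤ) (z : ι → A), 0 < m → (∀ i, w i ≠ m → z i = 0) →
      (∀ i, ∑ j, z j * (X j i).coeff 0 = 0) →
      ∃ y : ι → A, (∀ i, w i ≠ m + 1 → y i = 0) ∧ ∀ i, z i = ∑ j, y j * (X j i).coeff 0)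
    (m : ℤ) (z : (ι → MvPolynomial (Fin c) A) →ₗ[A] A) (hm : 0 < m)
    (hz : IsShamashFunctional w (polyBasis A ι c) 0 m z)
    (h : z ∘ₗ X.mulVecLin.restrictScalars A = 0) :
    ∃ y, IsShamashFunctional w (polyBasis A ι c) 0 (m + 1) y ∧
      z = y ∘ₗ X.mulVecLin.restrictScalars A := by
  classical
  obtain ⟨y, hy, hyz⟩ := hbase m (fun i => z (polyBasis A ι c (i, 0))) hm
    (fun i hi => hz.degree _ (by simpa [shamashDegree] using hi)) (fun i => by
      have := LinearMap.congr_fun h (polyBasis A ι c (i, 0))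
      rw [LinearMap.comp_apply, functional_apply_of_kills hz] at this
      simpa [mulVec_polyBasis_zero] using this)
  set g : (ι → MvPolynomial (Fin c) A) →ₗ[A] A :=
    (polyBasis A ι c).constr A fun κ => if κ.2 = 0 then y κ.1 else 0
  have hgb : ∀ κ, g (polyBasis A ι c κ) = if κ.2 = 0 then y κ.1 else 0 :=
    fun κ => (polyBasis A ι c).constr_basis A _ κ
  have hg : IsShamashFunctional w (polyBasis A ι c) 0 (m + 1) g := by
    constructor
    · intro κ hκ
      rw [hgb]
      split_ifs with h0
      · exact hy _ (by simpa [shamashDegree, h0] using hκ)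
      · rfl
    · intro κ l _ hl
      rw [hgb, if_neg fun h0 => hl (by simp [h0])]
  refine ⟨g, hg, (polyBasis A ι c).ext fun κ => ?_⟩
  by_cases h0 : κ.2 = 0
  · obtain ⟨i, a⟩ := κ
    obtain rfl : a = 0 := h0
    rw [LinearMap.comp_apply, functional_apply_of_kills hg]
    simpa [mulVec_polyBasis_zero, hgb] using hyz i
  · obtain ⟨l, hl⟩ := Finsupp.ne_iff.mp h0
    rw [hz.kills κ l (Nat.zero_le _) hl,
      (hg.comp hX.isHypersurfaceFactorization).kills κ l (Nat.zero_le _) hl]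

lemma ker_shamashMap (hX : IsCurvedDifferential f w X)
    (hsurj : Function.Surjective (algebraMap A B))
    (hker : RingHom.ker (algebraMap A B) = Ideal.span (Set.range f))
    (hreg : ∀ (j : Fin c) x, f j * x ∈ initialIdeal f j → x ∈ initialIdeal f j)
    (hbase : ∀ (m : ℤ) (z : ι → A), 0 < m → (∀ i, w i ≠ m → z i = 0) →
      (∀ i, ∑ j, z j * (X j i).coeff 0 = 0) →
      ∃ y : ι → A, (∀ i, w i ≠ m + 1 → y i = 0) ∧ ∀ i, z i = ∑ j, y j * (X j i).coeff 0)
    {n m k : ℤ} (hn : 0 ≤ n) (hm : m = n + 1) (hk : k = m + 1) :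
    LinearMap.ker (shamashMap B w X n m) = LinearMap.range (shamashMap B w X m k) := by
  classical
  have hT := hX.isHypersurfaceFactorization
  apply le_antisymm
  · intro z hz
    obtain ⟨y, hy, rfl⟩ := exists_functional_lift hsurj z
    have hyT := IsShamashFunctional.comp hT (hm ▸ hy)
    have hyI : ∀ p, y (X.mulVecLin.restrictScalars A p) ∈ initialIdeal f c := by
      refine mem_ideal_of_basis (b := polyBasis A ι c) _ (y ∘ₗ X.mulVecLin.restrictScalars A)
        fun κ => ?_
      by_cases hκ : shamashDegree w κ = n
      · rw [initialIdeal_top, ← hker, RingHom.mem_ker]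
        exact (functional_apply hX hm y ⟨κ, hκ⟩).trans (congrFun hz ⟨κ, hκ⟩)
      · rw [hyT.degree κ hκ]
        exact zero_mem _
    obtain ⟨u, hu, h⟩ := shamash_exact hT hreg (shamash_base hX hbase) c le_rfl m (by omega) y hy hyI
    refine ⟨fun κ => algebraMap A B (u (polyBasis A ι c κ.1)), ?_⟩
    funext κ
    rw [← functional_apply hX hk, eq_comm, ← sub_eq_zero, ← map_sub, ← RingHom.mem_ker, hker,
      ← initialIdeal_top]
    exact h _
  · rintro _ ⟨z, rfl⟩
    obtain ⟨y, hy, rfl⟩ := exists_functional_lift hsurj z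
    have h1 : shamashMap B w X m k (fun κ => algebraMap A B (y (polyBasis A ι c κ.1))) =
        fun κ => algebraMap A B ((y ∘ₗ X.mulVecLin.restrictScalars A) (polyBasis A ι c κ.1)) := by
      funext κ
      rw [← functional_apply hX hk]
      rfl
    rw [LinearMap.mem_ker, h1]
    funext κ
    rw [← functional_apply hX hm, LinearMap.comp_apply, LinearMap.coe_restrictScalars,
      Matrix.mulVecLin_apply, hX.square, Pi.zero_apply, ← RingHom.mem_ker, hker, Finset.sum_smul,
      map_sum]
    refine Submodule.sum_mem _ fun l _ => ?_
    rw [← MvPolynomial.smul_eq_C_mul, smul_assoc, map_smul, smul_eq_mul]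
    exact Ideal.mul_mem_right _ _ (Ideal.subset_span ⟨l, rfl⟩)

end ShamashResolution

section ShamashBetti

noncomputable instance evenGrading_gradedAlgebra (K : Type*) [CommRing K] (c : ℕ) :
    GradedAlgebra (evenGrading K c) :=
  MvPolynomial.weightedGradedAlgebra K _

variable {A B ι : Type*} [CommRing A] [CommRing B] [Algebra A B] [Fintype ι] {c : ℕ}
  {f : Fin c → A} {w : ι → ℤ} {X : Matrix ι ι (MvPolynomial (Fin c) A)}

lemma gradedPiece_evenGrading (K : Type*) [Field K] (w : ι → ℤ) (n : ℤ) :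
    gradedPiece (evenGrading K c) w n =
      Submodule.span K (Set.range fun κ : ShamashIndex c w n => polyBasis K ι c κ.1) := by
  have : (Set.range fun κ : ShamashIndex c w n => polyBasis K ι c κ.1) =
      polyBasis K ι c '' {κ | shamashDegree w κ = n} := by
    rw [Set.image_eq_range]
    rfl
  rw [this]
  ext p
  rw [mem_gradedPiece, mem_span_polyBasis]
  simp only [mem_evenGrading, Prod.forall, Set.mem_ofPred_eq, shamashDegree]
  refine forall_congr' fun i => forall_congr' fun a => imp_congr_right fun _ => ?_
  constructor <;> intro h <;> linarith

lemma finrank_gradedPiece_evenGrading (K : Type*) [Field K] (w : ι → ℤ) (n : ℤ) :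
    finrank K (gradedPiece (evenGrading K c) w n) = Fintype.card (ShamashIndex c w n) := by
  rw [gradedPiece_evenGrading, finrank_span_eq_card]
  exact (polyBasis K ι c).linearIndependent.comp _ Subtype.val_injective

lemma mapFieldRank_mulVecLin (K : Type*) [Field K] [Algebra B K] {I J : Type*} [Fintype I]
    [Fintype J] (Y : Matrix I J B) :
    mapFieldRank K Y.mulVecLin = (Y.map (algebraMap B K)).rank := by
  classical
  have h := LinearMap.toMatrix_baseChange (A := K) Y.mulVecLin (Pi.basisFun B J) (Pi.basisFun B I)
  have h2 : LinearMap.toMatrix (Pi.basisFun B J) (Pi.basisFun B I) Y.mulVecLin = Y :=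
    LinearMap.toMatrix'_toLin' Y
  rw [h2] at h
  rw [← h, mapFieldRank, Matrix.rank_eq_finrank_range_toLin _
    (Algebra.TensorProduct.basis K (Pi.basisFun B I))
    (Algebra.TensorProduct.basis K (Pi.basisFun B J)), Matrix.toLin_toMatrix]

lemma IsCurvedDifferential.map_homogeneous (hX : IsCurvedDifferential f w X) (K : Type*) [Field K]
    [Algebra A K] : IsHomogeneousDifferential (evenGrading K c) w
      (X.map (MvPolynomial.map (algebraMap A K))) := by
  intro i j
  rw [mem_evenGrading]
  intro a ha
  rw [Matrix.map_apply, MvPolynomial.coeff_map] at ha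
  have := mem_evenGrading.mp (hX.homogeneous i j) a fun h => ha (by rw [h, map_zero])
  rw [this]
  ring

lemma mapFieldRank_shamashMap (hX : IsCurvedDifferential f w X) (K : Type*) [Field K]
    [Algebra A K] [Algebra B K] [IsScalarTower A B K] {n m : ℤ} (hm : m = n + 1) :
    mapFieldRank K (shamashMap B w X n m) = gradedRank (evenGrading K c)
      (X.map (MvPolynomial.map (algebraMap A K))) w n := by
  classical
  set Z := X.map (MvPolynomial.map (algebraMap A K)) with hZ
  let res : (ι → MvPolynomial (Fin c) K) →ₗ[K] (ShamashIndex c w m → K) :=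
    LinearMap.pi fun κ => (MvPolynomial.lcoeff K κ.1.2) ∘ₗ LinearMap.proj κ.1.1
  have hres : ∀ p κ, res p κ = (p κ.1.1).coeff κ.1.2 := fun p κ => rfl
  have hmem : ∀ z ∈ gradedPiece (evenGrading K c) w n,
      Z.mulVec z ∈ gradedPiece (evenGrading K c) w m := by
    intro z hz
    have := mulVec_mem_gradedPiece (hX.map_homogeneous K) hz
    rw [mem_gradedPiece] at this ⊢
    intro i
    have h := this i
    rwa [show n - (w i - 1) = m - w i by rw [hm]; ring] at h
  have h1 : gradedRank (evenGrading K c) Z w n =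
      finrank K ((gradedPiece (evenGrading K c) w n).map (res ∘ₗ mulVecK K Z)) := by
    refine finrank_map_eq_of_ker_iff _ _ _ fun z hz => ⟨fun h => ?_, fun h => ?_⟩
    · rw [LinearMap.comp_apply, h, map_zero]
    · have hz' := mem_gradedPiece.mp (hmem z hz)
      funext i
      ext a
      by_contra h0
      have hd := mem_evenGrading.mp (hz' i) a (by simpa using h0)
      have := congrFun h ⟨(i, a), by simp only [shamashDegree]; linarith⟩
      rw [LinearMap.comp_apply, hres] at this
      exact h0 (by simpa using this)
  rw [h1, gradedPiece_evenGrading, Submodule.map_span, ← Set.range_comp, shamashMap,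
    mapFieldRank_mulVecLin, Matrix.rank_eq_finrank_span_row]
  refine congrArg (fun v => finrank K (Submodule.span K (Set.range v))) (funext₂ fun κ κ' => ?_)
  simp only [Function.comp_apply, LinearMap.comp_apply, hres, mulVecK_apply, Matrix.row_apply,
    Matrix.map_apply, Matrix.of_apply]
  rw [← IsScalarTower.algebraMap_apply, ← shamashEntry_map, shamashEntry_eq_repr, polyBasis_repr]
  rfl

lemma exists_vector_lift (hsurj : Function.Surjective (algebraMap A B)) (hw : ∀ i, 0 ≤ w i) {n : ℤ}
    (hn : n ≤ 1) (z : ShamashIndex c w n → B) :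
    ∃ y : ι → A, (∀ i, w i ≠ n → y i = 0) ∧ z = fun κ => algebraMap A B (y κ.1.1) := by
  classical
  choose s hs using hsurj
  refine ⟨fun i => if h : w i = n then s (z ⟨(i, 0), by simpa [shamashDegree] using h⟩) else 0,
    fun i h => dif_neg h, ?_⟩
  funext ⟨⟨i, a⟩, h⟩
  have h' : w i + 2 * (a.degree : ℤ) = n := h
  have := hw i
  have ha : a.degree = 0 := by omega
  obtain rfl : a = 0 := (Finsupp.degree_eq_zero_iff a).mp ha
  have hi : w i = n := by simpa using h'
  simp only [dif_pos hi, hs]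

lemma shamashMap_vector (hX : IsCurvedDifferential f w X) (hw : ∀ i, 0 ≤ w i) {y : ι → A}
    (hy : ∀ i, w i ≠ 1 → y i = 0) :
    shamashMap B w X 0 1 (fun κ => algebraMap A B (y κ.1.1)) =
      fun κ => algebraMap A B (∑ j, y j * (X j κ.1.1).coeff 0) := by
  classical
  set g : (ι → MvPolynomial (Fin c) A) →ₗ[A] A :=
    (polyBasis A ι c).constr A fun κ => if κ.2 = 0 then y κ.1 else 0
  have hgb : ∀ κ, g (polyBasis A ι c κ) = if κ.2 = 0 then y κ.1 else 0 :=
    fun κ => (polyBasis A ι c).constr_basis A _ κ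
  have hg : IsShamashFunctional w (polyBasis A ι c) 0 1 g := by
    constructor
    · intro κ hκ
      rw [hgb]
      split_ifs with h0
      · exact hy _ (by simpa [shamashDegree, h0] using hκ)
      · rfl
    · intro κ l _ hl
      rw [hgb, if_neg fun h0 => hl (by simp [h0])]
  have hzero : ∀ {n : ℤ} (hn : n ≤ 1) (κ : ShamashIndex c w n), κ.1.2 = 0 := by
    rintro n hn ⟨⟨i, a⟩, h⟩
    have h' : w i + 2 * (a.degree : ℤ) = n := h
    have := hw i
    have ha : a.degree = 0 := by omega
    exact (Finsupp.degree_eq_zero_iff a).mp ha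
  funext κ
  have := functional_apply (B := B) hX (show (1 : ℤ) = 0 + 1 by norm_num) g κ
  rw [functional_apply_of_kills hg] at this
  have hκ : κ.1 = (κ.1.1, 0) := Prod.ext rfl (hzero (by norm_num) κ)
  rw [hκ] at this
  simp only [mulVec_polyBasis_zero, hgb, if_true] at this
  rw [this]
  refine congrArg (fun v => shamashMap B w X 0 1 v κ) (funext fun κ' => ?_)
  rw [if_pos (hzero le_rfl κ')]

variable {M : Type*} [AddCommGroup M] [Module A M] [Module B M] [IsScalarTower A B M]

lemma shamash_augmentation (hX : IsCurvedDifferential f w X)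
    (hsurj : Function.Surjective (algebraMap A B)) (hw : ∀ i, 0 ≤ w i)
    (ε : (ι → A) →ₗ[A] M) (hε : ∀ m, ∃ z, (∀ i, w i ≠ 0 → z i = 0) ∧ ε z = m)
    (hε0 : ∀ z, (∀ i, w i ≠ 0 → z i = 0) → (ε z = 0 ↔
      ∃ y : ι → A, (∀ i, w i ≠ 1 → y i = 0) ∧ ∀ i, z i = ∑ j, y j * (X j i).coeff 0)) :
    ∃ η : (ShamashIndex c w 0 → B) →ₗ[B] M, Function.Surjective η ∧
      LinearMap.ker η = LinearMap.range (shamashMap B w X 0 1) := by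
  classical
  let η : (ShamashIndex c w 0 → B) →ₗ[B] M :=
    Fintype.linearCombination B fun κ => ε (Pi.single κ.1.1 1)
  have hη : ∀ z : ι → A, (∀ i, w i ≠ 0 → z i = 0) →
      η (fun κ => algebraMap A B (z κ.1.1)) = ε z := by
    intro z hz
    rw [Fintype.linearCombination_apply]
    have h1 : ε z = ∑ i, z i • ε (Pi.single i 1) := by
      conv_lhs => rw [← Finset.univ_sum_single z, map_sum]
      refine Finset.sum_congr rfl fun i _ => ?_
      rw [← map_smul, ← Pi.single_smul, smul_eq_mul, mul_one]
    rw [h1]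
    refine Finset.sum_of_injOn (fun κ => κ.1.1) ?_ (fun _ _ => Finset.mem_coe.mpr (Finset.mem_univ _)) ?_ ?_
    · rintro ⟨⟨i, a⟩, h⟩ - ⟨⟨i', a'⟩, h'⟩ - rfl
      have h : w i + 2 * (a.degree : ℤ) = 0 := h
      have h' : w i + 2 * (a'.degree : ℤ) = 0 := h'
      have := hw i
      have ha : a.degree = 0 := by omega
      have ha' : a'.degree = 0 := by omega
      have ha : a = 0 := (Finsupp.degree_eq_zero_iff a).mp ha
      have ha' : a' = 0 := (Finsupp.degree_eq_zero_iff a').mp ha'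
      simp [ha, ha']
    · intro i _ hi
      rw [hz i, zero_smul]
      intro h
      exact hi ⟨⟨(i, 0), by simpa [shamashDegree] using h⟩, by simp⟩
    · intro κ _
      rw [algebraMap_smul]
  refine ⟨η, fun m => ?_, le_antisymm ?_ ?_⟩
  · obtain ⟨z, hz, rfl⟩ := hε m
    exact ⟨_, hη z hz⟩
  · intro z hz
    obtain ⟨y, hy, rfl⟩ := exists_vector_lift hsurj hw zero_le_one z
    rw [LinearMap.mem_ker, hη y hy, hε0 y hy] at hz
    obtain ⟨u, hu, huy⟩ := hz
    refine ⟨fun κ => algebraMap A B (u κ.1.1), ?_⟩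
    rw [shamashMap_vector hX hw hu]
    funext κ
    rw [huy]
  · rintro _ ⟨z, rfl⟩
    obtain ⟨y, hy, rfl⟩ := exists_vector_lift hsurj hw le_rfl z
    rw [LinearMap.mem_ker, shamashMap_vector hX hw hy]
    have h0 : ∀ i, w i ≠ 0 → ∑ j, y j * (X j i).coeff 0 = 0 := by
      refine fun i hi => Finset.sum_eq_zero fun j _ => ?_
      by_cases hj : w j = 1
      · have : (X j i).coeff 0 = 0 := by
          by_contra h
          have := mem_evenGrading.mp (hX.homogeneous j i) 0 h
          simp at this
          omega
        rw [this, mul_zero]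
      · rw [hy j hj, zero_mul]
    rw [hη _ h0, hε0 _ h0]
    exact ⟨y, hy, fun _ => rfl⟩

/-- The Betti numbers of a module are the dimensions of the homology of the reduced curved
differential. -/
theorem shamash_betti [Nontrivial B] (hX : IsCurvedDifferential f w X)
    (hsurj : Function.Surjective (algebraMap A B))
    (hker : RingHom.ker (algebraMap A B) = Ideal.span (Set.range f))
    (hreg : ∀ (j : Fin c) x, f j * x ∈ initialIdeal f j → x ∈ initialIdeal f j)
    (hw : ∀ i, 0 ≤ w i)
    (hbase : ∀ (m : ℤ) (z : ι → A), 0 < m → (∀ i, w i ≠ m → z i = 0) →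
      (∀ i, ∑ j, z j * (X j i).coeff 0 = 0) →
      ∃ y : ι → A, (∀ i, w i ≠ m + 1 → y i = 0) ∧ ∀ i, z i = ∑ j, y j * (X j i).coeff 0)
    (ε : (ι → A) →ₗ[A] M) (hε : ∀ m, ∃ z, (∀ i, w i ≠ 0 → z i = 0) ∧ ε z = m)
    (hε0 : ∀ z, (∀ i, w i ≠ 0 → z i = 0) → (ε z = 0 ↔
      ∃ y : ι → A, (∀ i, w i ≠ 1 → y i = 0) ∧ ∀ i, z i = ∑ j, y j * (X j i).coeff 0))
    (K : Type*) [Field K] [Algebra A K] [Algebra B K] [IsScalarTower A B K]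
    {β : ℕ → ℕ} (δ : ∀ n, (Fin (β (n + 1)) → B) →ₗ[B] (Fin (β n) → B))
    (η : (Fin (β 0) → B) →ₗ[B] M) (hη : Function.Surjective η)
    (hδ0 : LinearMap.ker η = LinearMap.range (δ 0))
    (hδ : ∀ n, LinearMap.ker (δ n) = LinearMap.range (δ (n + 1)))
    (hδK : ∀ n, mapFieldRank K (δ n) = 0) (n : ℕ) :
    (β n : ℝ) = homologyDim (evenGrading K c) (X.map (MvPolynomial.map (algebraMap A K))) w n := by
  obtain ⟨ε', hε', hε0'⟩ := shamash_augmentation (B := B) hX hsurj hw ε hε hε0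
  obtain ⟨h0, h1⟩ := betti_comparison (F := fun n => ShamashIndex c w n → B)
    (G := fun n => Fin (β n) → B) K
    (fun n => shamashMap B w X n (n + 1 : ℕ)) ε' δ η hε' hε0'
    (fun n => ker_shamashMap hX hsurj hker hreg hbase (by omega) (by push_cast; ring)
      (by push_cast; ring)) hη hδ0 hδ
  simp only [finrank_fintype_fun_eq_card, Fintype.card_fin, hδK, add_zero] at h0 h1
  rw [homologyDim, finrank_gradedPiece_evenGrading]
  rcases n with _ | n
  · have hneg : gradedRank (evenGrading K c) (X.map (MvPolynomial.map (algebraMap A K))) w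
        (((0 : ℕ) : ℤ) - 1) = 0 := by
      rw [gradedRank, gradedPiece_evenGrading]
      have : IsEmpty (ShamashIndex c w (((0 : ℕ) : ℤ) - 1)) := ⟨fun ⟨κ, h⟩ => by
        have h : w κ.1 + 2 * (κ.2.degree : ℤ) = ((0 : ℕ) : ℤ) - 1 := h
        have := hw κ.1
        push_cast at h
        omega⟩
      rw [Set.range_eq_empty, Submodule.span_empty, Submodule.map_bot, finrank_bot]
    rw [mapFieldRank_shamashMap hX K (by simp)] at h0
    rw [hneg, h0]
    push_cast
    ring
  · have h2 := h1 n
    rw [mapFieldRank_shamashMap hX K (by push_cast; ring),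
      mapFieldRank_shamashMap hX K (by push_cast; ring)] at h2
    rw [h2, show (((n + 1 : ℕ) : ℤ) - 1) = n by push_cast; ring]
    push_cast
    ring

end ShamashBetti

section Homotopies

variable {A ι : Type*} [CommRing A] [Fintype ι]

/-- A free complex with homogeneous basis indexed by `ι`, written as one matrix, which is exact in
positive degrees. -/
structure IsAcyclicComplex (w : ι → ℤ) (d : Matrix ι ι A) : Prop where
  homogeneous : ∀ i j, d i j ≠ 0 → w j = w i + 1
  square : ∀ z, d.mulVec (d.mulVec z) = 0
  exact : ∀ (m : ℤ) (z : ι → A), 0 < m → (∀ i, w i ≠ m → z i = 0) → d.mulVec z = 0 →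
    ∃ y : ι → A, (∀ i, w i ≠ m + 1 → y i = 0) ∧ z = d.mulVec y
  nonneg : ∀ i, 0 ≤ w i

variable {w : ι → ℤ} {d : Matrix ι ι A}

/-- A chain endomorphism of non-negative degree which is a boundary in degree zero is
null-homotopic. -/
lemma IsAcyclicComplex.exists_nullHomotopy (hd : IsAcyclicComplex w d) {e : ℤ} (he : 0 ≤ e)
    (ω : Matrix ι ι A) (hω : ∀ i j, ω i j ≠ 0 → w i = w j + e) (hc : d * ω = ω * d)
    (h0 : e = 0 → ∀ j, w j = 0 →
      ∃ y : ι → A, (∀ i, w i ≠ 1 → y i = 0) ∧ ω.col j = d.mulVec y) :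
    ∃ σ : Matrix ι ι A, (∀ i j, σ i j ≠ 0 → w i = w j + e + 1) ∧ d * σ + σ * d = ω := by
  classical
  have key : ∀ n : ℕ, ∃ σ : Matrix ι ι A, (∀ i j, σ i j ≠ 0 → w i = w j + e + 1) ∧
      (∀ i j, (n : ℤ) ≤ w j → σ i j = 0) ∧
      ∀ i j, w j < n → (d * σ + σ * d) i j = ω i j := by
    intro n
    induction n with
    | zero =>
      exact ⟨0, by simp, by simp, fun i j h => absurd h (by simpa using hd.nonneg j)⟩
    | succ n ih =>
      obtain ⟨σ, hσ, hσ0, hσe⟩ := ih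
      have step : ∀ j, ∃ y : ι → A, (∀ i, w i ≠ n + e + 1 → y i = 0) ∧
          (w j = n → (ω - σ * d).col j = d.mulVec y) := by
        intro j
        by_cases hj : w j = n
        swap
        · exact ⟨0, by simp, fun h => absurd h hj⟩
        by_cases hne : (n : ℤ) + e = 0
        · have hn : n = 0 := by omega
          subst hn
          have he0 : e = 0 := by simpa using hne
          obtain ⟨y, hy, hy'⟩ := h0 he0 j (by simpa using hj)
          refine ⟨y, by simpa [he0] using hy, fun _ => ?_⟩
          rw [← hy']
          ext i
          have : (σ * d) i j = 0 := by
            rw [Matrix.mul_apply]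
            refine Finset.sum_eq_zero fun k _ => ?_
            rw [hσ0 i k (by simpa using hd.nonneg k), zero_mul]
          simp [this]
        · have h1 : d.mulVec ((ω - σ * d).col j) = 0 := by
            ext i
            have e1 : d.mulVec ((ω - σ * d).col j) i = (d * (ω - σ * d)) i j := by
              simp [Matrix.mul_apply, Matrix.mulVec, dotProduct]
            rw [e1, Matrix.mul_sub, hc, ← Matrix.mul_assoc, ← Matrix.sub_mul, Matrix.mul_apply]
            have hdd : (σ * d * d) i j = 0 := by
              rw [Matrix.mul_assoc, Matrix.mul_apply]
              refine Finset.sum_eq_zero fun k _ => ?_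
              have := congrFun (hd.square (Pi.single j 1)) k
              rw [Matrix.mulVec_mulVec, Matrix.mulVec_single_one] at this
              have : (d * d) k j = 0 := this
              rw [this, mul_zero]
            rw [Pi.zero_apply, ← hdd, Matrix.mul_apply]
            refine Finset.sum_congr rfl fun k _ => ?_
            by_cases hk : d k j = 0
            · simp [hk]
            · have h2 := hσe i k (by have := hd.homogeneous k j hk; omega)
              rw [Matrix.sub_apply, ← h2, Matrix.add_apply, add_sub_cancel_left]
          have hsupp : ∀ i, w i ≠ n + e → (ω - σ * d).col j i = 0 := by
            intro i hi
            rw [Matrix.col_apply, Matrix.sub_apply]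
            have h3 : ω i j = 0 := by
              by_contra h
              exact hi (by rw [hω i j h, hj])
            have h4 : (σ * d) i j = 0 := by
              rw [Matrix.mul_apply]
              refine Finset.sum_eq_zero fun k _ => ?_
              by_contra h
              have h5 := hσ i k (left_ne_zero_of_mul h)
              have h6 := hd.homogeneous k j (right_ne_zero_of_mul h)
              exact hi (by omega)
            rw [h3, h4, sub_zero]
          obtain ⟨y, hy, hy'⟩ := hd.exact (n + e) _ (by omega) hsupp h1
          exact ⟨y, hy, fun _ => hy'⟩
      choose y hy hy' using step
      have hzero : ∀ i j, w j = n → σ i j = 0 := fun i j h => hσ0 i j h.ge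
      refine ⟨Matrix.of fun i j => if w j = n then y j i else σ i j, ?_, ?_, ?_⟩
      · intro i j h
        rw [Matrix.of_apply] at h
        split_ifs at h with hj
        · by_contra h'
          exact h (hy j i (by rw [← hj]; exact h'))
        · exact hσ i j h
      · intro i j h
        push_cast at h
        rw [Matrix.of_apply, if_neg (by omega)]
        exact hσ0 i j (by omega)
      · intro i j h
        push_cast at h
        by_cases hj : w j = n
        · have h1 := congrFun (hy' j hj) i
          rw [Matrix.col_apply, Matrix.sub_apply] at h1
          rw [Matrix.add_apply, sub_eq_iff_eq_add.mp h1]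
          congr 1
          · simp [Matrix.mul_apply, Matrix.mulVec, dotProduct, hj]
          · simp only [Matrix.mul_apply]
            refine Finset.sum_congr rfl fun k _ => ?_
            by_cases hk : d k j = 0
            · simp [hk]
            · rw [Matrix.of_apply, if_neg (by have := hd.homogeneous k j hk; omega)]
        · rw [← hσe i j (by omega)]
          simp only [Matrix.add_apply, Matrix.mul_apply, Matrix.of_apply, if_neg hj]
          congr 1
          refine Finset.sum_congr rfl fun k _ => ?_
          by_cases hk : d k j = 0
          · simp [hk]
          · rw [if_neg (by have := hd.homogeneous k j hk; omega)]
  obtain ⟨σ, hσ, -, hσe⟩ := key (∑ j, (w j).toNat + 1)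
  refine ⟨σ, hσ, ?_⟩
  ext i j
  refine hσe i j ?_
  have h1 : (w j).toNat ≤ ∑ j, (w j).toNat :=
    Finset.single_le_sum (f := fun j => (w j).toNat) (fun _ _ => Nat.zero_le _) (Finset.mem_univ j)
  omega


lemma coeff_mul_of_degree_lt {c n : ℕ} (p q : MvPolynomial (Fin c) A)
    (hq : ∀ a, a.degree < n → q.coeff a = 0) (a : Fin c →₀ ℕ) (ha : a.degree ≤ n) :
    (p * q).coeff a = p.coeff 0 * q.coeff a := by
  classical
  rw [MvPolynomial.coeff_mul, Finset.sum_eq_single (0, a)]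
  · rintro ⟨b, b'⟩ hb hne
    have hb : b + b' = a := Finset.HasAntidiagonal.mem_antidiagonal.mp hb
    have h1 : b ≠ 0 := by
      rintro rfl
      exact hne (by rw [← hb, zero_add])
    have h2 : b.degree ≠ 0 := by rwa [Ne, Finsupp.degree_eq_zero_iff]
    have h3 : b.degree + b'.degree = a.degree := by rw [← hb, map_add]
    rw [hq b' (by omega), mul_zero]
  · simp

/-- The system of higher homotopies on a free resolution of a module annihilated by `f`. -/
theorem IsAcyclicComplex.exists_higherHomotopies [DecidableEq ι] (hd : IsAcyclicComplex w d)
    {c : ℕ} (f : Fin c → A)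
    (h0 : ∀ j, w j = 0 → ∀ r ∈ Ideal.span (Set.range f),
      ∃ y : ι → A, (∀ i, w i ≠ 1 → y i = 0) ∧ r • Pi.single j 1 = d.mulVec y) :
    ∃ T : Matrix ι ι (MvPolynomial (Fin c) A), (∀ i j, T i j ∈ evenGrading A c (w i - w j + 1)) ∧
      (∀ i j, (T i j).coeff 0 = d i j) ∧
      T * T = (∑ l, MvPolynomial.C (f l) * MvPolynomial.X l : MvPolynomial (Fin c) A) •
        (1 : Matrix ι ι (MvPolynomial (Fin c) A)) := by
  set F : MvPolynomial (Fin c) A := ∑ l, MvPolynomial.C (f l) * MvPolynomial.X l with hF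
  have hFcoeff : ∀ a, F.coeff a ∈ Ideal.span (Set.range f) := by
    intro a
    rw [hF, MvPolynomial.coeff_sum]
    refine Ideal.sum_mem _ fun l _ => ?_
    rw [MvPolynomial.coeff_C_mul]
    exact Ideal.mul_mem_right _ _ (Ideal.subset_span ⟨l, rfl⟩)
  have hFdeg : ∀ a, F.coeff a ≠ 0 → a.degree = 1 := by
    intro a ha
    rw [hF, MvPolynomial.coeff_sum] at ha
    obtain ⟨l, -, hl⟩ := Finset.exists_ne_zero_of_sum_ne_zero ha
    rw [MvPolynomial.coeff_C_mul] at hl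
    have := right_ne_zero_of_mul hl
    rw [MvPolynomial.coeff_X] at this
    split_ifs at this with h
    · rw [← h, Finsupp.degree_single]
    · exact absurd rfl this
  have hsq : ∀ T : Matrix ι ι (MvPolynomial (Fin c) A),
      (∀ i j, T i j ∈ evenGrading A c (w i - w j + 1)) →
      ∀ i j a, ((T * T - F • (1 : Matrix ι ι (MvPolynomial (Fin c) A))) i j).coeff a ≠ 0 →
        2 * (a.degree : ℤ) = w i - w j + 2 := by
    intro T hT i j a ha
    by_contra hne
    apply ha
    rw [Matrix.sub_apply, MvPolynomial.coeff_sub, Matrix.mul_apply, MvPolynomial.coeff_sum,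
      Finset.sum_eq_zero, zero_sub, neg_eq_zero]
    · rw [Matrix.smul_apply, Matrix.one_apply]
      split_ifs with hij
      · rw [smul_eq_mul, mul_one]
        by_contra h
        have := hFdeg a h
        subst hij
        omega
      · simp
    · intro k _
      by_contra h
      have hmem : T i k * T k j ∈ evenGrading A c ((w i - w k + 1) + (w k - w j + 1)) :=
        MvPolynomial.IsWeightedHomogeneous.mul (hT i k) (hT k j)
      have := mem_evenGrading.mp hmem a h
      omega
  have key : ∀ n : ℕ, ∃ T : Matrix ι ι (MvPolynomial (Fin c) A),
      (∀ i j, T i j ∈ evenGrading A c (w i - w j + 1)) ∧ (∀ i j, (T i j).coeff 0 = d i j) ∧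
      ∀ i j a, a.degree < n + 1 →
        ((T * T - F • (1 : Matrix ι ι (MvPolynomial (Fin c) A))) i j).coeff a = 0 := by
    intro n
    induction n with
    | zero =>
      refine ⟨d.map MvPolynomial.C, fun i j => mem_evenGrading.mpr fun a ha => ?_,
        fun i j => by simp, fun i j a ha => ?_⟩
      · rw [Matrix.map_apply, MvPolynomial.coeff_C] at ha
        split_ifs at ha with h
        · have := hd.homogeneous i j ha
          rw [← h, map_zero]
          push_cast
          omega
        · exact absurd rfl ha
      · have ha0 : a = 0 := by
          rw [← Finsupp.degree_eq_zero_iff]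
          omega
        subst ha0
        have h1 : (d * d) i j = 0 := by
          have := congrFun (hd.square (Pi.single j 1)) i
          rwa [Matrix.mulVec_mulVec, Matrix.mulVec_single_one] at this
        have h2 : F.coeff 0 = 0 := by
          by_contra h
          simpa using hFdeg 0 h
        rw [Matrix.sub_apply, ← Matrix.map_mul, Matrix.map_apply, h1, Matrix.smul_apply,
          Matrix.one_apply]
        split_ifs <;> simp [h2]
    | succ n ih =>
      obtain ⟨T, hT, hT0, hTn⟩ := ih
      set R := T * T - F • (1 : Matrix ι ι (MvPolynomial (Fin c) A)) with hR
      have hcomm : T * R = R * T := by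
        rw [hR, Matrix.mul_sub, Matrix.sub_mul, Matrix.mul_assoc, Matrix.mul_smul, Matrix.smul_mul,
          Matrix.mul_one, Matrix.one_mul]
      have hex : ∀ a : Fin c →₀ ℕ, ∃ σ : Matrix ι ι A,
          (∀ i j, σ i j ≠ 0 → w i = w j + 2 * n + 1) ∧ (a.degree = n + 1 →
            d * σ + σ * d = -R.map (MvPolynomial.coeff a)) := by
        intro a
        by_cases ha : a.degree = n + 1
        swap
        · exact ⟨0, by simp, fun h => absurd h ha⟩
        refine (hd.exists_nullHomotopy (e := 2 * n) (by positivity)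
          (-R.map (MvPolynomial.coeff a)) ?_ ?_ ?_).imp fun σ h => ⟨h.1, fun _ => h.2⟩
        · intro i j h
          have := hsq T hT i j a (by rwa [Matrix.neg_apply, Matrix.map_apply, neg_ne_zero] at h)
          rw [ha] at this
          push_cast at this
          omega
        · ext i j
          have := congrArg (MvPolynomial.coeff a) (congrFun (congrFun hcomm i) j)
          rw [Matrix.mul_apply, Matrix.mul_apply, MvPolynomial.coeff_sum,
            MvPolynomial.coeff_sum] at this
          rw [Matrix.mul_neg, Matrix.neg_mul, Matrix.neg_apply, Matrix.neg_apply, Matrix.mul_apply,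
            Matrix.mul_apply]
          congr 1
          refine Eq.trans (Finset.sum_congr rfl fun k _ => ?_)
            (this.trans (Finset.sum_congr rfl fun k _ => ?_))
          · rw [coeff_mul_of_degree_lt _ _ (fun b hb => hTn k j b hb) a ha.le, hT0, Matrix.map_apply]
          · rw [mul_comm, coeff_mul_of_degree_lt _ _ (fun b hb => hTn i k b hb) a ha.le, hT0,
              Matrix.map_apply, mul_comm]
        · intro he j hj
          have hn : n = 0 := by simpa using he
          subst hn
          obtain ⟨y, hy, hy'⟩ := h0 j hj _ (hFcoeff a)
          refine ⟨y - fun i => (T i j).coeff a, fun i hi => ?_, ?_⟩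
          · rw [Pi.sub_apply, hy i hi, zero_sub, neg_eq_zero]
            by_contra h
            have := mem_evenGrading.mp (hT i j) a h
            rw [ha] at this
            push_cast at this
            omega
          · rw [Matrix.mulVec_sub, ← hy']
            ext i
            have hcol : ∀ k, d k j = 0 := fun k => by
              by_contra h
              have h1 := hd.homogeneous k j h
              have h2 := hd.nonneg k
              omega
            have h1 : ((T * T) i j).coeff a = d.mulVec (fun i => (T i j).coeff a) i := by
              rw [Matrix.mul_apply, MvPolynomial.coeff_sum, Matrix.mulVec, dotProduct]
              refine Finset.sum_congr rfl fun k _ => ?_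
              rw [coeff_mul_of_degree_lt (n := 1) _ _ (fun b hb => ?_) a (by omega), hT0]
              have hb0 : b = 0 := by
                rw [← Finsupp.degree_eq_zero_iff]
                omega
              rw [hb0, hT0, hcol]
            rw [Matrix.col_apply, Matrix.neg_apply, Matrix.map_apply, hR, Matrix.sub_apply,
              MvPolynomial.coeff_sub, h1, neg_sub, Pi.sub_apply]
            congr 1
            rw [Matrix.smul_apply, Matrix.one_apply, Pi.smul_apply, Pi.single_apply]
            split_ifs <;> simp
      choose σ hσ hσ' using hex
      let S : Matrix ι ι (MvPolynomial (Fin c) A) := Matrix.of fun i j =>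
        ∑ a ∈ (Finsupp.finite_of_degree_eq (σ := Fin c) (n + 1)).toFinset, MvPolynomial.monomial a (σ a i j)
      have hS : ∀ i j a, (S i j).coeff a = if a.degree = n + 1 then σ a i j else 0 := by
        intro i j a
        simp only [S, Matrix.of_apply, MvPolynomial.coeff_sum, MvPolynomial.coeff_monomial]
        rw [Finset.sum_ite_eq']
        simp
      have hSn : ∀ i j a, a.degree < n + 1 → (S i j).coeff a = 0 := fun i j a ha => by
        rw [hS, if_neg ha.ne]
      refine ⟨T + S, fun i j => mem_evenGrading.mpr fun a ha => ?_, fun i j => ?_, ?_⟩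
      · rw [Matrix.add_apply, MvPolynomial.coeff_add] at ha
        by_cases h1 : (T i j).coeff a = 0
        · rw [h1, zero_add, hS] at ha
          split_ifs at ha with h
          · have := hσ a i j ha
            rw [h]
            push_cast
            omega
          · exact absurd rfl ha
        · exact mem_evenGrading.mp (hT i j) a h1
      · rw [Matrix.add_apply, MvPolynomial.coeff_add, hT0, hSn i j 0 (by simp), add_zero]
      · intro i j a ha
        have hexp : (T + S) * (T + S) - F • (1 : Matrix ι ι (MvPolynomial (Fin c) A)) =
            R + T * S + S * T + S * S := by
          rw [hR, Matrix.mul_add, Matrix.add_mul, Matrix.add_mul]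
          abel
        have e1 : ((T * S) i j).coeff a = ∑ k, d i k * (S k j).coeff a := by
          rw [Matrix.mul_apply, MvPolynomial.coeff_sum]
          refine Finset.sum_congr rfl fun k _ => ?_
          rw [coeff_mul_of_degree_lt _ _ (hSn k j) a (by omega), hT0]
        have e2 : ((S * T) i j).coeff a = ∑ k, (S i k).coeff a * d k j := by
          rw [Matrix.mul_apply, MvPolynomial.coeff_sum]
          refine Finset.sum_congr rfl fun k _ => ?_
          rw [mul_comm, coeff_mul_of_degree_lt _ _ (hSn i k) a (by omega), hT0, mul_comm]
        have e3 : ((S * S) i j).coeff a = 0 := by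
          rw [Matrix.mul_apply, MvPolynomial.coeff_sum]
          refine Finset.sum_eq_zero fun k _ => ?_
          rw [coeff_mul_of_degree_lt _ _ (hSn k j) a (by omega), hSn i k 0 (by simp), zero_mul]
        rw [hexp, Matrix.add_apply, Matrix.add_apply, Matrix.add_apply, MvPolynomial.coeff_add,
          MvPolynomial.coeff_add, MvPolynomial.coeff_add, e1, e2, e3, add_zero]
        by_cases h : a.degree = n + 1
        · have := congrFun (congrFun (hσ' a h) i) j
          rw [Matrix.add_apply, Matrix.mul_apply, Matrix.mul_apply] at this
          simp only [hS, if_pos h]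
          rw [add_assoc, this, Matrix.neg_apply, Matrix.map_apply, add_neg_cancel]
        · simp [hS, if_neg h, hTn i j a (by omega)]
  obtain ⟨T, hT, hT0, hTn⟩ := key (∑ j, (w j).toNat + 2)
  refine ⟨T, hT, hT0, sub_eq_zero.mp ?_⟩
  ext i j a
  rw [Matrix.zero_apply, MvPolynomial.coeff_zero]
  by_contra h
  have h1 := hsq T hT i j a h
  have h2 : (w i).toNat ≤ ∑ j, (w j).toNat :=
    Finset.single_le_sum (f := fun j => (w j).toNat) (fun _ _ => Nat.zero_le _) (Finset.mem_univ i)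
  have h3 := hd.nonneg j
  refine h (hTn i j a ?_)
  omega

end Homotopies

section DualComplex

variable {A ι : Type*} [CommRing A]

/-- The vectors all of whose entries lie in the ideal `I`. -/
def vecIdeal (ι : Type*) (I : Ideal A) : Submodule A (ι → A) := Submodule.pi Set.univ fun _ => I

lemma mem_vecIdeal {I : Ideal A} {z : ι → A} : z ∈ vecIdeal ι I ↔ ∀ i, z i ∈ I := by
  simp [vecIdeal, Submodule.mem_pi]

lemma mulVec_mem_vecIdeal [Fintype ι] {I : Ideal A} (X : Matrix ι ι A) {z : ι → A} (hz : z ∈ vecIdeal ι I) :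
    X.mulVec z ∈ vecIdeal ι I :=
  mem_vecIdeal.mpr fun _ => Ideal.sum_mem _ fun j _ => I.mul_mem_left _ (mem_vecIdeal.mp hz j)

lemma vecIdeal_mono {I J : Ideal A} (h : I ≤ J) : vecIdeal ι I ≤ vecIdeal ι J := fun _ hz =>
  mem_vecIdeal.mpr fun i => h (mem_vecIdeal.mp hz i)

/-- The vectors supported in weight `m`. -/
def weightPiece (A : Type*) [CommRing A] {ι : Type*} (w : ι → ℤ) (m : ℤ) : Submodule A (ι → A) where
  carrier := {z | ∀ i, w i ≠ m → z i = 0}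
  add_mem' {x y} hx hy i hi := by rw [Pi.add_apply, hx i hi, hy i hi, add_zero]
  zero_mem' _ _ := rfl
  smul_mem' a x hx i hi := by rw [Pi.smul_apply, hx i hi, smul_zero]

lemma mem_weightPiece {w : ι → ℤ} {m : ℤ} {z : ι → A} :
    z ∈ weightPiece A w m ↔ ∀ i, w i ≠ m → z i = 0 := Iff.rfl

lemma mulVec_mem_weightPiece [Fintype ι] {w : ι → ℤ} {e : ℤ} {X : Matrix ι ι A}
    (hX : ∀ i j, X i j ≠ 0 → w i = w j + e) {m n : ℤ} (hn : n = m + e) {z : ι → A}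
    (hz : z ∈ weightPiece A w m) : X.mulVec z ∈ weightPiece A w n := by
  intro i hi
  refine Finset.sum_eq_zero fun j _ => ?_
  by_contra h
  have h1 := hX i j (left_ne_zero_of_mul h)
  have h2 : w j = m := by
    by_contra h'
    exact right_ne_zero_of_mul h (hz j h')
  exact hi (by omega)

/-- Splitting off the contribution of `f j` from a vector with entries in the next ideal of the
sequence. -/
lemma exists_sub_smul_mem_vecIdeal {c : ℕ} (f : Fin c → A) (w : ι → ℤ) (m : ℤ) (j : Fin c)
    {z : ι → A} (hz : z ∈ vecIdeal ι (initialIdeal f (j + 1))) (hm : z ∈ weightPiece A w m) :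
    ∃ v ∈ weightPiece A w m, z - f j • v ∈ vecIdeal ι (initialIdeal f j) := by
  classical
  have h : ∀ i, ∃ v, (w i ≠ m → v = 0) ∧ z i - f j * v ∈ initialIdeal f j := by
    intro i
    by_cases hi : w i = m
    · obtain ⟨v, hv⟩ := exists_sub_mul_mem_of_mem_initialIdeal_succ f j (mem_vecIdeal.mp hz i)
      exact ⟨v, fun h => absurd hi h, hv⟩
    · exact ⟨0, fun _ => rfl, by simp [hm i hi]⟩
  choose v hv hv' using h
  exact ⟨v, hv, mem_vecIdeal.mpr hv'⟩

variable [Fintype ι]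

/-- The cocycle-type data satisfied by the dual of a free resolution of length `c` of a module
annihilated by the regular sequence `f`, with homotopies `H l` for multiplication by `f l`. -/
structure IsDualComplex {c : ℕ} (f : Fin c → A) (w : ι → ℤ) (D : Matrix ι ι A)
    (H : Fin c → Matrix ι ι A) : Prop where
  homogeneous : ∀ i j, D i j ≠ 0 → w i = w j + 1
  square : ∀ z, D.mulVec (D.mulVec z) = 0
  homotopy_homogeneous : ∀ l i j, H l i j ≠ 0 → w i = w j + (-1)
  homotopy : ∀ l z, D.mulVec ((H l).mulVec z) + (H l).mulVec (D.mulVec z) = f l • z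
  nonneg : ∀ i, 0 ≤ w i
  le : ∀ i, w i ≤ c
  regular : ∀ (j : Fin c) x, f j * x ∈ initialIdeal f j → x ∈ initialIdeal f j

namespace IsDualComplex

variable {c : ℕ} {f : Fin c → A} {w : ι → ℤ} {D : Matrix ι ι A} {H : Fin c → Matrix ι ι A}

lemma mem_of_smul_mem (h : IsDualComplex f w D H) (j : Fin c) {z : ι → A}
    (hz : f j • z ∈ vecIdeal ι (initialIdeal f j)) : z ∈ vecIdeal ι (initialIdeal f j) :=
  mem_vecIdeal.mpr fun i => h.regular j _ (mem_vecIdeal.mp hz i)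

/-- Boundaries modulo an initial ideal. -/
def boundaries (f : Fin c → A) (w : ι → ℤ) (D : Matrix ι ι A) (j : ℕ) (m : ℤ) :
    Submodule A (ι → A) :=
  (weightPiece A w (m - 1)).map D.mulVecLin ⊔ vecIdeal ι (initialIdeal f j)

lemma mem_boundaries {j : ℕ} {m : ℤ} {z : ι → A} : z ∈ boundaries f w D j m ↔
    ∃ u ∈ weightPiece A w (m - 1), z - D.mulVec u ∈ vecIdeal ι (initialIdeal f j) := by
  rw [boundaries, Submodule.mem_sup]
  constructor
  · rintro ⟨_, ⟨u, hu, rfl⟩, v, hv, rfl⟩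
    exact ⟨u, hu, by simpa using hv⟩
  · rintro ⟨u, hu, hv⟩
    exact ⟨_, ⟨u, hu, rfl⟩, _, hv, by simp⟩

/-- If `y` is a boundary modulo the next ideal and `D y` agrees with `f j • z`, then `z` is a
boundary. -/
lemma boundary_of_boundary_succ (h : IsDualComplex f w D H) (j : Fin c) {m : ℤ} {y z : ι → A}
    (hyw : y ∈ weightPiece A w m)
    (hy : y ∈ boundaries f w D (j + 1) m)
    (hyz : D.mulVec y - f j • z ∈ vecIdeal ι (initialIdeal f j)) :
    z ∈ boundaries f w D j (m + 1) := by
  obtain ⟨u, hu, hv⟩ := mem_boundaries.mp hy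
  obtain ⟨v, hv, hv'⟩ := exists_sub_smul_mem_vecIdeal f w m j hv
    (sub_mem hyw (mulVec_mem_weightPiece h.homogeneous (by ring) hu))
  refine mem_boundaries.mpr ⟨v, by simpa using hv, h.mem_of_smul_mem j ?_⟩
  have h1 := sub_mem (mulVec_mem_vecIdeal D hv') hyz
  convert h1 using 1
  rw [Matrix.mulVec_sub, Matrix.mulVec_sub, h.square, Matrix.mulVec_smul, smul_sub]
  abel

/-- Exactness modulo an initial ideal below the critical degree. -/
lemma exact_mod (h : IsDualComplex f w D H) (j : ℕ) (hj : j ≤ c) {m : ℤ} (hm : m < c - j)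
    {z : ι → A} (hz : z ∈ weightPiece A w m)
    (hDz : D.mulVec z ∈ vecIdeal ι (initialIdeal f j)) : z ∈ boundaries f w D j m := by
  induction hj using Nat.decreasingInduction generalizing m z with
  | self =>
    have : z = 0 := funext fun i => hz i (by have := h.nonneg i; omega)
    rw [this]
    exact zero_mem _
  | of_succ j hj ih =>
    set J : Fin c := ⟨j, hj⟩
    have h1 : D.mulVec ((H J).mulVec z) - f J • z ∈ vecIdeal ι (initialIdeal f j) := by
      rw [← h.homotopy J z]
      simpa using mulVec_mem_vecIdeal (H J) hDz
    have hw : (H J).mulVec z ∈ weightPiece A w (m - 1) :=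
      mulVec_mem_weightPiece (h.homotopy_homogeneous J) (by ring) hz
    have h2 : D.mulVec ((H J).mulVec z) ∈ vecIdeal ι (initialIdeal f (j + 1)) := by
      have h3 : f J • z ∈ vecIdeal ι (initialIdeal f (j + 1)) :=
        mem_vecIdeal.mpr fun i => Ideal.mul_mem_right _ _ (mem_initialIdeal (l := J) f (Nat.lt_succ_self j))
      simpa using add_mem (vecIdeal_mono (initialIdeal_mono f (Nat.le_succ j)) h1) h3
    have h4 := h.boundary_of_boundary_succ J hw (ih (by push_cast; omega) hw h2) h1
    simpa using h4

lemma boundary_succ_of_boundary (h : IsDualComplex f w D H) (j : Fin c) {m : ℤ} (hm : m < c - j)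
    {y z : ι → A} (hyw : y ∈ weightPiece A w m) (hz : z ∈ boundaries f w D j (m + 1))
    (hyz : D.mulVec y - f j • z ∈ vecIdeal ι (initialIdeal f j)) :
    y ∈ boundaries f w D (j + 1) m := by
  obtain ⟨u, hu, hv⟩ := mem_boundaries.mp hz
  have hu : u ∈ weightPiece A w m := by simpa using hu
  have h1 : y - f j • u ∈ boundaries f w D j m := by
    refine h.exact_mod j j.2.le hm (sub_mem hyw (Submodule.smul_mem _ _ hu)) ?_
    have h2 := add_mem hyz (Submodule.smul_mem _ (f j) hv)
    convert h2 using 1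
    rw [Matrix.mulVec_sub, Matrix.mulVec_smul, smul_sub]
    abel
  obtain ⟨v, hv, hv'⟩ := mem_boundaries.mp h1
  refine mem_boundaries.mpr ⟨v, hv, ?_⟩
  have h3 : f j • u ∈ vecIdeal ι (initialIdeal f (j + 1)) :=
    mem_vecIdeal.mpr fun i => Ideal.mul_mem_right _ _ (mem_initialIdeal f (Nat.lt_succ_self _))
  have h4 := add_mem (vecIdeal_mono (initialIdeal_mono f (Nat.le_succ _)) hv') h3
  convert h4 using 1
  abel

/-- The iterated homotopies induce an isomorphism from the top cohomology to cocycles modulo an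
initial ideal. -/
lemma exists_transfer (h : IsDualComplex f w D H) (j : ℕ) (hj : j ≤ c) :
    ∃ Θ : (ι → A) →ₗ[A] (ι → A), ∀ m : ℤ, m = c - j →
      (∀ z ∈ weightPiece A w c, Θ z ∈ weightPiece A w m ∧
        D.mulVec (Θ z) ∈ vecIdeal ι (initialIdeal f j) ∧
        (Θ z ∈ boundaries f w D j m ↔ z ∈ boundaries f w D 0 c)) ∧
      ∀ y ∈ weightPiece A w m, D.mulVec y ∈ vecIdeal ι (initialIdeal f j) →
        ∃ z ∈ weightPiece A w c, y - Θ z ∈ boundaries f w D j m := by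
  induction j with
  | zero =>
    refine ⟨LinearMap.id, ?_⟩
    rintro m hm
    have hm : m = c := by simpa using hm
    subst hm
    refine ⟨fun z hz => ⟨hz, ?_, Iff.rfl⟩, fun y hy _ => ⟨y, hy, by simp⟩⟩
    have : D.mulVec z = 0 := by
      have h1 := mulVec_mem_weightPiece h.homogeneous rfl hz
      exact funext fun i => h1 i (by have := h.le i; omega)
    rw [LinearMap.id_apply, this]
    exact zero_mem _
  | succ j ih =>
    obtain ⟨Θ, hΘ⟩ := ih (by omega)
    set J : Fin c := ⟨j, hj⟩
    refine ⟨(H J).mulVecLin ∘ₗ Θ, ?_⟩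
    rintro m hm
    obtain ⟨h1, h2⟩ := hΘ (m + 1) (by push_cast at hm; omega)
    have hmJ : m < c - (J : ℕ) := by
      have : (J : ℕ) = j := rfl
      push_cast at hm
      omega
    have hwt : ∀ z ∈ weightPiece A w c, (H J).mulVec (Θ z) ∈ weightPiece A w m := fun z hz =>
      mulVec_mem_weightPiece (h.homotopy_homogeneous J) (by ring) (h1 z hz).1
    have hrel : ∀ z ∈ weightPiece A w c,
        D.mulVec ((H J).mulVec (Θ z)) - f J • Θ z ∈ vecIdeal ι (initialIdeal f j) := fun z hz => by
      rw [← h.homotopy J (Θ z)]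
      simpa using mulVec_mem_vecIdeal (H J) (h1 z hz).2.1
    refine ⟨fun z hz => ⟨hwt z hz, ?_, ?_⟩, fun y hy hDy => ?_⟩
    · have h3 : f J • Θ z ∈ vecIdeal ι (initialIdeal f (j + 1)) :=
        mem_vecIdeal.mpr fun i => Ideal.mul_mem_right _ _ (mem_initialIdeal (l := J) f (Nat.lt_succ_self j))
      simpa using add_mem (vecIdeal_mono (initialIdeal_mono f (Nat.le_succ j)) (hrel z hz)) h3
    · rw [← (h1 z hz).2.2]
      exact ⟨fun hb => h.boundary_of_boundary_succ J (hwt z hz) hb (hrel z hz),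
        fun hb => h.boundary_succ_of_boundary J hmJ (hwt z hz) hb (hrel z hz)⟩
    · obtain ⟨v, hv, hv'⟩ := exists_sub_smul_mem_vecIdeal f w (m + 1) J hDy
        (mulVec_mem_weightPiece h.homogeneous rfl hy)
      have h3 : D.mulVec v ∈ vecIdeal ι (initialIdeal f j) := by
        refine h.mem_of_smul_mem J ?_
        have := mulVec_mem_vecIdeal D hv'
        rw [Matrix.mulVec_sub, h.square, Matrix.mulVec_smul, zero_sub, neg_mem_iff] at this
        exact this
      obtain ⟨z, hz, hb⟩ := h2 v hv h3
      refine ⟨z, hz, h.boundary_succ_of_boundary J hmJ (sub_mem hy (hwt z hz)) hb ?_⟩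
      have := sub_mem hv' (hrel z hz)
      convert this using 1
      rw [LinearMap.comp_apply, Matrix.mulVecLin_apply, Matrix.mulVec_sub, smul_sub]
      abel

end IsDualComplex

end DualComplex

section DualAugmentation

variable {A B ι : Type*} [CommRing A] [CommRing B] [Algebra A B] [Fintype ι]
  {M : Type*} [AddCommGroup M] [Module A M] [Module B M] [IsScalarTower A B M]
  {c : ℕ} {f : Fin c → A} {w : ι → ℤ} {d : Matrix ι ι A} {H : Fin c → Matrix ι ι A}

/-- The weight-zero cocycles modulo `f` are the functionals on the cokernel. -/
lemma exists_functional_of_cocycle (hsurj : Function.Surjective (algebraMap A B))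
    (hker : RingHom.ker (algebraMap A B) = Ideal.span (Set.range f))
    (ε : (ι → A) →ₗ[A] M) (hε : ∀ m, ∃ z ∈ weightPiece A w 0, ε z = m)
    (hε0 : ∀ z ∈ weightPiece A w 0, (ε z = 0 ↔ ∃ y ∈ weightPiece A w 1, z = d.mulVec y))
    (y : ι → A) (hy : d.transpose.mulVec y ∈ vecIdeal ι (initialIdeal f c)) :
    ∃ l : Module.Dual B M, ∀ z ∈ weightPiece A w 0, l (ε z) = algebraMap A B (y ⬝ᵥ z) := by
  choose s hs hs' using hε
  have hz : ∀ z ∈ weightPiece A w 0, ε z = 0 → algebraMap A B (y ⬝ᵥ z) = 0 := by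
    intro z hz h
    obtain ⟨u, -, rfl⟩ := (hε0 z hz).mp h
    rw [← RingHom.mem_ker, hker, ← initialIdeal_top, Matrix.dotProduct_mulVec,
      ← Matrix.mulVec_transpose]
    exact Ideal.sum_mem _ fun i _ => Ideal.mul_mem_right _ _ (mem_vecIdeal.mp hy i)
  have hz' : ∀ z ∈ weightPiece A w 0, algebraMap A B (y ⬝ᵥ s (ε z)) = algebraMap A B (y ⬝ᵥ z) := by
    intro z h
    rw [← sub_eq_zero, ← map_sub, ← dotProduct_sub]
    exact hz _ (sub_mem (hs _) h) (by rw [map_sub, hs', sub_self])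
  refine ⟨⟨⟨fun m => algebraMap A B (y ⬝ᵥ s m), fun m m' => ?_⟩, fun b m => ?_⟩, hz'⟩
  · have := hz' (s m + s m') (add_mem (hs _) (hs _))
    rwa [map_add, hs', hs', dotProduct_add, map_add] at this
  · obtain ⟨a, rfl⟩ := hsurj b
    have := hz' (a • s m) (Submodule.smul_mem _ _ (hs _))
    rw [map_smul, hs', dotProduct_smul, smul_eq_mul, map_mul] at this
    rw [algebraMap_smul]
    exact this

/-- The top cohomology of the dual complex is the dual module. -/
theorem IsDualComplex.exists_augmentation (h : IsDualComplex f w d.transpose H)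
    (hsurj : Function.Surjective (algebraMap A B))
    (hker : RingHom.ker (algebraMap A B) = Ideal.span (Set.range f))
    (ε : (ι → A) →ₗ[A] M) (hε : ∀ m, ∃ z ∈ weightPiece A w 0, ε z = m)
    (hε0 : ∀ z ∈ weightPiece A w 0, (ε z = 0 ↔ ∃ y ∈ weightPiece A w 1, z = d.mulVec y)) :
    ∃ ε' : (ι → A) →ₗ[A] Module.Dual B M,
      (∀ l, ∃ z ∈ weightPiece A w c, ε' z = l) ∧
      ∀ z ∈ weightPiece A w c,
        (ε' z = 0 ↔ ∃ y ∈ weightPiece A w (c - 1), z = d.transpose.mulVec y) := by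
  classical
  obtain ⟨Θ, hΘ⟩ := h.exists_transfer c le_rfl
  obtain ⟨h1, h2⟩ := hΘ 0 (by simp)
  let π : (ι → A) →ₗ[A] (ι → A) := LinearMap.pi fun i =>
    if w i = c then LinearMap.proj i else 0
  have hπ : ∀ z, π z ∈ weightPiece A w c := fun z i hi => by simp [π, if_neg hi]
  have hπ' : ∀ z ∈ weightPiece A w c, π z = z := by
    intro z hz
    ext i
    by_cases hi : w i = c
    · simp [π, if_pos hi]
    · simp [π, if_neg hi, hz i hi]
  choose L hL using fun z => exists_functional_of_cocycle hsurj hker ε hε hε0 (Θ (π z))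
    (h1 _ (hπ z)).2.1
  have huniq : ∀ l l' : Module.Dual B M, (∀ z ∈ weightPiece A w 0, l (ε z) = l' (ε z)) → l = l' := by
    intro l l' hl
    ext m
    obtain ⟨z, hz, rfl⟩ := hε m
    exact hl z hz
  have hzero : ∀ y ∈ weightPiece A w 0, (∀ z ∈ weightPiece A w 0, algebraMap A B (y ⬝ᵥ z) = 0) ↔
      y ∈ IsDualComplex.boundaries f w d.transpose c 0 := by
    intro y hy
    rw [IsDualComplex.mem_boundaries]
    constructor
    · intro hyz
      refine ⟨0, zero_mem _, ?_⟩
      rw [Matrix.mulVec_zero, sub_zero, mem_vecIdeal]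
      intro i
      by_cases hi : w i = 0
      · have := hyz (Pi.single i 1) (fun j hj => Pi.single_eq_of_ne (by rintro rfl; exact hj hi) _)
        rwa [dotProduct_single_one, ← RingHom.mem_ker, hker, ← initialIdeal_top] at this
      · rw [hy i hi]
        exact zero_mem _
    · rintro ⟨u, hu, hv⟩ z -
      have hu0 : u = 0 := funext fun i => hu i (by have := h.nonneg i; omega)
      rw [hu0, Matrix.mulVec_zero, sub_zero] at hv
      rw [← RingHom.mem_ker, hker, ← initialIdeal_top]
      exact Ideal.sum_mem _ fun i _ => Ideal.mul_mem_right _ _ (mem_vecIdeal.mp hv i)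
  let ε' : (ι → A) →ₗ[A] Module.Dual B M :=
    { toFun := L
      map_add' := fun x y => huniq _ _ fun z hz => by
        rw [LinearMap.add_apply, hL _ z hz, hL _ z hz, hL _ z hz, map_add, map_add, add_dotProduct,
          map_add]
      map_smul' := fun a x => huniq _ _ fun z hz => by
        rw [RingHom.id_apply, LinearMap.smul_apply, hL _ z hz, hL _ z hz, map_smul, map_smul,
          smul_dotProduct, smul_eq_mul, map_mul, Algebra.smul_def] }
  have hε' : ∀ x, ∀ z ∈ weightPiece A w 0, ε' x (ε z) = algebraMap A B (Θ (π x) ⬝ᵥ z) := hL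
  refine ⟨ε', fun l => ?_, fun z hz => ?_⟩
  · choose y hy using fun i => hsurj (l (ε (Pi.single i 1)))
    let y0 : ι → A := fun i => if w i = 0 then y i else 0
    have hy0 : y0 ∈ weightPiece A w 0 := fun i hi => by simp [y0, if_neg hi]
    have hly : ∀ z ∈ weightPiece A w 0, l (ε z) = algebraMap A B (y0 ⬝ᵥ z) := by
      intro z hz
      have e1 : ε z = ∑ i, z i • ε (Pi.single i 1) := by
        conv_lhs => rw [← LinearMap.sum_single_apply (φ := fun _ : ι => A) z, map_sum]
        refine Finset.sum_congr rfl fun i _ => ?_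
        rw [← map_smul, ← Pi.single_smul, smul_eq_mul, mul_one]
      rw [e1, map_sum, dotProduct, map_sum]
      refine Finset.sum_congr rfl fun i _ => ?_
      rw [← algebraMap_smul B (z i), map_smul, ← hy, smul_eq_mul, ← map_mul]
      by_cases hi : w i = 0
      · simp [y0, if_pos hi, mul_comm]
      · simp [hz i hi]
    have hDy : d.transpose.mulVec y0 ∈ vecIdeal ι (initialIdeal f c) := by
      rw [mem_vecIdeal]
      intro j
      rw [initialIdeal_top, ← hker, RingHom.mem_ker]
      have hcol : d.transpose.mulVec y0 j = y0 ⬝ᵥ d.mulVec (Pi.single j 1) := by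
        rw [Matrix.dotProduct_mulVec, dotProduct_single_one, Matrix.mulVec_transpose]
      by_cases hj : w j = 1
      · have hmem : Pi.single j (1 : A) ∈ weightPiece A w 1 := fun i hi =>
          Pi.single_eq_of_ne (by rintro rfl; exact hi hj) _
        have hdm : d.mulVec (Pi.single j 1) ∈ weightPiece A w 0 := by
          refine mulVec_mem_weightPiece (e := -1) (fun i k hik => ?_) (by norm_num) hmem
          have := h.homogeneous k i hik
          omega
        rw [hcol, ← hly _ hdm, (hε0 _ hdm).mpr ⟨_, hmem, rfl⟩, map_zero]
      · have := mulVec_mem_weightPiece h.homogeneous (n := 1) (by norm_num) hy0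
        rw [this j hj, map_zero]
    obtain ⟨z, hz, hb⟩ := h2 y0 hy0 hDy
    refine ⟨z, hz, huniq _ _ fun u hu => ?_⟩
    rw [hε' _ u hu, hly u hu, hπ' z hz, eq_comm, ← sub_eq_zero, ← map_sub, ← sub_dotProduct]
    exact (hzero _ (sub_mem hy0 (h1 z hz).1)).mpr hb u hu
  · have e1 : ε' z = 0 ↔ Θ z ∈ IsDualComplex.boundaries f w d.transpose c 0 := by
      rw [← hzero _ (h1 z hz).1]
      constructor
      · intro h0 u hu
        rw [← hπ' z hz, ← hε' z u hu, h0, LinearMap.zero_apply]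
      · intro h0
        refine huniq _ _ fun u hu => ?_
        rw [hε' _ u hu, hπ' z hz, h0 u hu, LinearMap.zero_apply]
    rw [e1, (h1 z hz).2.2, IsDualComplex.mem_boundaries]
    refine exists_congr fun u => and_congr_right fun _ => ?_
    rw [initialIdeal_zero, mem_vecIdeal, funext_iff]
    simp [sub_eq_zero]

end DualAugmentation

section HomotopySystem

variable {A ι : Type*} [CommRing A] [Fintype ι] {M : Type*} [AddCommGroup M] [Module A M]
  {c : ℕ} {f : Fin c → A} {w : ι → ℤ}

lemma sum_mul_coeff_zero (T : Matrix ι ι (MvPolynomial (Fin c) A)) (y : ι → A) (i : ι) :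
    ∑ j, y j * (T.transpose j i).coeff 0 = (T.map (MvPolynomial.coeff 0)).mulVec y i := by
  simp [Matrix.mulVec, dotProduct, mul_comm]

/-- A finite free resolution `ε` of `M`, together with a system of higher homotopies `T` for the
multiplications by `f`. -/
structure IsHomotopySystem [DecidableEq ι] (f : Fin c → A) (w : ι → ℤ)
    (T : Matrix ι ι (MvPolynomial (Fin c) A)) (ε : (ι → A) →ₗ[A] M) : Prop where
  acyclic : IsAcyclicComplex w (T.map (MvPolynomial.coeff 0))
  homogeneous : ∀ i j, T i j ∈ evenGrading A c (w i - w j + 1)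
  square : T * T = (∑ l, MvPolynomial.C (f l) * MvPolynomial.X l : MvPolynomial (Fin c) A) •
    (1 : Matrix ι ι (MvPolynomial (Fin c) A))
  surjective : ∀ m, ∃ z ∈ weightPiece A w 0, ε z = m
  kernel : ∀ z ∈ weightPiece A w 0,
    (ε z = 0 ↔ ∃ y ∈ weightPiece A w 1, z = (T.map (MvPolynomial.coeff 0)).mulVec y)

variable {B : Type*} [CommRing B] [Algebra A B] [Module B M] [IsScalarTower A B M]
  [DecidableEq ι] {T : Matrix ι ι (MvPolynomial (Fin c) A)} {ε : (ι → A) →ₗ[A] M}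

lemma IsHomotopySystem.isCurvedDifferential_transpose (h : IsHomotopySystem f w T ε) :
    IsCurvedDifferential f w T.transpose where
  homogeneous i j := h.homogeneous j i
  square p := by
    rw [Matrix.mulVec_mulVec, ← Matrix.transpose_mul, h.square, Matrix.transpose_smul,
      Matrix.transpose_one, Matrix.smul_mulVec, Matrix.one_mulVec]

lemma IsHomotopySystem.isCurvedDifferential (h : IsHomotopySystem f w T ε) (k : ℤ) :
    IsCurvedDifferential f (fun i => k - w i) T where
  homogeneous i j := by
    have := h.homogeneous i j
    rwa [show w i - w j + 1 = k - w j - (k - w i) + 1 by ring] at this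
  square p := by
    rw [Matrix.mulVec_mulVec, h.square, Matrix.smul_mulVec, Matrix.one_mulVec]

/-- The Betti numbers of `M` over the complete intersection quotient are the dimensions of the
homology of the reduced transpose of a system of higher homotopies. -/
theorem IsHomotopySystem.betti [Nontrivial B] (h : IsHomotopySystem f w T ε)
    (hsurj : Function.Surjective (algebraMap A B))
    (hker : RingHom.ker (algebraMap A B) = Ideal.span (Set.range f))
    (hreg : ∀ (j : Fin c) x, f j * x ∈ initialIdeal f j → x ∈ initialIdeal f j)
    (K : Type*) [Field K] [Algebra A K] [Algebra B K] [IsScalarTower A B K]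
    {β : ℕ → ℕ} (δ : ∀ n, (Fin (β (n + 1)) → B) →ₗ[B] (Fin (β n) → B))
    (η : (Fin (β 0) → B) →ₗ[B] M) (hη : Function.Surjective η)
    (hδ0 : LinearMap.ker η = LinearMap.range (δ 0))
    (hδ : ∀ n, LinearMap.ker (δ n) = LinearMap.range (δ (n + 1)))
    (hδK : ∀ n, mapFieldRank K (δ n) = 0) (n : ℕ) :
    (β n : ℝ) = homologyDim (evenGrading K c)
      (T.map (MvPolynomial.map (algebraMap A K))).transpose w n := by
  have := shamash_betti h.isCurvedDifferential_transpose hsurj hker hreg h.acyclic.nonneg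
    (fun m z hm hz hz' => by
      obtain ⟨y, hy, hy'⟩ := h.acyclic.exact m z hm hz
        (funext fun i => by rw [← sum_mul_coeff_zero]; exact hz' i)
      exact ⟨y, hy, fun i => by rw [sum_mul_coeff_zero, hy']⟩) ε h.surjective
    (fun z hz => by
      rw [h.kernel z hz]
      refine exists_congr fun y => and_congr_right fun _ => ?_
      simp_rw [sum_mul_coeff_zero, funext_iff]) K δ η hη hδ0 hδ hδK n
  rw [this, Matrix.transpose_map]

lemma IsHomotopySystem.isDualComplex (h : IsHomotopySystem f w T ε) (hw : ∀ i, w i ≤ c)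
    (hreg : ∀ (j : Fin c) x, f j * x ∈ initialIdeal f j → x ∈ initialIdeal f j) :
    IsDualComplex f w (T.map (MvPolynomial.coeff 0)).transpose
      fun l => (T.map (MvPolynomial.coeff (Finsupp.single l 1))).transpose where
  homogeneous i j hij := h.acyclic.homogeneous j i hij
  square z := by
    rw [Matrix.mulVec_mulVec, ← Matrix.transpose_mul]
    have : T.map (MvPolynomial.coeff 0) * T.map (MvPolynomial.coeff 0) = 0 := by
      ext i j
      have := congrFun (h.acyclic.square (Pi.single j 1)) i
      rwa [Matrix.mulVec_mulVec, Matrix.mulVec_single_one] at this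
    rw [this, Matrix.transpose_zero, Matrix.zero_mulVec]
  homotopy_homogeneous l i j hij := by
    have := mem_evenGrading.mp (h.homogeneous j i) _ hij
    rw [Finsupp.degree_single] at this
    push_cast at this
    omega
  homotopy l z := by
    have key : T.map (MvPolynomial.coeff (Finsupp.single l 1)) * T.map (MvPolynomial.coeff 0) +
        T.map (MvPolynomial.coeff 0) * T.map (MvPolynomial.coeff (Finsupp.single l 1)) =
        f l • (1 : Matrix ι ι A) := by
      ext i j
      have := congrArg (MvPolynomial.coeff (Finsupp.single l 1)) (congrFun (congrFun h.square i) j)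
      rw [Matrix.mul_apply, MvPolynomial.coeff_sum, Matrix.smul_apply, Matrix.one_apply] at this
      rw [Matrix.add_apply, Matrix.mul_apply, Matrix.mul_apply, ← Finset.sum_add_distrib,
        Matrix.smul_apply, Matrix.one_apply]
      have e1 : ∀ p q : MvPolynomial (Fin c) A, (p * q).coeff (Finsupp.single l 1) =
          p.coeff (Finsupp.single l 1) * q.coeff 0 + p.coeff 0 * q.coeff (Finsupp.single l 1) := by
        intro p q
        rw [MvPolynomial.coeff_mul, Finsupp.antidiagonal_single, Finset.sum_map]
        simp [Finset.Nat.antidiagonal_succ, add_comm]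
      simp_rw [e1] at this
      simp only [Matrix.map_apply]
      rw [this]
      split_ifs
      · rw [smul_eq_mul, mul_one, MvPolynomial.coeff_sum, Finset.sum_eq_single l]
        · simp
        · intro k _ hk
          rw [MvPolynomial.coeff_C_mul, MvPolynomial.coeff_X, if_neg, mul_zero]
          intro e
          exact hk (Finsupp.single_left_injective one_ne_zero e)
        · simp
      · simp
    rw [Matrix.mulVec_mulVec, Matrix.mulVec_mulVec, ← Matrix.transpose_mul, ← Matrix.transpose_mul,
      ← Matrix.add_mulVec, ← Matrix.transpose_add, key, Matrix.transpose_smul,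
      Matrix.transpose_one, Matrix.smul_mulVec, Matrix.one_mulVec]
  nonneg := h.acyclic.nonneg
  le := hw
  regular := hreg

/-- The Betti numbers of the dual of `M` over the complete intersection quotient are the dimensions
of the homology of a reduced system of higher homotopies. -/
theorem IsHomotopySystem.betti_dual [Nontrivial B] (h : IsHomotopySystem f w T ε)
    (hw : ∀ i, w i ≤ c) (hsurj : Function.Surjective (algebraMap A B))
    (hker : RingHom.ker (algebraMap A B) = Ideal.span (Set.range f))
    (hreg : ∀ (j : Fin c) x, f j * x ∈ initialIdeal f j → x ∈ initialIdeal f j)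
    (K : Type*) [Field K] [Algebra A K] [Algebra B K] [IsScalarTower A B K]
    {β : ℕ → ℕ} (δ : ∀ n, (Fin (β (n + 1)) → B) →ₗ[B] (Fin (β n) → B))
    (η : (Fin (β 0) → B) →ₗ[B] Module.Dual B M) (hη : Function.Surjective η)
    (hδ0 : LinearMap.ker η = LinearMap.range (δ 0))
    (hδ : ∀ n, LinearMap.ker (δ n) = LinearMap.range (δ (n + 1)))
    (hδK : ∀ n, mapFieldRank K (δ n) = 0) (n : ℕ) :
    (β n : ℝ) = homologyDim (evenGrading K c)
      (T.map (MvPolynomial.map (algebraMap A K))) (fun i => c - w i) n := by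
  have hD := h.isDualComplex hw hreg
  obtain ⟨ε', h1, h2⟩ := hD.exists_augmentation (B := B) hsurj hker ε h.surjective h.kernel
  have hwt : ∀ (m : ℤ) (z : ι → A), (∀ i, (c : ℤ) - w i ≠ m → z i = 0) ↔
      z ∈ weightPiece A w (c - m) := fun m z => by
    rw [mem_weightPiece]
    refine forall_congr' fun i => ?_
    rw [show ((c : ℤ) - w i ≠ m) ↔ (w i ≠ c - m) by omega]
  have hsum : ∀ (y : ι → A) i, ∑ j, y j * (T j i).coeff 0 =
      (T.map (MvPolynomial.coeff 0)).transpose.mulVec y i := fun y i => by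
    simp [Matrix.mulVec, dotProduct, mul_comm]
  refine shamash_betti (h.isCurvedDifferential c) hsurj hker hreg
    (fun i => sub_nonneg.mpr (hw i)) (fun m z hm hz hz' => ?_) ε' (fun l => ?_) (fun z hz => ?_)
    K δ η hη hδ0 hδ hδK n
  · have hz0 : (T.map (MvPolynomial.coeff 0)).transpose.mulVec z = 0 :=
      funext fun i => by rw [← hsum]; exact hz' i
    obtain ⟨u, hu, hv⟩ := IsDualComplex.mem_boundaries.mp
      (hD.exact_mod 0 (Nat.zero_le c) (by push_cast; omega) ((hwt m z).mp hz)
        (by rw [hz0]; exact zero_mem _))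
    refine ⟨u, (hwt _ _).mpr (by rwa [← sub_sub]), fun i => ?_⟩
    have := mem_vecIdeal.mp hv i
    rw [initialIdeal_zero, Ideal.mem_bot, Pi.sub_apply, sub_eq_zero] at this
    rw [this, hsum]
  · obtain ⟨z, hz, rfl⟩ := h1 l
    exact ⟨z, (hwt 0 z).mpr (by rwa [sub_zero]), rfl⟩
  · rw [h2 z (by have := (hwt 0 z).mp hz; rwa [sub_zero] at this)]
    refine exists_congr fun y => ?_
    rw [hwt]
    simp_rw [hsum, funext_iff]

/-- Restriction of a system of higher homotopies to a single linear combination. -/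
lemma IsHomotopySystem.specialize (h : IsHomotopySystem f w T ε) (a : Fin c → A) :
    IsHomotopySystem (fun _ : Fin 1 => ∑ l, a l * f l) w
      (T.map (MvPolynomial.aeval fun l => MvPolynomial.C (a l) * MvPolynomial.X (0 : Fin 1))) ε := by
  set s : MvPolynomial (Fin c) A →ₐ[A] MvPolynomial (Fin 1) A :=
    MvPolynomial.aeval fun l => MvPolynomial.C (a l) * MvPolynomial.X (0 : Fin 1) with hs
  have h0 : ∀ p, (s p).coeff 0 = p.coeff 0 := by
    intro p
    have : (MvPolynomial.constantCoeff.comp s.toRingHom) =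
        (MvPolynomial.constantCoeff : MvPolynomial (Fin c) A →+* A) := by
      apply MvPolynomial.ringHom_ext
      · intro r
        simp [hs]
      · intro i
        simp [hs]
    exact congrArg (fun φ : MvPolynomial (Fin c) A →+* A => φ p) this
  have hmap : (T.map s).map (MvPolynomial.coeff 0) = T.map (MvPolynomial.coeff 0) := by
    ext i j
    simp [h0]
  refine ⟨hmap ▸ h.acyclic, fun i j => ?_, ?_, h.surjective, hmap ▸ h.kernel⟩
  · rw [Matrix.map_apply]
    have hT := h.homogeneous i j
    rw [(T i j).as_sum, map_sum]
    refine Submodule.sum_mem _ fun b hb => ?_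
    have hdeg := mem_evenGrading.mp hT b (MvPolynomial.mem_support_iff.mp hb)
    have e1 : s (MvPolynomial.monomial b ((T i j).coeff b)) =
        MvPolynomial.C ((T i j).coeff b * ∏ l, a l ^ b l) *
          MvPolynomial.X (0 : Fin 1) ^ b.degree := by
      rw [hs, MvPolynomial.aeval_monomial, Finsupp.prod_fintype _ _ (by simp), map_mul, mul_assoc]
      simp_rw [mul_pow, Finset.prod_mul_distrib, Finset.prod_pow_eq_pow_sum, map_prod, map_pow,
        Finsupp.degree_eq_sum]
      rfl
    rw [e1, mem_evenGrading]
    intro b' hb'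
    rw [MvPolynomial.coeff_C_mul, MvPolynomial.coeff_X_pow] at hb'
    have := right_ne_zero_of_mul hb'
    split_ifs at this with h'
    · rw [← h', Finsupp.degree_single, hdeg]
    · exact absurd rfl this
  · have := congrArg (fun X => X.map s) h.square
    rw [Matrix.map_mul] at this
    rw [this]
    ext1 i j
    rw [Matrix.map_apply, Matrix.smul_apply, Matrix.smul_apply, Matrix.one_apply, Matrix.one_apply]
    split_ifs
    · simp only [hs, smul_eq_mul, mul_one, map_sum, map_mul, MvPolynomial.aeval_X,
        Finset.univ_unique, Finset.sum_singleton, Finset.sum_mul, Fin.default_eq_zero,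
        MvPolynomial.algHom_C, MvPolynomial.algebraMap_eq]
      exact Finset.sum_congr rfl fun l _ => by ring
    · simp

end HomotopySystem

section Slices

variable {A : Type*} [CommRing A] {N : ℕ} {β : ℕ → ℕ}

/-- The homogeneous components of a vector indexed by the basis of a finite complex. -/
def slice (z : (Σ i : Fin (N + 1), Fin (β i)) → A) (i : ℕ) (b : Fin (β i)) : A :=
  if h : i < N + 1 then z ⟨⟨i, h⟩, b⟩ else 0

/-- The vector with given homogeneous components. -/
def glue (V : ∀ i, Fin (β i) → A) : (Σ i : Fin (N + 1), Fin (β i)) → A := fun x => V x.1 x.2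

lemma glue_slice (z : (Σ i : Fin (N + 1), Fin (β i)) → A) : glue (slice z) = z := by
  ext ⟨i, b⟩
  exact dif_pos i.2

lemma slice_glue (hβ : ∀ i, N < i → β i = 0) (V : ∀ i, Fin (β i) → A) :
    slice (N := N) (glue V) = V := by
  ext i b
  by_cases h : i < N + 1
  · simp [slice, h, glue]
  · have := hβ i (by omega)
    exact absurd b.2 (by omega)

lemma slice_add (x y : (Σ i : Fin (N + 1), Fin (β i)) → A) : slice (x + y) = slice x + slice y := by
  ext i b
  simp only [slice, Pi.add_apply]
  split_ifs <;> simp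

lemma slice_smul (a : A) (x : (Σ i : Fin (N + 1), Fin (β i)) → A) : slice (a • x) = a • slice x := by
  ext i b
  simp only [slice, Pi.smul_apply]
  split_ifs <;> simp

/-- The total differential of a complex of free modules. -/
def totalDifferential (d : ∀ i, (Fin (β (i + 1)) → A) →ₗ[A] (Fin (β i) → A)) :
    ((Σ i : Fin (N + 1), Fin (β i)) → A) →ₗ[A] ((Σ i : Fin (N + 1), Fin (β i)) → A) where
  toFun z := glue fun i => d i (slice z (i + 1))
  map_add' x y := by
    ext ⟨i, b⟩
    simp [glue, slice_add]
  map_smul' a x := by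
    ext ⟨i, b⟩
    simp [glue, slice_smul]

lemma mem_weightPiece_iff_slice (m : ℕ)
    (z : (Σ i : Fin (N + 1), Fin (β i)) → A) :
    z ∈ weightPiece A (fun x : Σ i : Fin (N + 1), Fin (β i) => ((x.1 : ℕ) : ℤ)) m ↔
      ∀ i, i ≠ m → slice z i = 0 := by
  constructor
  · intro h i hi
    ext b
    by_cases hiN : i < N + 1
    · simp only [slice, dif_pos hiN]
      exact h _ (by simpa using hi)
    · exact dif_neg hiN
  · rintro h ⟨i, b⟩ hi
    have := congrFun (h i (by simpa using hi)) b
    rwa [slice, dif_pos i.2] at this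

lemma slice_totalDifferential (hβ : ∀ i, N < i → β i = 0)
    (d : ∀ i, (Fin (β (i + 1)) → A) →ₗ[A] (Fin (β i) → A))
    (z : (Σ i : Fin (N + 1), Fin (β i)) → A) (i : ℕ) :
    slice (totalDifferential d z) i = d i (slice z (i + 1)) :=
  congrFun (slice_glue hβ fun i => d i (slice z (i + 1))) i

end Slices

/-- A finite free resolution of a module annihilated by `f` carries a system of higher
homotopies. -/
theorem exists_homotopySystem {A : Type} [CommRing A] {M : Type} [AddCommGroup M] [Module A M]
    {β : ℕ → ℕ} (hres : IsFreeResolutionBetti A M β) {N : ℕ} (hβ : ∀ i, N < i → β i = 0)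
    {c : ℕ} (f : Fin c → A) (hf : ∀ r ∈ Ideal.span (Set.range f), ∀ m : M, r • m = 0) :
    ∃ (T : Matrix (Σ i : Fin (N + 1), Fin (β i)) (Σ i : Fin (N + 1), Fin (β i))
      (MvPolynomial (Fin c) A)) (ε : ((Σ i : Fin (N + 1), Fin (β i)) → A) →ₗ[A] M),
      IsHomotopySystem f (fun x => ((x.1 : ℕ) : ℤ)) T ε := by
  classical
  obtain ⟨d, η, hη, hd0, hd⟩ := hres
  set w : (Σ i : Fin (N + 1), Fin (β i)) → ℤ := fun x => ((x.1 : ℕ) : ℤ) with hw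
  set D := LinearMap.toMatrix' (totalDifferential (N := N) d) with hD
  have hDz : ∀ z, D.mulVec z = totalDifferential d z := fun z => by
    rw [hD, ← Matrix.toLin'_apply, Matrix.toLin'_toMatrix']
  have hsD : ∀ z i, slice (D.mulVec z) i = d i (slice z (i + 1)) := fun z i => by
    rw [hDz, slice_totalDifferential hβ]
  have hext : ∀ z z' : (Σ i : Fin (N + 1), Fin (β i)) → A,
      (∀ i, slice z i = slice z' i) → z = z' := fun z z' h => by
    rw [← glue_slice z, ← glue_slice z', show slice z = slice z' from funext h]
  have hs0 : ∀ i, slice (0 : (Σ i : Fin (N + 1), Fin (β i)) → A) i = 0 := fun i => by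
    ext b
    simp [slice]
  have hdd : ∀ i x, d i (d (i + 1) x) = 0 := fun i x => by
    rw [← LinearMap.mem_ker, hd i]
    exact ⟨x, rfl⟩
  have hex : ∀ (m : ℕ) (z : (Σ i : Fin (N + 1), Fin (β i)) → A), z ∈ weightPiece A w m →
      slice z m ∈ LinearMap.range (d m) → ∃ y ∈ weightPiece A w (m + 1), z = D.mulVec y := by
    rintro m z hz ⟨u, hu⟩
    have hz := (mem_weightPiece_iff_slice m z).mp hz
    refine ⟨glue (Pi.single (m + 1) u), ?_, hext _ _ fun i => ?_⟩
    · have := (mem_weightPiece_iff_slice (m + 1) (glue (Pi.single (m + 1) u))).mpr fun i hi => by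
        rw [slice_glue hβ, Pi.single_eq_of_ne hi]
      exact_mod_cast this
    · rw [hsD, slice_glue hβ]
      by_cases hi : i = m
      · subst hi
        rw [Pi.single_eq_same, hu]
      · rw [Pi.single_eq_of_ne (by omega), map_zero, hz i hi]
  have hacyc : IsAcyclicComplex w D := by
    refine ⟨fun x y hxy => ?_, fun z => hext _ _ fun i => ?_, fun m z hm hz hz0 => ?_, fun x => ?_⟩
    · by_contra h
      apply hxy
      have e1 : D x y = D.mulVec (Pi.single y 1) x := by
        rw [Matrix.mulVec_single_one, Matrix.col_apply]
      have e2 : slice (Pi.single y (1 : A)) ((x.1 : ℕ) + 1) = 0 := by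
        refine (mem_weightPiece_iff_slice (y.1 : ℕ) (Pi.single y (1 : A))).mp
          (fun v hv => ?_) _ ?_
        · exact Pi.single_eq_of_ne (by rintro rfl; exact hv rfl) _
        · intro h'
          exact h (by simp only [hw, ← h']; push_cast; ring)
      rw [e1, hDz]
      change d x.1 (slice (Pi.single y (1 : A)) ((x.1 : ℕ) + 1)) x.2 = 0
      rw [e2, map_zero, Pi.zero_apply]
    · rw [hsD, hsD, hdd, hs0]
    · obtain ⟨n, rfl⟩ : ∃ n : ℕ, m = (n + 1 : ℕ) := ⟨(m - 1).toNat, by omega⟩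
      have h1 : slice z (n + 1) ∈ LinearMap.range (d (n + 1)) := by
        rw [← hd n, LinearMap.mem_ker, ← hsD, hz0, hs0]
      exact hex (n + 1) z hz h1
    · simp [hw]
  let ε : ((Σ i : Fin (N + 1), Fin (β i)) → A) →ₗ[A] M :=
    { toFun := fun z => η (slice z 0)
      map_add' := fun x y => by rw [slice_add, Pi.add_apply, map_add]
      map_smul' := fun a x => by rw [slice_smul, Pi.smul_apply, map_smul, RingHom.id_apply] }
  have hε : ∀ z, ε z = η (slice z 0) := fun _ => rfl
  have hker : ∀ z ∈ weightPiece A w 0, (ε z = 0 ↔ ∃ y ∈ weightPiece A w 1, z = D.mulVec y) := by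
    intro z hz
    constructor
    · intro h
      rw [hε, ← LinearMap.mem_ker, hd0] at h
      simpa using hex 0 z (by simpa using hz) h
    · rintro ⟨y, -, rfl⟩
      rw [hε, hsD, ← LinearMap.mem_ker, hd0]
      exact ⟨_, rfl⟩
  obtain ⟨T, hT, hT0, hTT⟩ := hacyc.exists_higherHomotopies f fun j hj r hr => by
    have hmem : r • Pi.single j (1 : A) ∈ weightPiece A w 0 :=
      Submodule.smul_mem _ _ fun i hi =>
        Pi.single_eq_of_ne (by rintro rfl; exact hi hj) _
    exact (hker _ hmem).mp (by rw [map_smul, hf r hr])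
  have hmap : T.map (MvPolynomial.coeff 0) = D := by
    ext i j
    exact hT0 i j
  refine ⟨T, ε, hmap ▸ hacyc, hT, ?_, fun m => ?_, hmap ▸ hker⟩
  · convert hTT
  · obtain ⟨v, rfl⟩ := hη m
    refine ⟨glue (Pi.single 0 v), ?_, ?_⟩
    · have := (mem_weightPiece_iff_slice 0 (glue (Pi.single 0 v))).mpr fun i hi => by
        rw [slice_glue hβ, Pi.single_eq_of_ne hi]
      exact_mod_cast this
    · rw [hε, slice_glue hβ, Pi.single_eq_same]

section RegularSequences

open RingTheory.Sequence
open scoped Pointwise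

lemma ofList_take_ofFn {A : Type*} [CommRing A] {c : ℕ} (f : Fin c → A) (j : ℕ) :
    Ideal.ofList ((List.ofFn f).take j) = initialIdeal f j := by
  rw [initialIdeal, Ideal.ofList]
  congr 1
  ext x
  simp only [Set.mem_ofPred_eq, Set.mem_image, List.mem_take_iff_getElem, List.length_ofFn,
    List.getElem_ofFn]
  constructor
  · rintro ⟨i, hi, rfl⟩
    exact ⟨⟨i, by omega⟩, by simp; omega, rfl⟩
  · rintro ⟨l, hl, rfl⟩
    exact ⟨l, by simp only [lt_inf_iff]; exact ⟨hl, l.2⟩, rfl⟩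

lemma isWeaklyRegular_ofFn_iff {A : Type*} [CommRing A] {c : ℕ} (f : Fin c → A) :
    IsWeaklyRegular A (List.ofFn f) ↔
      ∀ (j : Fin c) x, f j * x ∈ initialIdeal f j → x ∈ initialIdeal f j := by
  have key (j : Fin c) : IsSMulRegular
      (A ⧸ (Ideal.ofList ((List.ofFn f).take j) • ⊤ : Submodule A A)) (f j) ↔
      ∀ x, f j * x ∈ initialIdeal f j → x ∈ initialIdeal f j := by
    rw [isSMulRegular_quotient_iff_mem_of_smul_mem]
    simp [ofList_take_ofFn]
  rw [isWeaklyRegular_iff]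
  constructor
  · intro h j
    rw [← key]
    simpa using h j (by simp)
  · intro h i hi
    have hi' : i < c := by simpa using hi
    simpa using (key ⟨i, hi'⟩).2 (h ⟨i, hi'⟩)

lemma ofList_ofFn {A : Type*} [CommRing A] {c : ℕ} (f : Fin c → A) :
    Ideal.ofList (List.ofFn f) = Ideal.span (Set.range f) := by
  rw [← initialIdeal_top, ← ofList_take_ofFn, List.take_of_length_le (by simp)]

lemma quotSMulTop_isWeaklyRegular_iff {A : Type*} [CommRing A] (g : A) (rs : List (A ⧸ Ideal.span {g})) :
    IsWeaklyRegular (QuotSMulTop g A) rs ↔ IsWeaklyRegular (A ⧸ Ideal.span {g}) rs := by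
  have e : (g • ⊤ : Submodule A A) = Ideal.span {g} := by
    rw [← Submodule.ideal_span_singleton_smul]; simp
  let E : QuotSMulTop g A ≃ₗ[A] A ⧸ Ideal.span {g} := Submodule.quotEquivOfEq _ _ e
  refine AddEquiv.isWeaklyRegular_congr (e := E.toAddEquiv) ?_
  rw [List.forall₂_same]
  intro r _ x
  obtain ⟨r, rfl⟩ := Ideal.Quotient.mk_surjective r
  exact E.map_smul r x

/-- A general linear combination of a regular sequence in a local ring can replace its
first element. -/
lemma isWeaklyRegular_quotient_linearCombination {A : Type*} [CommRing A] [IsNoetherianRing A]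
    [IsLocalRing A] {c : ℕ} (f : Fin (c + 1) → A) (hf : ∀ i, f i ∈ maximalIdeal A)
    (hreg : IsWeaklyRegular A (List.ofFn f)) (a : Fin (c + 1) → A) (ha : IsUnit (a 0)) :
    IsSMulRegular A (∑ l, a l * f l) ∧
    IsWeaklyRegular (A ⧸ Ideal.span {∑ l, a l * f l})
      (List.ofFn fun i : Fin c => Ideal.Quotient.mk (Ideal.span {∑ l, a l * f l}) (f i.succ)) := by
  set g := ∑ l, a l * f l with hg
  set rs := List.ofFn fun i : Fin c => f i.succ with hrs
  have hrsm : ∀ r ∈ rs, r ∈ maximalIdeal A := by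
    intro r hr
    obtain ⟨i, rfl⟩ := List.mem_ofFn.1 hr
    exact hf _
  have hgm : g ∈ maximalIdeal A := Ideal.sum_mem _ fun l _ => Ideal.mul_mem_left _ _ (hf l)
  have h1 : IsWeaklyRegular A (rs ++ [f 0]) := by
    refine IsLocalRing.isWeaklyRegular_of_perm_of_subset_maximalIdeal hreg ?_ ?_
    · rw [List.ofFn_succ]
      exact (List.perm_append_singleton _ _).symm
    · intro r hr
      obtain ⟨i, rfl⟩ := List.mem_ofFn.1 hr
      exact hf _
  have h2 : IsWeaklyRegular A (rs ++ [g]) := by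
    rw [isWeaklyRegular_append_iff, isWeaklyRegular_singleton_iff,
      isSMulRegular_quotient_iff_mem_of_smul_mem] at h1 ⊢
    refine ⟨h1.1, fun x hx => h1.2 x ?_⟩
    simp only [smul_eq_mul, Ideal.mul_top] at hx ⊢
    have : a 0 * (f 0 * x) ∈ Ideal.ofList rs := by
      have e : a 0 * (f 0 * x) = g * x - (∑ l : Fin c, a l.succ * f l.succ) * x := by
        rw [hg, Fin.sum_univ_succ]; ring
      rw [e]
      refine Ideal.sub_mem _ hx (Ideal.mul_mem_right _ _ (Ideal.sum_mem _ fun l _ =>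
        Ideal.mul_mem_left _ _ (Ideal.subset_span ?_)))
      exact List.mem_ofFn.2 ⟨l, rfl⟩
    exact (Ideal.unit_mul_mem_iff_mem _ ha).1 this
  have h3 : IsWeaklyRegular A (g :: rs) := by
    refine IsLocalRing.isWeaklyRegular_of_perm_of_subset_maximalIdeal h2
      (List.perm_append_singleton _ _) ?_
    simp only [List.mem_append, List.mem_singleton]
    rintro r (h | rfl)
    exacts [hrsm r h, hgm]
  rw [isWeaklyRegular_cons_iff'] at h3
  refine ⟨h3.1, ?_⟩
  rw [← quotSMulTop_isWeaklyRegular_iff]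
  simpa [hrs, List.map_ofFn, Function.comp_def] using h3.2

lemma mapFieldRank_eq_zero_of_range_le {B : Type*} [CommRing B] [IsLocalRing B] (K : Type*) [Field K]
    [Algebra B K] (hK : ∀ r ∈ maximalIdeal B, algebraMap B K r = 0) {F G : Type*}
    [AddCommGroup F] [Module B F] [AddCommGroup G] [Module B G] (d : F →ₗ[B] G)
    (h : LinearMap.range d ≤ maximalIdeal B • (⊤ : Submodule B G)) : mapFieldRank K d = 0 := by
  have key : ∀ y ∈ maximalIdeal B • (⊤ : Submodule B G), (1 : K) ⊗ₜ[B] y = 0 := by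
    intro y hy
    refine Submodule.smul_induction_on hy (fun r hr n _ => ?_) (fun x y hx hy => ?_)
    · rw [← TensorProduct.smul_tmul, Algebra.smul_def, mul_one, hK r hr, TensorProduct.zero_tmul]
    · rw [TensorProduct.tmul_add, hx, hy, add_zero]
  have : d.baseChange K = 0 := by
    ext x
    simpa using key _ (h ⟨x, rfl⟩)
  rw [mapFieldRank, this]
  rw [LinearMap.range_zero, finrank_bot]

end RegularSequences

section Limsup

lemma eventually_int_of_nat {P : ℤ → Prop} (h : ∀ᶠ n : ℕ in atTop, P n) : ∀ᶠ n : ℤ in atTop, P n := by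
  obtain ⟨m, hm⟩ := eventually_atTop.1 h
  filter_upwards [eventually_ge_atTop (m : ℤ)] with n hn
  lift n to ℕ using by omega
  exact hm n (by exact_mod_cast hn)

lemma natCast_div_pow_eq_ofReal (b N : ℕ) {i : ℕ} (hi : 0 < i) :
    (b : ENNReal) / (i : ENNReal) ^ N = ENNReal.ofReal ((b : ℝ) / (i : ℝ) ^ N) := by
  rw [ENNReal.ofReal_div_of_pos (by positivity), ENNReal.ofReal_pow (by positivity)]
  simp

lemma atTop_eq_even_sup_odd :
    (atTop : Filter ℕ) = map (fun n => 2 * n) atTop ⊔ map (fun n => 2 * n + 1) atTop := by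
  apply le_antisymm
  · intro s hs
    obtain ⟨⟨a, ha⟩, ⟨b, hb⟩⟩ := And.intro (mem_atTop_sets.1 hs.1) (mem_atTop_sets.1 hs.2)
    rw [mem_atTop_sets]
    refine ⟨2 * (a + b), fun n hn => ?_⟩
    rcases Nat.even_or_odd' n with ⟨k, rfl | rfl⟩
    · exact ha k (by omega)
    · exact hb k (by omega)
  · exact sup_le (tendsto_atTop_mono (fun n => by simp only [id]; omega) tendsto_id)
      (tendsto_atTop_mono (fun n => by simp only [id]; omega) tendsto_id)

lemma ParityAsymptotic.limsup_eq {N : ℕ} {a : ℤ → ℝ} {r : ZMod 2 → ℝ} (h : ParityAsymptotic N a r)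
    {β : ℕ → ℕ} (hβ : ∀ n : ℕ, (β n : ℝ) = a n) :
    limsup (fun i : ℕ => (β i : ENNReal) / (i : ENNReal) ^ N) atTop =
      ENNReal.ofReal (r 0) ⊔ ENNReal.ofReal (r 1) := by
  have h1 : Tendsto (fun n : ℕ => (β n : ℝ) / (n : ℝ) ^ N - r (n : ZMod 2)) atTop (𝓝 0) := by
    have := Tendsto.comp h (tendsto_natCast_atTop_atTop (R := ℤ))
    refine this.congr fun n => ?_
    simp [hβ]
  have h2 : limsup (fun i : ℕ => (β i : ENNReal) / (i : ENNReal) ^ N) atTop =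
      limsup (fun i : ℕ => ENNReal.ofReal ((β i : ℝ) / (i : ℝ) ^ N)) atTop := by
    refine limsup_congr ?_
    filter_upwards [eventually_gt_atTop 0] with i hi using natCast_div_pow_eq_ofReal _ _ hi
  rw [h2, atTop_eq_even_sup_odd, limsup_sup_filter]
  have key (φ : ℕ → ℕ) (hφ : Tendsto φ atTop atTop) (e : ZMod 2) (he : ∀ n, (φ n : ZMod 2) = e) :
      limsup (fun i : ℕ => ENNReal.ofReal ((β i : ℝ) / (i : ℝ) ^ N)) (map φ atTop) =
        ENNReal.ofReal (r e) := by
    have h3 := (h1.comp hφ).add_const (r e)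
    rw [zero_add] at h3
    have h4 : Tendsto (fun n => (β (φ n) : ℝ) / (φ n : ℝ) ^ N) atTop (𝓝 (r e)) :=
      h3.congr fun n => by simp [he]
    exact ((ENNReal.continuous_ofReal.tendsto _).comp h4).limsup_eq
  congr 1
  · refine key _ (tendsto_atTop_mono (fun n => by simp only [id]; omega) tendsto_id) 0 fun n => ?_
    push_cast
    rw [show (2 : ZMod 2) = 0 from rfl, zero_mul]
  · refine key _ (tendsto_atTop_mono (fun n => by simp only [id]; omega) tendsto_id) 1 fun n => ?_
    push_cast
    rw [show (2 : ZMod 2) = 0 from rfl, zero_mul, zero_add]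

lemma limsup_eq_top_of_not_polynomiallyBounded {N : ℕ} {a : ℤ → ℝ}
    {β : ℕ → ℕ} (hβ : ∀ n : ℕ, (β n : ℝ) = a n) (h : ¬ PolynomiallyBounded N a) :
    limsup (fun i : ℕ => (β i : ENNReal) / (i : ENNReal) ^ N) atTop = ⊤ := by
  by_contra hne
  refine h ?_
  obtain ⟨C, hC⟩ := exists_between (lt_top_iff_ne_top.2 hne)
  refine ⟨C.toReal, eventually_int_of_nat ?_⟩
  filter_upwards [eventually_lt_of_limsup_lt hC.1, eventually_gt_atTop 0] with i hi hi0
  rw [natCast_div_pow_eq_ofReal _ _ hi0] at hi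
  have := (ENNReal.ofReal_lt_iff_lt_toReal (by positivity) hC.2.ne).1 hi
  have hp : (0 : ℝ) < (i : ℝ) ^ N := by positivity
  rw [div_lt_iff₀ hp] at this
  rw [← hβ]
  exact_mod_cast this.le

lemma sup_ofReal_sub (r : ZMod 2 → ℝ) (k : ZMod 2) :
    ENNReal.ofReal (r (0 - k)) ⊔ ENNReal.ofReal (r (1 - k)) =
      ENNReal.ofReal (r 0) ⊔ ENNReal.ofReal (r 1) := by
  fin_cases k
  · rfl
  · exact sup_comm _ _

end Limsup

section MinimalResolutions

lemma mem_ideal_smul_top_pi_iff {R : Type*} [CommRing R] {n : ℕ} (I : Ideal R) (x : Fin n → R) :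
    x ∈ I • (⊤ : Submodule R (Fin n → R)) ↔ ∀ i, x i ∈ I := by
  classical
  constructor
  · intro hx i
    refine Submodule.smul_induction_on hx (fun r hr y _ => ?_) (fun y z hy hz => ?_)
    · exact I.mul_mem_right _ hr
    · exact I.add_mem hy hz
  · intro h
    rw [← Finset.univ_sum_single x]
    refine Submodule.sum_mem _ fun i _ => ?_
    have : Pi.single i (x i) = x i • (Pi.single i 1 : Fin n → R) := by
      rw [← Pi.single_smul, smul_eq_mul, mul_one]
    rw [this]
    exact Submodule.smul_mem_smul (h i) trivial

/-- Every finite module over a local ring is a quotient of a free module by vectors with entries in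
the maximal ideal. -/
lemma exists_minimal_surjection {R : Type*} [CommRing R] [IsLocalRing R] (N : Type*)
    [AddCommGroup N] [Module R N] [Module.Finite R N] :
    ∃ (n : ℕ) (ε : (Fin n → R) →ₗ[R] N), Function.Surjective ε ∧
      LinearMap.ker ε ≤ maximalIdeal R • (⊤ : Submodule R (Fin n → R)) := by
  classical
  have hex : ∃ (n : ℕ) (ε : (Fin n → R) →ₗ[R] N), Function.Surjective ε := Module.Finite.exists_fin' R N
  obtain ⟨ε, hε⟩ := Nat.find_spec hex
  refine ⟨_, ε, hε, fun v hv => ?_⟩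
  rw [mem_ideal_smul_top_pi_iff]
  by_contra! hnot
  obtain ⟨i, hi⟩ := hnot
  have hu : IsUnit (v i) := by simpa using hi
  generalize hn : Nat.find hex = n at *
  obtain _ | n := n
  · exact i.elim0
  obtain ⟨b, hb⟩ := hu.exists_left_inv
  refine Nat.find_min hex (m := n) (by omega)
    ⟨ε ∘ₗ LinearMap.pi (fun j => (if h : ∃ k, i.succAbove k = j then LinearMap.proj h.choose else 0)),
      fun y => ?_⟩
  obtain ⟨x, rfl⟩ := hε y
  refine ⟨fun k => (x - (x i * b) • v) (i.succAbove k), ?_⟩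
  have : ε x = ε (x - (x i * b) • v) := by
    rw [map_sub, map_smul, LinearMap.mem_ker.1 hv, smul_zero, sub_zero]
  rw [this, LinearMap.comp_apply]
  congr 1
  ext j
  rw [LinearMap.pi_apply]
  split_ifs with h
  · rw [LinearMap.proj_apply, h.choose_spec]
  · have : j = i := by
      by_contra hne
      exact h (Fin.exists_succAbove_eq hne)
    subst this
    simp [mul_assoc, hb]

theorem exists_minimalFreeResolution (R : Type) [CommRing R] [IsNoetherianRing R] [IsLocalRing R]
    (M : Type) [AddCommGroup M] [Module R M] [Module.Finite R M] :
    ∃ β, IsMinimalFreeResolutionBetti R M β := by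
  obtain ⟨n₀, ε, hε, hεm⟩ := exists_minimal_surjection (R := R) M
  choose F hF using fun s : Σ n : ℕ, Submodule R (Fin n → R) =>
    exists_minimal_surjection (R := R) s.2
  choose e he hem using hF
  let s : ℕ → Σ n : ℕ, Submodule R (Fin n → R) := fun i =>
    Nat.rec ⟨n₀, LinearMap.ker ε⟩ (fun _ s => ⟨F s, LinearMap.ker (e s)⟩) i
  have hrange : ∀ i, LinearMap.range ((s i).2.subtype ∘ₗ e (s i)) = (s i).2 := fun i => by
    rw [LinearMap.range_comp, LinearMap.range_eq_top.2 (he _), Submodule.map_top,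
      Submodule.range_subtype]
  refine ⟨fun i => (s i).1, fun i => (s i).2.subtype ∘ₗ e (s i), ε, hε, (hrange 0).symm,
    fun i => ?_, fun i => ?_⟩
  · refine Eq.trans ?_ (hrange (i + 1)).symm
    exact LinearMap.ker_comp_of_ker_eq_bot _ (Submodule.ker_subtype _)
  · refine (hrange i).le.trans ?_
    cases i with
    | zero => exact hεm
    | succ i => exact hem _

end MinimalResolutions

section Specialization

open MvPolynomial

/-- The restriction of a homogeneous polynomial to a line. -/
lemma aeval_line_of_mem_evenGrading {S : Type*} [CommRing S] {c m : ℕ}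
    {p : MvPolynomial (Fin c) S} (hp : p ∈ evenGrading S c (2 * m)) (a : Fin c → S) :
    aeval (fun l => C (a l) * X (0 : Fin 1)) p = C (eval a p) * X (0 : Fin 1) ^ m := by
  conv_lhs => rw [p.as_sum]
  rw [map_sum, eval_eq', map_sum, Finset.sum_mul]
  refine Finset.sum_congr rfl fun b hb => ?_
  have hdeg := mem_evenGrading.mp hp b (mem_support_iff.mp hb)
  have hm : m = b.degree := by omega
  rw [hm, aeval_monomial, Finsupp.prod_fintype _ _ (by simp), map_mul, mul_assoc]
  simp_rw [mul_pow, Finset.prod_mul_distrib, Finset.prod_pow_eq_pow_sum, map_prod, map_pow,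
    Finsupp.degree_eq_sum]
  rfl

lemma exists_eq_two_mul_of_mem_evenGrading {S : Type*} [CommRing S] {c : ℕ} {n : ℤ}
    {p : MvPolynomial (Fin c) S} (hp : p ∈ evenGrading S c n) (hp0 : p ≠ 0) :
    ∃ m : ℕ, n = 2 * m := by
  obtain ⟨b, hb⟩ := ne_zero_iff.mp hp0
  exact ⟨b.degree, (mem_evenGrading.mp hp b hb).symm⟩

lemma C_mul_X_pow_mem_evenGrading {S : Type*} [CommRing S] (u : S) (m : ℕ) :
    C u * X (0 : Fin 1) ^ m ∈ evenGrading S 1 (2 * m) := by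
  rw [mem_evenGrading]
  intro b hb
  rw [coeff_C_mul, coeff_X_pow] at hb
  have := right_ne_zero_of_mul hb
  split_ifs at this with h'
  · rw [← h', Finsupp.degree_single]
  · exact absurd rfl this

lemma aeval_line_mem_evenGrading {S : Type*} [CommRing S] {c : ℕ} {n : ℤ}
    {p : MvPolynomial (Fin c) S} (hp : p ∈ evenGrading S c n) (a : Fin c → S) :
    aeval (fun l => C (a l) * X (0 : Fin 1)) p ∈ evenGrading S 1 n := by
  by_cases hp0 : p = 0
  · rw [hp0, map_zero]; exact zero_mem _
  · obtain ⟨m, rfl⟩ := exists_eq_two_mul_of_mem_evenGrading hp hp0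
    rw [aeval_line_of_mem_evenGrading hp]
    exact C_mul_X_pow_mem_evenGrading _ _

lemma exists_eq_X_pow_mul {K : Type*} [CommRing K] {m : ℕ} {d : ℤ} (hd : -1 ≤ d)
    {p : MvPolynomial (Fin 1) K} (hp : p ∈ evenGrading K 1 (d + 2 * m)) :
    ∃ q ∈ evenGrading K 1 d, p = X 0 ^ m * q := by
  by_cases hp0 : p = 0
  · exact ⟨0, zero_mem _, by rw [hp0, mul_zero]⟩
  · obtain ⟨k, hk⟩ := exists_eq_two_mul_of_mem_evenGrading hp hp0
    rw [hk] at hp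
    have e := aeval_line_of_mem_evenGrading hp (fun _ => 1)
    have e2 : aeval (fun _ : Fin 1 => C (1 : K) * X (0 : Fin 1)) p = p := by
      have : (fun _ : Fin 1 => C (1 : K) * X (0 : Fin 1)) = X := by
        funext l; rw [map_one, one_mul, Subsingleton.elim l 0]
      rw [this, aeval_X_left_apply]
    rw [e2] at e
    obtain ⟨t, rfl⟩ : ∃ t : ℕ, k = t + m := ⟨k - m, by omega⟩
    refine ⟨C (eval (fun _ => 1) p) * X 0 ^ t, ?_, ?_⟩
    · have : d = 2 * (t : ℤ) := by push_cast at hk; linarith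
      rw [this]
      exact C_mul_X_pow_mem_evenGrading _ _
    · rw [← mul_assoc, mul_comm (X 0 ^ m), mul_assoc, ← pow_add, add_comm m t]
      exact e

variable {ι : Type*} [Fintype ι]

lemma homologyDim_eq_zero_of_exact {K R : Type*} [Field K] [CommRing R] [Algebra K R]
    {𝒜 : ℤ → Submodule K R} [∀ n, FiniteDimensional K (𝒜 n)] {D : Matrix ι ι R} {w : ι → ℤ} {n : ℤ}
    (h : ∀ x ∈ gradedPiece 𝒜 w n, D.mulVec x = 0 ↔
      ∃ y ∈ gradedPiece 𝒜 w (n - 1), D.mulVec y = x)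
    (h' : ∀ y ∈ gradedPiece 𝒜 w (n - 1), D.mulVec y ∈ gradedPiece 𝒜 w n) :
    homologyDim 𝒜 D w n = 0 := by
  set L := (mulVecK K D).domRestrict (gradedPiece 𝒜 w n) with hL
  have h1 := L.finrank_range_add_finrank_ker
  have h2 : LinearMap.range L = (gradedPiece 𝒜 w n).map (mulVecK K D) :=
    LinearMap.range_domRestrict _ _
  have h3 : (LinearMap.ker L).map (gradedPiece 𝒜 w n).subtype =
      (gradedPiece 𝒜 w (n - 1)).map (mulVecK K D) := by
    ext x
    simp only [Submodule.mem_map, LinearMap.mem_ker, Submodule.subtype_apply, Subtype.exists,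
      exists_and_right, exists_eq_right]
    constructor
    · rintro ⟨hx, hx'⟩
      exact (h x hx).1 hx'
    · rintro ⟨y, hy, rfl⟩
      exact ⟨h' y hy, (h _ (h' y hy)).2 ⟨y, hy, rfl⟩⟩
  have h4 := Submodule.finrank_map_subtype_eq (gradedPiece 𝒜 w n) (LinearMap.ker L)
  rw [h3] at h4
  rw [h2, ← h4] at h1
  rw [homologyDim, gradedRank, gradedRank, ← h1]
  push_cast
  ring

lemma homologyDim_eq_zero_of_nullHomotopic [DecidableEq ι] {K : Type*} [Field K] {w : ι → ℤ} {c : ℤ}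
    {D H : Matrix ι ι (MvPolynomial (Fin 1) K)}
    (hD : IsHomogeneousDifferential (evenGrading K 1) w D) (hDD : D * D = 0)
    (hw : ∀ i, w i ≤ c) {m : ℕ} {u : K} (hu : u ≠ 0)
    (hH : IsHomogeneousMatrix (evenGrading K 1) (fun i => w i + 1 - 2 * m) w H)
    (hDH : D * H + H * D = (C u * X 0 ^ m : MvPolynomial (Fin 1) K) • (1 : Matrix ι ι _))
    {n : ℤ} (hn : c ≤ n) : homologyDim (evenGrading K 1) D w n = 0 := by
  have hDmem : ∀ y ∈ gradedPiece (evenGrading K 1) w (n - 1),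
      D.mulVec y ∈ gradedPiece (evenGrading K 1) w n := fun y hy => by
    have := mulVec_mem_gradedPiece hD hy
    rw [mem_gradedPiece] at this ⊢
    intro i
    rw [show n - w i = n - 1 - (w i - 1) by ring]
    exact this i
  refine homologyDim_eq_zero_of_exact (fun x hx => ⟨fun hx0 => ?_, ?_⟩) hDmem
  · have h1 := mem_gradedPiece.1 (mulVec_mem_gradedPiece hH hx)
    have h2 : ∀ i, ∃ q ∈ evenGrading K 1 (n - 1 - w i), H.mulVec x i = X 0 ^ m * q := fun i =>
      exists_eq_X_pow_mul (by have := hw i; omega)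
        (by rw [show n - 1 - w i + 2 * (m : ℤ) = n - (w i + 1 - 2 * m) by ring]; exact h1 i)
    choose q hq hq' using h2
    have hHx : H.mulVec x = (X 0 ^ m : MvPolynomial (Fin 1) K) • q := funext hq'
    have h3 : D.mulVec (H.mulVec x) = (C u * X 0 ^ m : MvPolynomial (Fin 1) K) • x := by
      have := congrArg (fun Y => Y.mulVec x) hDH
      simpa [Matrix.add_mulVec, ← Matrix.mulVec_mulVec, hx0, Matrix.smul_mulVec] using this
    rw [hHx, Matrix.mulVec_smul] at h3
    have hX : (X 0 ^ m : MvPolynomial (Fin 1) K) ≠ 0 := pow_ne_zero _ (X_ne_zero _)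
    have h4 : D.mulVec q = (C u : MvPolynomial (Fin 1) K) • x := by
      refine smul_right_injective _ hX ?_
      simp only
      rw [h3, smul_smul, mul_comm]
    refine ⟨u⁻¹ • q, Submodule.smul_mem _ _ (mem_gradedPiece.2 hq), ?_⟩
    have h5 : u⁻¹ • q = (C u⁻¹ : MvPolynomial (Fin 1) K) • q := by
      funext i
      simp [C_mul']
    rw [h5, Matrix.mulVec_smul, h4, smul_smul, ← C_mul, inv_mul_cancel₀ hu, C_1, one_smul]
  · rintro ⟨y, _, rfl⟩
    rw [Matrix.mulVec_mulVec, hDD, Matrix.zero_mulVec]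


/-- If the homology of a reduced system of higher homotopies grows slower than the polynomial ring,
then a general linear combination of the sequence annihilates it in high degrees. -/
theorem IsHomotopySystem.exists_specialize {A ι : Type*} [CommRing A] [Fintype ι] [DecidableEq ι]
    {M : Type*} [AddCommGroup M] [Module A M] {c : ℕ} {f : Fin (c + 1) → A} {w : ι → ℤ}
    {T : Matrix ι ι (MvPolynomial (Fin (c + 1)) A)} {ε : (ι → A) →ₗ[A] M}
    (h : IsHomotopySystem f w T ε) (hw : ∀ i, w i ≤ c + 1) (K : Type*) [Field K] [Infinite K]
    [Algebra A K] (hK : Function.Surjective (algebraMap A K)) (hfK : ∀ l, algebraMap A K (f l) = 0)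
    (hh : ParityAsymptotic c (homologyDim (evenGrading K (c + 1))
      (T.map (MvPolynomial.map (algebraMap A K))).transpose w) (fun _ => 0)) :
    ∃ a : Fin (c + 1) → A, algebraMap A K (a 0) ≠ 0 ∧ ∀ n : ℤ, c + 1 ≤ n →
      homologyDim (evenGrading K 1) ((T.map (MvPolynomial.aeval fun l =>
        MvPolynomial.C (a l) * MvPolynomial.X (0 : Fin 1))).map
          (MvPolynomial.map (algebraMap A K))).transpose w n = 0 := by
  set D := (T.map (MvPolynomial.map (algebraMap A K))).transpose with hDdef
  have hD : IsHomogeneousDifferential (evenGrading K (c + 1)) w D :=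
    h.isCurvedDifferential_transpose.map_homogeneous K
  have hDD : D * D = 0 := by
    rw [hDdef, ← Matrix.transpose_mul, ← Matrix.map_mul, h.square]
    ext1 i j
    rw [Matrix.transpose_apply, Matrix.map_apply, Matrix.smul_apply, Matrix.one_apply]
    split_ifs <;> simp [hfK]
  obtain ⟨q, hq, hilb⟩ := hilbert_asymptotic K c
  obtain ⟨p, hp, H, hH⟩ := exists_nullHomotopic (evenGrading_odd K (c + 1)) hilb hq hD hDD hh
  obtain ⟨e, p', hp', hp'e, H', hH', hDH⟩ := exists_homogeneous_nullHomotopic hD hp hH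
  obtain ⟨m, rfl⟩ := exists_eq_two_mul_of_mem_evenGrading hp'e hp'
  obtain ⟨b, hb⟩ : ∃ b : Fin (c + 1) → K, eval b (p' * X 0) ≠ 0 := by
    by_contra! hcon
    exact mul_ne_zero hp' (X_ne_zero 0) (MvPolynomial.funext fun x => by rw [hcon x, map_zero])
  rw [map_mul, eval_X] at hb
  choose a ha using fun l => hK (b l)
  refine ⟨a, by rw [ha]; exact right_ne_zero_of_mul hb, fun n hn => ?_⟩
  set s : MvPolynomial (Fin (c + 1)) K →ₐ[K] MvPolynomial (Fin 1) K :=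
    aeval (fun l => C (b l) * X (0 : Fin 1)) with hs
  have hcomm : ((T.map (MvPolynomial.aeval fun l =>
        MvPolynomial.C (a l) * MvPolynomial.X (0 : Fin 1))).map
          (MvPolynomial.map (algebraMap A K))).transpose = D.map s := by
    ext1 i j
    simp only [hDdef, Matrix.transpose_apply, Matrix.map_apply]
    generalize T j i = t
    have : (MvPolynomial.map (algebraMap A K)).comp
        (MvPolynomial.aeval fun l => MvPolynomial.C (a l) * MvPolynomial.X (0 : Fin 1) :
          MvPolynomial (Fin (c + 1)) A →ₐ[A] MvPolynomial (Fin 1) A).toRingHom =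
        s.toRingHom.comp (MvPolynomial.map (algebraMap A K)) := by
      apply MvPolynomial.ringHom_ext
      · intro r
        simp [hs]
      · intro i
        simp [hs, ha]
    exact congrArg (fun φ : MvPolynomial (Fin (c + 1)) A →+* MvPolynomial (Fin 1) K => φ t) this
  rw [hcomm]
  refine homologyDim_eq_zero_of_nullHomotopic (c := c + 1) (H := H'.map s) (m := m)
    (u := eval b p') ?_ ?_ hw (left_ne_zero_of_mul hb) ?_ ?_ hn
  · exact fun i j => aeval_line_mem_evenGrading (hD i j) b
  · rw [← Matrix.map_mul, hDD]
    exact Matrix.map_zero _ (map_zero s)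
  · exact fun i j => aeval_line_mem_evenGrading (hH' i j) b
  · rw [← Matrix.map_mul, ← Matrix.map_mul, ← Matrix.map_add _ (map_add s), hDH,
      ← aeval_line_of_mem_evenGrading hp'e b]
    ext1 i j
    simp only [Matrix.map_apply, Matrix.smul_apply, Matrix.one_apply, smul_eq_mul, map_mul]
    split_ifs <;> simp [hs]

end Specialization

section InfiniteResidueField

open RingTheory.Sequence

variable {A : Type} [CommRing A] {B : Type} [CommRing B] [IsLocalRing B] [Algebra A B]

lemma residueField_algebraMap_eq_zero [IsLocalRing A]
    (hsurj : Function.Surjective (algebraMap A B)) (r : A) (hr : r ∈ maximalIdeal A) :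
    algebraMap A (ResidueField B) r = 0 := by
  have := IsLocalHom.of_surjective _ hsurj
  rw [IsScalarTower.algebraMap_apply A B (ResidueField B), ResidueField.algebraMap_eq,
    residue_eq_zero_iff]
  exact (mem_maximalIdeal _).2 fun h => (mem_maximalIdeal _).1 hr (isUnit_of_map_unit _ _ h)

lemma residueField_algebraMap_surjective (hsurj : Function.Surjective (algebraMap A B)) :
    Function.Surjective (algebraMap A (ResidueField B)) := by
  rw [IsScalarTower.algebraMap_eq A B (ResidueField B)]
  exact (residue_surjective).comp hsurj

lemma PolynomiallyBounded.asymptotic_zero_of_nat {N : ℕ} {a : ℤ → ℝ} (ha : PolynomiallyBounded N a)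
    {β : ℕ → ℕ} (hβ : ∀ n : ℕ, (β n : ℝ) = a n) {d : ℕ} (hd : N < d) :
    ParityAsymptotic d a (fun _ => 0) := by
  have heq : ∀ᶠ n : ℤ in atTop, (β n.toNat : ℝ) = a n := by
    filter_upwards [eventually_ge_atTop 0] with n hn
    rw [hβ, Int.toNat_of_nonneg hn]
  have h1 : PolynomiallyBounded N (fun n => (β n.toNat : ℝ)) := by
    obtain ⟨C, hC⟩ := ha
    exact ⟨C, by filter_upwards [hC, heq] with n h1 h2; rwa [h2]⟩
  refine (h1.asymptotic_zero (fun n => by positivity) hd).congr' ?_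
  filter_upwards [heq] with n hn
  simp only [hn]

lemma ker_quotient_linearCombination {c : ℕ} (f : Fin (c + 1) → A)
    (hker : RingHom.ker (algebraMap A B) = Ideal.span (Set.range f)) (a : Fin (c + 1) → A)
    (ha : IsUnit (a 0)) (φ : A ⧸ Ideal.span {∑ l, a l * f l} →+* B)
    (hφ : ∀ x, φ (Ideal.Quotient.mk _ x) = algebraMap A B x) :
    RingHom.ker φ = Ideal.span (Set.range fun i : Fin c =>
      Ideal.Quotient.mk (Ideal.span {∑ l, a l * f l}) (f i.succ)) := by
  set g := ∑ l, a l * f l with hg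
  have hfker : ∀ l, algebraMap A B (f l) = 0 := fun l => by
    rw [← RingHom.mem_ker, hker]; exact Ideal.subset_span ⟨l, rfl⟩
  apply le_antisymm
  · intro x hx
    obtain ⟨x, rfl⟩ := Ideal.Quotient.mk_surjective x
    rw [RingHom.mem_ker, hφ, ← RingHom.mem_ker, hker] at hx
    set J := Ideal.span (Set.range fun i : Fin c => Ideal.Quotient.mk (Ideal.span {g}) (f i.succ))
      with hJ
    have hsucc : ∀ i : Fin c, Ideal.Quotient.mk (Ideal.span {g}) (f i.succ) ∈ J := fun i =>
      Ideal.subset_span ⟨i, rfl⟩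
    suffices Ideal.span (Set.range f) ≤ J.comap (Ideal.Quotient.mk _) from this hx
    rw [Ideal.span_le]
    rintro _ ⟨l, rfl⟩
    refine Fin.cases ?_ (fun i => hsucc i) l
    change Ideal.Quotient.mk (Ideal.span {g}) (f 0) ∈ J
    rw [← Ideal.unit_mul_mem_iff_mem J (ha.map (Ideal.Quotient.mk (Ideal.span {g}))), ← map_mul]
    have e : a 0 * f 0 = g - ∑ l : Fin c, a l.succ * f l.succ := by
      rw [hg, Fin.sum_univ_succ]; ring
    rw [e, map_sub, Ideal.Quotient.eq_zero_iff_mem.2 (Ideal.mem_span_singleton_self g), zero_sub,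
      map_sum]
    refine J.neg_mem (J.sum_mem fun i _ => ?_)
    rw [map_mul]
    exact J.mul_mem_left _ (hsucc i)
  · rw [Ideal.span_le]
    rintro _ ⟨i, rfl⟩
    rw [SetLike.mem_coe, RingHom.mem_ker, hφ, hfker]

/-- The Betti numbers of `M` and of its dual are computed by one and the same reduced system of higher
homotopies. -/
lemma exists_homotopySystem_betti (M : Type) [AddCommGroup M] [Module B M] {β β' : ℕ → ℕ}
    (hβ : IsMinimalFreeResolutionBetti B M β)
    (hβ' : IsMinimalFreeResolutionBetti B (Module.Dual B M) β') {c : ℕ} [Module A M]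
    [IsScalarTower A B M] (hsurj : Function.Surjective (algebraMap A B))
    {f : Fin c → A} (hreg : IsWeaklyRegular A (List.ofFn f))
    (hker : RingHom.ker (algebraMap A B) = Ideal.span (Set.range f))
    (hres : ∃ βA, IsFreeResolutionBetti A M βA ∧ ∀ i, c < i → βA i = 0) :
    ∃ (ι : Type) (_ : Fintype ι) (_ : DecidableEq ι) (w : ι → ℤ)
      (T : Matrix ι ι (MvPolynomial (Fin c) A)) (ε : (ι → A) →ₗ[A] M),
      IsHomotopySystem f w T ε ∧ (∀ i, w i ≤ c) ∧
      (∀ n : ℕ, (β n : ℝ) = homologyDim (evenGrading (ResidueField B) c)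
        (T.map (MvPolynomial.map (algebraMap A (ResidueField B)))).transpose w n) ∧
      (∀ n : ℕ, (β' n : ℝ) = homologyDim (evenGrading (ResidueField B) c)
        (T.map (MvPolynomial.map (algebraMap A (ResidueField B)))) (fun i => c - w i) n) := by
  obtain ⟨βA, hres, hβA⟩ := hres
  obtain ⟨T, ε, h⟩ := exists_homotopySystem hres hβA f fun r hr m => by
    rw [← hker, RingHom.mem_ker] at hr
    rw [← algebraMap_smul B r m, hr, zero_smul]
  have hw : ∀ i : (Σ i : Fin (c + 1), Fin (βA i)), ((i.1 : ℕ) : ℤ) ≤ c := fun i => by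
    have := i.1.2
    omega
  obtain ⟨δ, η, hη, hδ0, hδ, hm⟩ := hβ
  obtain ⟨δ', η', hη', hδ0', hδ', hm'⟩ := hβ'
  have hK : ∀ r ∈ maximalIdeal B, algebraMap B (ResidueField B) r = 0 := fun r hr =>
    (residue_eq_zero_iff r).2 hr
  have hreg' := (isWeaklyRegular_ofFn_iff f).1 hreg
  exact ⟨_, inferInstance, inferInstance, _, T, ε, h, hw,
    h.betti hsurj hker hreg' (ResidueField B) δ η hη hδ0 hδ
      (fun n => mapFieldRank_eq_zero_of_range_le _ hK _ (hm n)),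
    h.betti_dual hw hsurj hker hreg' (ResidueField B) δ' η' hη' hδ0' hδ'
      (fun n => mapFieldRank_eq_zero_of_range_le _ hK _ (hm' n))⟩

lemma limsup_eq_of_le_succ {K : Type*} [Field K] [Algebra A K] {M : Type*} [AddCommGroup M]
    [Module A M] {ι : Type*} [Fintype ι] [DecidableEq ι] {c N : ℕ} {f : Fin c → A}
    {w : ι → ℤ} {T : Matrix ι ι (MvPolynomial (Fin c) A)} {ε : (ι → A) →ₗ[A] M}
    (h : IsHomotopySystem f w T ε) {β β' : ℕ → ℕ}
    (hβ : ∀ n : ℕ, (β n : ℝ) = homologyDim (evenGrading K c)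
      (T.map (MvPolynomial.map (algebraMap A K))).transpose w n)
    (hβ' : ∀ n : ℕ, (β' n : ℝ) = homologyDim (evenGrading K c)
      (T.map (MvPolynomial.map (algebraMap A K))) (fun i => c - w i) n)
    (hc : c ≤ N + 1) :
    limsup (fun i : ℕ => (β i : ENNReal) / (i : ENNReal) ^ N) atTop
      = limsup (fun i : ℕ => (β' i : ENNReal) / (i : ENNReal) ^ N) atTop := by
  obtain ⟨q, hilb⟩ := exists_hilbert_asymptotic K c hc
  obtain ⟨r, h1, h2⟩ := homologyDim_transpose_asymptotic (evenGrading_odd K c) hilb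
    (h.isCurvedDifferential_transpose.map_homogeneous K) c
  rw [h1.limsup_eq hβ, h2.limsup_eq hβ']
  exact (sup_ofReal_sub r _).symm

/-- Over an infinite residue field, the Betti numbers of a module of projective dimension at most
`c` over a complete intersection of codimension `c` and those of its dual have the same growth. -/
theorem limsup_betti_eq_of_infinite (M : Type) [AddCommGroup M] [Module B M]
    [Module.Finite B M] [Infinite (ResidueField B)] {β β' : ℕ → ℕ}
    (hβ : IsMinimalFreeResolutionBetti B M β)
    (hβ' : IsMinimalFreeResolutionBetti B (Module.Dual B M) β') (N : ℕ) (c : ℕ) :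
    ∀ (A : Type) [CommRing A] [IsNoetherianRing A] [IsLocalRing A] [Algebra A B] [Module A M]
      [IsScalarTower A B M], Function.Surjective (algebraMap A B) →
      ∀ f : Fin c → A, (∀ i, f i ∈ maximalIdeal A) → IsWeaklyRegular A (List.ofFn f) →
      RingHom.ker (algebraMap A B) = Ideal.span (Set.range f) →
      (∃ βA, IsFreeResolutionBetti A M βA ∧ ∀ i, c < i → βA i = 0) →
    limsup (fun i : ℕ => (β i : ENNReal) / (i : ENNReal) ^ N) atTop
      = limsup (fun i : ℕ => (β' i : ENNReal) / (i : ENNReal) ^ N) atTop := by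
  set K := ResidueField B
  induction c with
  | zero =>
    intro A _ _ _ _ _ _ hsurj f hf hreg hker hres
    obtain ⟨ι, _, _, w, T, ε, h, hw, hb, hb'⟩ :=
      exists_homotopySystem_betti M hβ hβ' hsurj hreg hker hres
    exact limsup_eq_of_le_succ h hb hb' (Nat.zero_le _)
  | succ c ih =>
    intro A _ _ _ _ _ _ hsurj f hf hreg hker hres
    obtain ⟨ι, _, _, w, T, ε, h, hw, hb, hb'⟩ :=
      exists_homotopySystem_betti M hβ hβ' hsurj hreg hker hres
    by_cases hc : c + 1 ≤ N + 1
    · exact limsup_eq_of_le_succ h hb hb' hc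
    set D := (T.map (MvPolynomial.map (algebraMap A K))).transpose with hDdef
    by_cases hP : ¬ PolynomiallyBounded N (homologyDim (evenGrading K (c + 1)) D w) ∧
      ¬ PolynomiallyBounded N (homologyDim (evenGrading K (c + 1)) D.transpose
        (fun i => (c + 1 : ℕ) - w i))
    · rw [limsup_eq_top_of_not_polynomiallyBounded hb hP.1,
        limsup_eq_top_of_not_polynomiallyBounded hb' hP.2]
    have hh : ParityAsymptotic c (homologyDim (evenGrading K (c + 1)) D w) (fun _ => 0) := by
      rw [not_and_or, not_not, not_not] at hP
      rcases hP with hP | hP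
      · exact hP.asymptotic_zero_of_nat hb (by omega)
      · have h0 := hP.asymptotic_zero_of_nat hb' (d := c) (by omega)
        obtain ⟨q, hq, hilb⟩ := hilbert_asymptotic K c
        obtain ⟨r, h1, h2⟩ := homologyDim_transpose_asymptotic (evenGrading_odd K (c + 1)) hilb
          (h.isCurvedDifferential_transpose.map_homogeneous K) ((c + 1 : ℕ) : ℤ)
        have h3 := h2.unique h0
        have h4 : r = fun _ => 0 := by
          funext e
          have := congrFun h3 (e + ((c + 1 : ℕ) : ℤ))
          simpa using this
        rwa [h4] at h1
    have hfK : ∀ l, algebraMap A K (f l) = 0 := fun l =>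
      residueField_algebraMap_eq_zero hsurj _ (hf l)
    obtain ⟨a, ha, hvan⟩ := h.exists_specialize (by exact_mod_cast hw) K
      (residueField_algebraMap_surjective hsurj) hfK hh
    have ha : IsUnit (a 0) := by
      by_contra hcon
      exact ha (residueField_algebraMap_eq_zero hsurj _ ((mem_maximalIdeal _).2 hcon))
    obtain ⟨hg, hreg'⟩ := isWeaklyRegular_quotient_linearCombination f hf hreg a ha
    have hspec := h.specialize a
    have hgm : ∑ l, a l * f l ∈ maximalIdeal A :=
      Ideal.sum_mem _ fun l _ => Ideal.mul_mem_left _ _ (hf l)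
    have hgB : algebraMap A B (∑ l, a l * f l) = 0 := by
      rw [← RingHom.mem_ker, hker]
      exact Ideal.sum_mem _ fun l _ => Ideal.mul_mem_left _ _ (Ideal.subset_span ⟨l, rfl⟩)
    have hkerφ := ker_quotient_linearCombination (B := B) f hker a ha
    generalize (∑ l, a l * f l) = g at *
    have : Nontrivial (A ⧸ Ideal.span {g}) := Ideal.Quotient.nontrivial_iff.2 fun htop => by
      rw [Ideal.span_singleton_eq_top] at htop
      exact hgm htop
    have : IsLocalRing (A ⧸ Ideal.span {g}) :=
      IsLocalRing.of_surjective' (Ideal.Quotient.mk _) Ideal.Quotient.mk_surjective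
    let φ : A ⧸ Ideal.span {g} →+* B := Ideal.Quotient.lift _ (algebraMap A B) fun x hx => by
      obtain ⟨y, rfl⟩ := Ideal.mem_span_singleton'.1 hx
      rw [map_mul, hgB, mul_zero]
    have hφ : ∀ x, φ (Ideal.Quotient.mk _ x) = algebraMap A B x := fun x => rfl
    let : Algebra (A ⧸ Ideal.span {g}) B := φ.toAlgebra
    let : Module (A ⧸ Ideal.span {g}) M := Module.compHom M φ
    have : IsScalarTower (A ⧸ Ideal.span {g}) B M := ⟨fun x b m => mul_smul (φ x) b m⟩
    have : IsScalarTower A (A ⧸ Ideal.span {g}) B := IsScalarTower.of_algebraMap_eq fun x => rfl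
    have : IsScalarTower A (A ⧸ Ideal.span {g}) M := ⟨fun x y m => by
      change φ (x • y) • m = x • (φ y • m)
      rw [Algebra.smul_def, map_mul, mul_smul]
      exact algebraMap_smul B x _⟩
    have hsurj' : Function.Surjective (algebraMap (A ⧸ Ideal.span {g}) B) := fun b => by
      obtain ⟨x, rfl⟩ := hsurj b
      exact ⟨Ideal.Quotient.mk _ x, rfl⟩
    have : Module.Finite (A ⧸ Ideal.span {g}) B :=
      Module.Finite.of_surjective (Algebra.linearMap _ _) hsurj'
    have : Module.Finite (A ⧸ Ideal.span {g}) M := Module.Finite.trans B M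
    obtain ⟨βA, δ, η, hη, hδ0, hδ, hm⟩ := exists_minimalFreeResolution (A ⧸ Ideal.span {g}) M
    refine ih (A ⧸ Ideal.span {g}) hsurj' _ (fun i => ?_) hreg' (hkerφ φ hφ)
      ⟨βA, ⟨δ, η, hη, hδ0, hδ⟩, fun i hi => ?_⟩
    · have := IsLocalHom.of_surjective _ (Ideal.Quotient.mk_surjective (I := Ideal.span {g}))
      exact (mem_maximalIdeal _).2 fun hu => (mem_maximalIdeal _).1 (hf i.succ)
        (isUnit_of_map_unit _ _ hu)
    · have key := hspec.betti (B := A ⧸ Ideal.span {g}) Ideal.Quotient.mk_surjective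
        (by rw [Ideal.Quotient.algebraMap_eq, Ideal.mk_ker, Set.range_const])
        ((isWeaklyRegular_ofFn_iff _).1 (by simpa using hg)) K δ η hη hδ0 hδ
        (fun n => mapFieldRank_eq_zero_of_range_le _ (residueField_algebraMap_eq_zero hsurj') _
          (hm n)) i
      rw [hvan i (by omega)] at key
      exact_mod_cast key

end InfiniteResidueField

section BaseChangeFree

variable {R S : Type} [CommRing R] [CommRing S]

/-- The base change of a map of finite free modules along a ring homomorphism. -/
noncomputable def LinearMap.mapPi (g : R →+* S) {n m : ℕ} (d : (Fin n → R) →ₗ[R] (Fin m → R)) :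
    (Fin n → S) →ₗ[S] (Fin m → S) :=
  ((LinearMap.toMatrix' d).map g).mulVecLin

lemma LinearMap.mapPi_comp_apply (g : R →+* S) {n m : ℕ} (d : (Fin n → R) →ₗ[R] (Fin m → R))
    (v : Fin n → R) : d.mapPi g (g ∘ v) = g ∘ d v := by
  ext i
  rw [LinearMap.mapPi, Matrix.mulVecLin_apply, Function.comp_apply]
  conv_rhs => rw [← LinearMap.toMatrix'_mulVec d v]
  rw [RingHom.map_mulVec]

lemma LinearMap.mapPi_apply_mem (g : R →+* S) (I : Ideal R) (J : Ideal S)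
    (hIJ : ∀ x ∈ I, g x ∈ J) {n m : ℕ} (d : (Fin n → R) →ₗ[R] (Fin m → R))
    (hd : LinearMap.range d ≤ I • ⊤) : LinearMap.range (d.mapPi g) ≤ J • ⊤ := by
  rintro _ ⟨v, rfl⟩
  rw [mem_ideal_smul_top_pi_iff]
  intro i
  rw [LinearMap.mapPi, Matrix.mulVecLin_apply, Matrix.mulVec, dotProduct]
  refine Ideal.sum_mem _ fun j _ => Ideal.mul_mem_right _ _ ?_
  rw [Matrix.map_apply, LinearMap.toMatrix'_apply]
  exact hIJ _ ((mem_ideal_smul_top_pi_iff _ _).1 (hd ⟨_, rfl⟩) i)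

end BaseChangeFree

section AuslanderBuchsbaum

lemma exists_mem_maximalIdeal_nonZeroDivisors {R : Type} [CommRing R] [IsLocalRing R]
    [IsNoetherianRing R] (h : ∀ a : R, (∀ r ∈ maximalIdeal R, r * a = 0) → a = 0) :
    ∃ x ∈ maximalIdeal R, x ∈ nonZeroDivisors R := by
  by_contra! hcon
  have hsub : (maximalIdeal R : Set R) ⊆ ⋃ p ∈ associatedPrimes R R, p := by
    rw [biUnion_associatedPrimes_eq_compl_nonZeroDivisors]
    exact hcon
  obtain ⟨p, hp, hle⟩ := (Ideal.subset_union_prime_finite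
    (associatedPrimes.finite R R) (f := id) 0 0 (fun p hp _ _ => hp.isPrime)).1 hsub
  obtain ⟨hprime, a, ha⟩ := (isAssociatedPrime_iff (R := R)).1 hp
  have ha0 : a = 0 := h a fun r hr => by
    have := hle hr
    rw [id, ha] at this
    simpa using this
  apply hprime.ne_top
  rw [ha, ha0]
  simp

lemma exists_nonZeroDivisors_of_injective {R : Type} [CommRing R] [IsLocalRing R]
    [IsNoetherianRing R] {n m : ℕ} (hn : n ≠ 0) (d : (Fin n → R) →ₗ[R] (Fin m → R))
    (hd : LinearMap.ker d = ⊥) (hm : LinearMap.range d ≤ maximalIdeal R • ⊤) :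
    ∃ x ∈ maximalIdeal R, x ∈ nonZeroDivisors R := by
  refine exists_mem_maximalIdeal_nonZeroDivisors fun a ha => ?_
  let j : Fin n := ⟨0, Nat.pos_of_ne_zero hn⟩
  have hz : a • (Pi.single j 1 : Fin n → R) ∈ LinearMap.ker d := by
    rw [LinearMap.mem_ker, map_smul]
    ext i
    rw [Pi.smul_apply, smul_eq_mul, mul_comm]
    exact ha _ ((mem_ideal_smul_top_pi_iff _ _).1 (hm ⟨_, rfl⟩) i)
  rw [hd, Submodule.mem_bot] at hz
  simpa using congrFun hz j

lemma comp_mk_eq_zero_iff {R : Type} [CommRing R] (x : R) {n : ℕ} (v : Fin n → R) :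
    Ideal.Quotient.mk (Ideal.span {x}) ∘ v = 0 ↔ ∃ w, v = x • w := by
  constructor
  · intro h
    have : ∀ i, ∃ b, v i = x * b := fun i => by
      have := congrFun h i
      rw [Function.comp_apply, Pi.zero_apply, Ideal.Quotient.eq_zero_iff_mem,
        Ideal.mem_span_singleton] at this
      exact this
    choose w hw using this
    exact ⟨w, funext hw⟩
  · rintro ⟨w, rfl⟩
    ext i
    rw [Function.comp_apply, Pi.zero_apply, Ideal.Quotient.eq_zero_iff_mem]
    exact Ideal.mul_mem_right _ _ (Ideal.mem_span_singleton_self x)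

lemma ker_mapPi_mk_eq_range {R : Type} [CommRing R] {x : R} (hx : x ∈ nonZeroDivisors R)
    {n₀ n₁ n₂ n₃ : ℕ} (d₀ : (Fin n₁ → R) →ₗ[R] (Fin n₀ → R))
    (d₁ : (Fin n₂ → R) →ₗ[R] (Fin n₁ → R)) (d₂ : (Fin n₃ → R) →ₗ[R] (Fin n₂ → R))
    (h₁ : LinearMap.ker d₀ = LinearMap.range d₁) (h₂ : LinearMap.ker d₁ = LinearMap.range d₂) :
    LinearMap.ker (d₁.mapPi (Ideal.Quotient.mk (Ideal.span {x}))) =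
      LinearMap.range (d₂.mapPi (Ideal.Quotient.mk (Ideal.span {x}))) := by
  have lift : ∀ {n : ℕ} (v : Fin n → R ⧸ Ideal.span {x}),
      ∃ w, v = Ideal.Quotient.mk (Ideal.span {x}) ∘ w := fun v => by
    choose w hw using fun i => Ideal.Quotient.mk_surjective (v i)
    exact ⟨w, (funext hw).symm⟩
  ext v
  obtain ⟨v, rfl⟩ := lift v
  rw [LinearMap.mem_ker, LinearMap.mapPi_comp_apply, comp_mk_eq_zero_iff, LinearMap.mem_range]
  constructor
  · rintro ⟨w, hw⟩
    have hw0 : w ∈ LinearMap.ker d₀ := by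
      have h0 : d₀ (d₁ v) = 0 := by
        rw [← LinearMap.mem_ker, h₁]
        exact ⟨v, rfl⟩
      rw [hw, map_smul] at h0
      rw [LinearMap.mem_ker]
      ext i
      exact (mul_right_mem_nonZeroDivisors_eq_zero_iff hx).1
        ((mul_comm _ _).trans (congrFun h0 i))
    rw [h₁] at hw0
    obtain ⟨u, rfl⟩ := hw0
    have hv : v - x • u ∈ LinearMap.ker d₁ := by
      rw [LinearMap.mem_ker, map_sub, map_smul, hw, sub_self]
    rw [h₂] at hv
    obtain ⟨t, ht⟩ := hv
    refine ⟨Ideal.Quotient.mk _ ∘ t, ?_⟩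
    rw [LinearMap.mapPi_comp_apply, ht]
    ext i
    simp [Ideal.Quotient.eq_zero_iff_mem.2 (Ideal.mem_span_singleton_self x)]
  · rintro ⟨t, ht⟩
    obtain ⟨t, rfl⟩ := lift t
    rw [LinearMap.mapPi_comp_apply] at ht
    obtain ⟨w, hw⟩ := (comp_mk_eq_zero_iff x (v - d₂ t)).1 (by
      ext i
      have := congrFun ht i
      simp only [Function.comp_apply] at this
      simp [this])
    refine ⟨d₁ w, ?_⟩
    have h0 : d₁ (d₂ t) = 0 := by
      rw [← LinearMap.mem_ker, h₂]
      exact ⟨t, rfl⟩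
    rw [← map_smul, ← hw, map_sub, h0, sub_zero]

lemma exists_nonZeroDivisors_of_exact {R : Type} [CommRing R] [IsLocalRing R]
    [IsNoetherianRing R] (β : ℕ → ℕ) (d : ∀ i, (Fin (β (i + 1)) → R) →ₗ[R] (Fin (β i) → R))
    (hker : ∀ i, LinearMap.ker (d i) = LinearMap.range (d (i + 1)))
    (hmin : ∀ i, LinearMap.range (d i) ≤ maximalIdeal R • ⊤)
    (hβ : ∃ n, ∀ i, n < i → β i = 0) (h : ∃ i, 0 < i ∧ β i ≠ 0) :
    ∃ x ∈ maximalIdeal R, x ∈ nonZeroDivisors R := by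
  classical
  obtain ⟨N, hN⟩ := hβ
  obtain ⟨i, hi, hi0⟩ := h
  have hiN : i ≤ N := by
    by_contra! hlt
    exact hi0 (hN i hlt)
  obtain ⟨p, hp⟩ : ∃ p, p + 1 = Nat.findGreatest (fun i => β i ≠ 0) N := by
    have : i ≤ Nat.findGreatest (fun i => β i ≠ 0) N := Nat.le_findGreatest hiN hi0
    exact ⟨Nat.findGreatest (fun i => β i ≠ 0) N - 1, by omega⟩
  have hp0 : β (p + 1) ≠ 0 := hp ▸ Nat.findGreatest_spec (P := fun i => β i ≠ 0) hiN hi0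
  have hp1 : β (p + 1 + 1) = 0 := by
    by_contra hne
    rcases le_or_gt (p + 1 + 1) N with hle | hlt
    · exact Nat.findGreatest_is_greatest (P := fun i => β i ≠ 0) (by omega) hle hne
    · exact hne (hN _ hlt)
  refine exists_nonZeroDivisors_of_injective hp0 (d p) ?_ (hmin p)
  have : IsEmpty (Fin (β (p + 1 + 1))) := by rw [hp1]; infer_instance
  rw [hker, LinearMap.range_eq_bot]
  exact Subsingleton.elim _ _

theorem betti_eq_zero_of_exact_of_ringKrullDim_le (D : ℕ) :
    ∀ (R : Type) [CommRing R] [IsLocalRing R] [IsNoetherianRing R], ringKrullDim R ≤ D →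
      ∀ (β : ℕ → ℕ) (d : ∀ i, (Fin (β (i + 1)) → R) →ₗ[R] (Fin (β i) → R)),
        (∀ i, LinearMap.ker (d i) = LinearMap.range (d (i + 1))) →
        (∀ i, LinearMap.range (d i) ≤ maximalIdeal R • ⊤) →
        (∃ n, ∀ i, n < i → β i = 0) → ∀ i, D < i → β i = 0 := by
  induction D with
  | zero =>
    intro R _ _ _ hdim β d hker hmin hβ
    by_contra! hcon
    obtain ⟨x, hxm, hx⟩ := exists_nonZeroDivisors_of_exact β d hker hmin hβ
      (hcon.imp fun i hi => ⟨by omega, hi.2⟩)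
    have h1 := (ringKrullDim_quotient_succ_le_of_nonZeroDivisor hx).trans hdim
    have : Nontrivial (R ⧸ Ideal.span {x}) := Ideal.Quotient.nontrivial_iff.2 fun htop => by
      rw [Ideal.span_singleton_eq_top] at htop
      exact hxm htop
    have h2 : 0 ≤ ringKrullDim (R ⧸ Ideal.span {x}) := ringKrullDim_nonneg_of_nontrivial
    have h3 := (add_le_add_left h2 1).trans h1
    norm_num at h3
  | succ D ih =>
    intro R _ _ _ hdim β d hker hmin hβ
    by_contra! hcon
    obtain ⟨x, hxm, hx⟩ := exists_nonZeroDivisors_of_exact β d hker hmin hβ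
      (hcon.imp fun i hi => ⟨by omega, hi.2⟩)
    have h1 := (ringKrullDim_quotient_succ_le_of_nonZeroDivisor hx).trans hdim
    have : Nontrivial (R ⧸ Ideal.span {x}) := Ideal.Quotient.nontrivial_iff.2 fun htop => by
      rw [Ideal.span_singleton_eq_top] at htop
      exact hxm htop
    have : IsLocalRing (R ⧸ Ideal.span {x}) :=
      IsLocalRing.of_surjective' (Ideal.Quotient.mk _) Ideal.Quotient.mk_surjective
    have h2 : ringKrullDim (R ⧸ Ideal.span {x}) ≤ D := by
      rw [Nat.cast_add, Nat.cast_one] at h1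
      exact (ENat.WithBot.add_le_add_one_right_iff).1 h1
    obtain ⟨N, hN⟩ := hβ
    obtain ⟨i, hi, hi0⟩ := hcon
    obtain ⟨i, rfl⟩ : ∃ j, i = j + 1 := ⟨i - 1, by omega⟩
    refine hi0 (ih (R ⧸ Ideal.span {x}) h2 (fun i => β (i + 1))
      (fun i => (d (i + 1)).mapPi (Ideal.Quotient.mk _))
      (fun i => ker_mapPi_mk_eq_range hx _ _ _ (hker i) (hker (i + 1)))
      (fun i => LinearMap.mapPi_apply_mem _ (maximalIdeal R) _ (fun r hr => ?_) _ (hmin _))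
      ⟨N, fun i hi => hN _ (by omega)⟩ i (by omega))
    have := IsLocalHom.of_surjective _ (Ideal.Quotient.mk_surjective (I := Ideal.span {x}))
    exact (mem_maximalIdeal _).2 fun hu => (mem_maximalIdeal _).1 hr (isUnit_of_map_unit _ _ hu)

end AuslanderBuchsbaum

section ProjectiveDimension

open CategoryTheory

lemma ker_eq_bot_of_projective {R : Type} [CommRing R] [IsLocalRing R] {F N : Type}
    [AddCommGroup F] [Module R F] [Module.Finite R F] [AddCommGroup N] [Module R N]
    [Module.Projective R N] (ε : F →ₗ[R] N) (hε : Function.Surjective ε)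
    (hmin : LinearMap.ker ε ≤ maximalIdeal R • ⊤) : LinearMap.ker ε = ⊥ := by
  obtain ⟨s, hs⟩ := Module.projective_lifting_property ε LinearMap.id hε
  have hsε : ∀ x, ε (s x) = x := fun x => LinearMap.congr_fun hs x
  have hcod : IsCompl (LinearMap.ker ε) (LinearMap.range s) := by
    constructor
    · rw [disjoint_iff, eq_bot_iff]
      rintro _ ⟨hx, y, rfl⟩
      have : y = 0 := by rw [← hsε y]; exact hx
      simp [this]
    · rw [codisjoint_iff, eq_top_iff]
      intro x _
      rw [← sub_add_cancel x (s (ε x))]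
      exact Submodule.add_mem_sup (by simp [hsε]) ⟨_, rfl⟩
  have htop : LinearMap.range s = ⊤ := by
    refine eq_top_iff.2 (Submodule.le_of_le_smul_of_le_jacobson_bot (I := maximalIdeal R)
      Module.Finite.fg_top (IsLocalRing.maximalIdeal_le_jacobson _) ?_)
    rw [← hcod.codisjoint.eq_top]
    refine sup_le ?_ le_sup_left
    rw [hcod.codisjoint.eq_top]
    exact hmin.trans le_sup_right
  have := hcod.disjoint
  rwa [htop, disjoint_top] at this

lemma betti_eq_zero_of_hasProjectiveDimensionLT {R : Type} [CommRing R] [IsLocalRing R] (n : ℕ) :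
    ∀ (N : Type) [AddCommGroup N] [Module R N] (β : ℕ → ℕ),
      IsMinimalFreeResolutionBetti R N β → HasProjectiveDimensionLT (ModuleCat.of R N) n →
        β n = 0 := by
  induction n with
  | zero =>
    rintro N _ _ β ⟨d, ε, hε, h0, hd, hmin⟩ hN
    rw [hasProjectiveDimensionLT_zero_iff_isZero, ModuleCat.isZero_iff_subsingleton] at hN
    have htop : LinearMap.ker ε = ⊤ := LinearMap.ker_eq_top.2 (by
      ext x; exact Subsingleton.elim (α := N) _ _)
    by_contra hne
    let j : Fin (β 0) := ⟨0, Nat.pos_of_ne_zero hne⟩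
    have := hmin 0 (h0 ▸ htop ▸ Submodule.mem_top : (Pi.single j 1 : Fin (β 0) → R) ∈ _)
    have := (mem_ideal_smul_top_pi_iff _ _).1 this j
    simp at this
  | succ n ih =>
    rintro N _ _ β ⟨d, ε, hε, h0, hd, hmin⟩ hN
    let δ : (Fin (β 1) → R) →ₗ[R] LinearMap.ker ε :=
      (d 0).codRestrict _ fun x => h0 ▸ LinearMap.mem_range_self _ x
    refine ih (LinearMap.ker ε) (fun i => β (i + 1)) ⟨fun i => d (i + 1), δ, ?_, ?_,
      fun i => hd (i + 1), fun i => hmin (i + 1)⟩ ?_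
    · rintro ⟨x, hx⟩
      have hx' := hx
      rw [h0] at hx'
      obtain ⟨y, rfl⟩ := hx'
      exact ⟨y, rfl⟩
    · rw [LinearMap.ker_codRestrict]
      exact hd 0
    · have hS := LinearMap.shortExact_shortComplexKer hε
      cases n with
      | zero =>
        rw [zero_add, ← projective_iff_hasProjectiveDimensionLT_one,
          ← IsProjective.iff_projective] at hN
        rw [hasProjectiveDimensionLT_zero_iff_isZero, ModuleCat.isZero_iff_subsingleton]
        have := ker_eq_bot_of_projective ε hε (h0 ▸ hmin 0)
        exact (Submodule.subsingleton_iff_eq_bot).2 this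
      | succ n =>
        exact (hS.hasProjectiveDimensionLT_X₃_iff n inferInstance).1 hN

lemma hasProjectiveDimensionLT_of_betti {R : Type} [CommRing R] (n : ℕ) :
    ∀ (N : Type) [AddCommGroup N] [Module R N] (β : ℕ → ℕ),
      IsFreeResolutionBetti R N β → (∀ i, n ≤ i → β i = 0) →
        HasProjectiveDimensionLT (ModuleCat.of R N) n := by
  induction n with
  | zero =>
    rintro N _ _ β ⟨d, ε, hε, -, -⟩ hβ
    rw [hasProjectiveDimensionLT_zero_iff_isZero, ModuleCat.isZero_iff_subsingleton]
    have : IsEmpty (Fin (β 0)) := by rw [hβ 0 le_rfl]; infer_instance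
    exact hε.subsingleton
  | succ n ih =>
    rintro N _ _ β ⟨d, ε, hε, h0, hd⟩ hβ
    let δ : (Fin (β 1) → R) →ₗ[R] LinearMap.ker ε :=
      (d 0).codRestrict _ fun x => h0 ▸ LinearMap.mem_range_self _ x
    have hS := LinearMap.shortExact_shortComplexKer hε
    refine hS.hasProjectiveDimensionLT_X₃ n (ih (LinearMap.ker ε) (fun i => β (i + 1))
      ⟨fun i => d (i + 1), δ, ?_, ?_, fun i => hd (i + 1)⟩ fun i hi => hβ _ (by omega)) ?_
    · rintro ⟨x, hx⟩
      have hx' := hx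
      rw [h0] at hx'
      obtain ⟨y, rfl⟩ := hx'
      exact ⟨y, rfl⟩
    · rw [LinearMap.ker_codRestrict]
      exact hd 0
    · have : Projective (ModuleCat.of R (Fin (β 0) → R)) := (IsProjective.iff_projective _).1 inferInstance
      exact hasProjectiveDimensionLT_of_ge (ModuleCat.of R (Fin (β 0) → R)) 1 (n + 1) (by omega)

theorem exists_minimalFreeResolution_of_maximalCohenMacaulay
    (A : Type) [CommRing A] [IsNoetherianRing A] [IsLocalRing A]
    (B : Type) [CommRing B] [IsLocalRing B] [Algebra A B]
    (hsurj : Function.Surjective (algebraMap A B)) (c : ℕ) (f : Fin c → A)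
    (hreg : RingTheory.Sequence.IsRegular A (List.ofFn f))
    (hker : RingHom.ker (algebraMap A B) = Ideal.span (Set.range f))
    (M : Type) [AddCommGroup M] [Module B M] [Module.Finite B M]
    [Module A M] [IsScalarTower A B M]
    (hfin : ∃ βA : ℕ → ℕ, IsFreeResolutionBetti A M βA ∧ ∃ n, ∀ i, n < i → βA i = 0)
    (hMCM : ∃ rs : List B, (∀ x ∈ rs, x ∈ maximalIdeal B) ∧
      RingTheory.Sequence.IsRegular M rs ∧ (rs.length : WithBot ℕ∞) = ringKrullDim B) :
    ∃ βA, IsMinimalFreeResolutionBetti A M βA ∧ ∀ i, c < i → βA i = 0 := by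
  obtain ⟨rs, hrs, hMreg, hlen⟩ := hMCM
  have : Module.Finite A B := Module.Finite.of_surjective (Algebra.linearMap A B) hsurj
  have : Module.Finite A M := Module.Finite.trans B M
  have : Nontrivial M := hMreg.nontrivial
  obtain ⟨rs, rfl⟩ := List.map_surjective_iff.2 hsurj rs
  have hrsA : ∀ x ∈ rs, x ∈ maximalIdeal A := fun x hx => (mem_maximalIdeal _).2 fun hu =>
    (mem_maximalIdeal _).1 (hrs _ (List.mem_map_of_mem hx)) (hu.map _)
  have hMregA : RingTheory.Sequence.IsWeaklyRegular M rs :=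
    (RingTheory.Sequence.isWeaklyRegular_map_algebraMap_iff B M rs).1 hMreg.1
  rw [List.length_map] at hlen
  have hdim : ringKrullDim A = (rs.length + c : ℕ) := by
    rw [← ringKrullDim_add_length_eq_ringKrullDim_of_isRegular _ hreg, List.length_ofFn,
      Nat.cast_add, hlen]
    congr 1
    refine ringKrullDim_eq_of_ringEquiv ?_
    exact (Ideal.quotEquivOfEq ((ofList_ofFn f).trans hker.symm)).trans
      (RingHom.quotientKerEquivOfSurjective hsurj)
  have hpd := ModuleCat.projectiveDimension_quotient_eq_add_length_of_isWeaklyRegular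
    (ModuleCat.of A M) rs hMregA hrsA
  obtain ⟨β₀, hβ₀, n, hn⟩ := hfin
  have hLT := hasProjectiveDimensionLT_of_betti (n + 1) M β₀ hβ₀ fun i hi => hn i hi
  obtain ⟨γ, hγ⟩ := exists_minimalFreeResolution A (M ⧸ Ideal.ofList rs • (⊤ : Submodule A M))
  have hLTN : HasProjectiveDimensionLT
      (ModuleCat.of A (M ⧸ Ideal.ofList rs • (⊤ : Submodule A M))) (n + rs.length + 1) := by
    replace hLT := (projectiveDimension_le_iff _ _).2 hLT
    refine (projectiveDimension_le_iff _ _).1 ?_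
    rw [Nat.cast_add]
    exact hpd.trans_le (add_le_add_left hLT _)
  have hγ0 : ∀ i, n + rs.length < i → γ i = 0 := fun i hi =>
    betti_eq_zero_of_hasProjectiveDimensionLT i _ γ hγ
      (hasProjectiveDimensionLT_of_ge _ (n + rs.length + 1) i hi)
  have hγ' : ∀ i, rs.length + c < i → γ i = 0 := by
    obtain ⟨d, ε, -, -, hd, hmin⟩ := hγ
    exact betti_eq_zero_of_exact_of_ringKrullDim_le _ A hdim.le γ d hd hmin ⟨_, hγ0⟩
  have hLTN' := hasProjectiveDimensionLT_of_betti (rs.length + c + 1) _ γ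
    (hγ.imp fun d => Exists.imp fun ε h => ⟨h.1, h.2.1, h.2.2.1⟩) fun i hi => hγ' i hi
  have hLTM : HasProjectiveDimensionLT (ModuleCat.of A M) (c + 1) := by
    replace hLTN' := (projectiveDimension_le_iff _ _).2 hLTN'
    refine (projectiveDimension_le_iff _ _).1 ?_
    rw [add_comm, Nat.cast_add] at hLTN'
    exact ENat.WithBot.add_le_add_natCast_right_iff.1 (hpd.symm.trans_le hLTN')
  obtain ⟨β, hβ⟩ := exists_minimalFreeResolution A M
  exact ⟨β, hβ, fun i hi => betti_eq_zero_of_hasProjectiveDimensionLT i _ β hβ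
    (hasProjectiveDimensionLT_of_ge _ (c + 1) i hi)⟩

end ProjectiveDimension

section FlatBaseChange

variable {P Q : Type} [CommRing P] [CommRing Q] [Algebra P Q]

lemma LinearMap.mapPi_algebraMap_piScalarRight {n m : ℕ} (d : (Fin n → P) →ₗ[P] (Fin m → P))
    (t : Q ⊗[P] (Fin n → P)) :
    d.mapPi (algebraMap P Q) (TensorProduct.piScalarRight P Q Q (Fin n) t) =
      TensorProduct.piScalarRight P Q Q (Fin m) (d.baseChange Q t) := by
  have hv : ∀ (k : ℕ) (q : Q) (v : Fin k → P),
      TensorProduct.piScalarRight P Q Q (Fin k) (q ⊗ₜ v) = q • (algebraMap P Q ∘ v) := by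
    intro k q v
    ext i
    simp [Algebra.smul_def, mul_comm]
  induction t with
  | zero => simp
  | add x y hx hy => rw [map_add, map_add, hx, hy, map_add, map_add]
  | tmul q v =>
    rw [LinearMap.baseChange_tmul, hv, hv, map_smul, LinearMap.mapPi_comp_apply]

lemma ker_mapPi_eq_range_of_flat [Module.Flat P Q] {n m l : ℕ}
    (d : (Fin m → P) →ₗ[P] (Fin l → P)) (d' : (Fin n → P) →ₗ[P] (Fin m → P))
    (h : LinearMap.ker d = LinearMap.range d') :
    LinearMap.ker (d.mapPi (algebraMap P Q)) = LinearMap.range (d'.mapPi (algebraMap P Q)) := by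
  have hex : Function.Exact (d'.baseChange Q) (d.baseChange Q) :=
    Module.Flat.lTensor_exact Q (LinearMap.exact_iff.2 h)
  ext v
  obtain ⟨t, rfl⟩ := (TensorProduct.piScalarRight P Q Q (Fin m)).surjective v
  rw [LinearMap.mem_ker, LinearMap.mapPi_algebraMap_piScalarRight,
    LinearEquiv.map_eq_zero_iff, hex t]
  constructor
  · rintro ⟨s, rfl⟩
    exact ⟨_, LinearMap.mapPi_algebraMap_piScalarRight d' s⟩
  · rintro ⟨w, hw⟩
    obtain ⟨s, rfl⟩ := (TensorProduct.piScalarRight P Q Q (Fin n)).surjective w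
    rw [LinearMap.mapPi_algebraMap_piScalarRight] at hw
    exact ⟨s, (TensorProduct.piScalarRight P Q Q (Fin m)).injective hw⟩

lemma exists_augmentation_of_flat [Module.Flat P Q] {N N' : Type} [AddCommGroup N]
    [Module P N] [AddCommGroup N'] [Module Q N'] (e : Q ⊗[P] N ≃ₗ[Q] N') {n m : ℕ}
    (d : (Fin n → P) →ₗ[P] (Fin m → P)) (ε : (Fin m → P) →ₗ[P] N)
    (hε : Function.Surjective ε) (h : LinearMap.ker ε = LinearMap.range d) :
    ∃ ε' : (Fin m → Q) →ₗ[Q] N', Function.Surjective ε' ∧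
      LinearMap.ker ε' = LinearMap.range (d.mapPi (algebraMap P Q)) := by
  let p := TensorProduct.piScalarRight P Q Q (Fin m)
  have hex : Function.Exact (d.baseChange Q) (ε.baseChange Q) :=
    Module.Flat.lTensor_exact Q (LinearMap.exact_iff.2 h)
  refine ⟨e.toLinearMap ∘ₗ ε.baseChange Q ∘ₗ p.symm.toLinearMap,
    e.surjective.comp ((LinearMap.lTensor_surjective Q hε).comp p.symm.surjective), ?_⟩
  ext v
  obtain ⟨t, rfl⟩ := p.surjective v
  rw [LinearMap.mem_ker, LinearMap.comp_apply, LinearMap.comp_apply, LinearEquiv.coe_coe,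
    LinearEquiv.coe_coe, LinearEquiv.symm_apply_apply, LinearEquiv.map_eq_zero_iff, hex t]
  constructor
  · rintro ⟨s, rfl⟩
    exact ⟨_, LinearMap.mapPi_algebraMap_piScalarRight d s⟩
  · rintro ⟨w, hw⟩
    obtain ⟨s, rfl⟩ := (TensorProduct.piScalarRight P Q Q (Fin n)).surjective w
    rw [LinearMap.mapPi_algebraMap_piScalarRight] at hw
    exact ⟨s, p.injective hw⟩

lemma IsFreeResolutionBetti.of_flat [Module.Flat P Q] {N N' : Type} [AddCommGroup N]
    [Module P N] [AddCommGroup N'] [Module Q N'] (e : Q ⊗[P] N ≃ₗ[Q] N') {β : ℕ → ℕ}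
    (h : IsFreeResolutionBetti P N β) : IsFreeResolutionBetti Q N' β := by
  obtain ⟨d, ε, hε, h0, hd⟩ := h
  obtain ⟨ε', hε', h0'⟩ := exists_augmentation_of_flat e (d 0) ε hε h0
  exact ⟨fun i => (d i).mapPi (algebraMap P Q), ε', hε', h0',
    fun i => ker_mapPi_eq_range_of_flat _ _ (hd i)⟩

lemma IsMinimalFreeResolutionBetti.of_flat [IsLocalRing P] [IsLocalRing Q]
    [IsLocalHom (algebraMap P Q)] [Module.Flat P Q] {N N' : Type} [AddCommGroup N]
    [Module P N] [AddCommGroup N'] [Module Q N'] (e : Q ⊗[P] N ≃ₗ[Q] N') {β : ℕ → ℕ}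
    (h : IsMinimalFreeResolutionBetti P N β) : IsMinimalFreeResolutionBetti Q N' β := by
  obtain ⟨d, ε, hε, h0, hd, hmin⟩ := h
  obtain ⟨ε', hε', h0'⟩ := exists_augmentation_of_flat e (d 0) ε hε h0
  exact ⟨fun i => (d i).mapPi (algebraMap P Q), ε', hε', h0',
    fun i => ker_mapPi_eq_range_of_flat _ _ (hd i), fun i =>
    LinearMap.mapPi_apply_mem _ (maximalIdeal P) _
      (fun x hx => map_nonunit (algebraMap P Q) x hx) _ (hmin i)⟩

/-- Duality commutes with flat base change for finitely presented modules. -/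
noncomputable def dualBaseChangeEquiv [Module.Flat P Q] (M : Type) [AddCommGroup M] [Module P M]
    [Module.FinitePresentation P M] : Q ⊗[P] Module.Dual P M ≃ₗ[Q] Module.Dual Q (Q ⊗[P] M) :=
  (Module.FinitePresentation.isBaseChange_map P M P Q).equiv ≪≫ₗ
    LinearEquiv.congrRight (TensorProduct.AlgebraTensorModule.rid P Q Q)

end FlatBaseChange

section InfiniteResidueFieldExtension

open Polynomial

lemma exists_flat_local_extension (A : Type) [CommRing A] [IsNoetherianRing A] [IsLocalRing A] :
    ∃ (R : Type) (_ : CommRing R) (_ : IsNoetherianRing R) (_ : IsLocalRing R) (_ : Algebra A R)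
      (_ : Module.Flat A R) (_ : IsLocalHom (algebraMap A R)), Infinite (ResidueField R) := by
  let p : Ideal A[X] := (maximalIdeal A).map C
  have hp : p.IsPrime := Ideal.isPrime_map_C_of_isPrime
  let R := Localization.AtPrime p
  have hX : ∀ i j : ℕ, i ≠ j → (X ^ i - X ^ j : A[X]) ∉ p := by
    intro i j hij h
    have := Ideal.mem_map_C_iff.1 h i
    rw [coeff_sub, coeff_X_pow, coeff_X_pow, if_pos rfl, if_neg hij, sub_zero] at this
    exact (Ideal.ne_top_iff_one _).1 (maximalIdeal.isMaximal A).ne_top this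
  refine ⟨R, inferInstance, IsLocalization.isNoetherianRing p.primeCompl _ inferInstance,
    inferInstance, inferInstance, ?_, ⟨fun a ha => ?_⟩, ?_⟩
  · exact Module.Flat.trans A A[X] R
  · by_contra hna
    rw [IsScalarTower.algebraMap_apply A A[X] R,
      IsLocalization.AtPrime.isUnit_to_map_iff R p] at ha
    exact ha (Ideal.mem_map_of_mem C hna)
  · refine Infinite.of_injective (fun i : ℕ => residue R (algebraMap A[X] R (X ^ i)))
      fun i j hij => ?_
    by_contra hne
    rw [← sub_eq_zero, ← map_sub, ← map_sub, residue_eq_zero_iff, mem_maximalIdeal] at hij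
    exact hij ((IsLocalization.AtPrime.isUnit_to_map_iff R p _).2 (hX i j hne))

end InfiniteResidueFieldExtension

section Reduction

lemma ker_includeRight_of_surjective {A B R : Type} [CommRing A] [CommRing B] [CommRing R]
    [Algebra A B] [Algebra A R] (hsurj : Function.Surjective (algebraMap A B)) :
    RingHom.ker (Algebra.TensorProduct.includeRight : R →ₐ[A] B ⊗[A] R) =
      (RingHom.ker (algebraMap A B)).map (algebraMap A R) := by
  have hk := Algebra.TensorProduct.rTensor_ker (R := A) (C := R) (Algebra.ofId A B) hsurj
  have hcomp : (Algebra.TensorProduct.includeRight : R →ₐ[A] B ⊗[A] R) =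
      (Algebra.TensorProduct.map (Algebra.ofId A B) (AlgHom.id A R)).comp
        (Algebra.TensorProduct.lid A R).symm.toAlgHom := by
    ext x
    simp
  ext x
  rw [hcomp, RingHom.mem_ker, AlgHom.comp_apply, ← RingHom.mem_ker]
  have : ((Algebra.TensorProduct.lid A R).symm.toAlgHom x ∈
      (RingHom.ker (Algebra.ofId A B)).map
        (Algebra.TensorProduct.includeLeft : A →ₐ[A] A ⊗[A] R)) ↔
      x ∈ (RingHom.ker (algebraMap A B)).map (algebraMap A R) := by
    have hmap : (RingHom.ker (algebraMap A B)).map (algebraMap A R) =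
        ((RingHom.ker (Algebra.ofId A B)).map
          (Algebra.TensorProduct.includeLeft : A →ₐ[A] A ⊗[A] R)).map
            (Algebra.TensorProduct.lid A R).toRingEquiv.toRingHom := by
      have h1 : (RingHom.ker (Algebra.ofId A B)).map
          (Algebra.TensorProduct.includeLeft : A →ₐ[A] A ⊗[A] R) =
          (RingHom.ker (algebraMap A B)).map
            (Algebra.TensorProduct.includeLeft : A →ₐ[A] A ⊗[A] R).toRingHom := rfl
      rw [h1, Ideal.map_map]
      congr 1
      ext a
      simp [Algebra.algebraMap_eq_smul_one]
    rw [hmap]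
    constructor
    · intro h
      have := Ideal.mem_map_of_mem (Algebra.TensorProduct.lid A R).toRingEquiv.toRingHom h
      simpa using this
    · intro h
      obtain ⟨y, hy, rfl⟩ := (Ideal.mem_map_iff_of_surjective _
        (Algebra.TensorProduct.lid A R).toRingEquiv.surjective).1 h
      simpa using hy
  rw [← this]
  exact SetLike.ext_iff.1 hk _

theorem limsup_betti_eq {A : Type} [CommRing A] [IsNoetherianRing A] [IsLocalRing A]
    {B : Type} [CommRing B] [IsNoetherianRing B] [IsLocalRing B] [Algebra A B]
    (hsurj : Function.Surjective (algebraMap A B)) {c : ℕ} (f : Fin c → A)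
    (hf : ∀ i, f i ∈ maximalIdeal A)
    (hreg : RingTheory.Sequence.IsWeaklyRegular A (List.ofFn f))
    (hker : RingHom.ker (algebraMap A B) = Ideal.span (Set.range f))
    {M : Type} [AddCommGroup M] [Module B M] [Module.Finite B M]
    [Module A M] [IsScalarTower A B M]
    (hfin : ∃ βA : ℕ → ℕ, IsFreeResolutionBetti A M βA ∧ ∀ i, c < i → βA i = 0)
    {β β' : ℕ → ℕ} (hβ : IsMinimalFreeResolutionBetti B M β)
    (hβ' : IsMinimalFreeResolutionBetti B (Module.Dual B M) β') (n : ℕ) :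
    limsup (fun i : ℕ => (β i : ENNReal) / (i : ENNReal) ^ n) atTop
      = limsup (fun i : ℕ => (β' i : ENNReal) / (i : ENNReal) ^ n) atTop := by
  obtain ⟨R, _, _, _, _, _, _, _⟩ := exists_flat_local_extension A
  let : Algebra R (B ⊗[A] R) := Algebra.TensorProduct.rightAlgebra
  have hsurjR : Function.Surjective (algebraMap R (B ⊗[A] R)) :=
    Algebra.TensorProduct.includeRight_surjective R hsurj
  have hfR : ∀ i, algebraMap A R (f i) ∈ maximalIdeal R := fun i =>
    map_nonunit (algebraMap A R) _ (hf i)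
  have hkerR : RingHom.ker (algebraMap R (B ⊗[A] R)) =
      Ideal.span (Set.range fun i => algebraMap A R (f i)) := by
    have := ker_includeRight_of_surjective (R := R) hsurj
    rw [hker, Ideal.map_span, ← Set.range_comp] at this
    exact this
  have hle : RingHom.ker (algebraMap R (B ⊗[A] R)) ≤ maximalIdeal R := by
    rw [hkerR, Ideal.span_le]
    rintro _ ⟨i, rfl⟩
    exact hfR i
  have : Nontrivial (B ⊗[A] R) := by
    by_contra h
    rw [not_nontrivial_iff_subsingleton] at h
    exact (Ideal.ne_top_iff_one _).1 (maximalIdeal.isMaximal R).ne_top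
      (hle ((RingHom.mem_ker).2 (Subsingleton.elim _ _)))
  have : IsLocalRing (B ⊗[A] R) := IsLocalRing.of_surjective' (algebraMap R (B ⊗[A] R)) hsurjR
  have := IsLocalHom.of_surjective (algebraMap R (B ⊗[A] R)) hsurjR
  have : Infinite (ResidueField (B ⊗[A] R)) :=
    Infinite.of_injective (ResidueField.map (algebraMap R (B ⊗[A] R)))
      (RingHom.injective _)
  have : Algebra.IsPushout A R B (B ⊗[A] R) := Algebra.IsPushout.symm inferInstance
  have : IsLocalHom (algebraMap B (B ⊗[A] R)) := ⟨fun b hb => by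
    obtain ⟨a, rfl⟩ := hsurj b
    rw [← IsScalarTower.algebraMap_apply A B (B ⊗[A] R),
      IsScalarTower.algebraMap_apply A R (B ⊗[A] R)] at hb
    exact (isUnit_of_map_unit _ _ (isUnit_of_map_unit _ _ hb)).map _⟩
  have : Module.FinitePresentation B M := Module.finitePresentation_of_finite B M
  obtain ⟨βA, hβA, hβA0⟩ := hfin
  have hregR : RingTheory.Sequence.IsWeaklyRegular R
      (List.ofFn fun i => algebraMap A R (f i)) := by
    have := hreg.of_flat (S := R)
    rwa [List.map_ofFn] at this
  exact limsup_betti_eq_of_infinite ((B ⊗[A] R) ⊗[B] M)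
    (hβ.of_flat (LinearEquiv.refl _ _)) (hβ'.of_flat (dualBaseChangeEquiv M)) n c R hsurjR _ hfR
    hregR hkerR
    ⟨βA, hβA.of_flat (Algebra.IsPushout.cancelBaseChange A R B (B ⊗[A] R) M).symm, hβA0⟩

end Reduction

end

/-- Let `A` be a Noetherian local ring, `f₁, …, f_c ∈ 𝔪_A` an `A`-regular
sequence, and `B = A/(f₁, …, f_c)`. Let `M` be a finitely generated `B`-module which is
maximal Cohen–Macaulay over `B` and admits a finite free resolution over `A`, and let
`M^∨ = Hom_B(M, B)`. Then the Betti numbers of minimal free resolutions `β` of `M` and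
`β'` of `M^∨` over `B` satisfy `limsup β i / iⁿ = limsup β' i / iⁿ` (in `[0,∞]`) for
every `n`; in particular the complexities and Betti degrees of `M` and `M^∨` coincide. -/
theorem stmt_8
    (A : Type) [CommRing A] [IsNoetherianRing A] [IsLocalRing A]
    (B : Type) [CommRing B] [IsNoetherianRing B] [IsLocalRing B]
    (φ : A →+* B) (hφ : Function.Surjective φ)
    (c : ℕ) (f : Fin c → A) (hf : ∀ i, f i ∈ maximalIdeal A)
    (hreg : RingTheory.Sequence.IsRegular A (List.ofFn f))
    (hker : RingHom.ker φ = Ideal.span (Set.range f))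
    (M : Type) [AddCommGroup M] [Module B M] [Module.Finite B M]
    [Module A M] (hcompat : ∀ (a : A) (m : M), a • m = φ a • m)
    (hfinresA : ∃ βA : ℕ → ℕ, IsFreeResolutionBetti A M βA ∧ ∃ n, ∀ i, n < i → βA i = 0)
    (hMCM : ∃ rs : List B, (∀ x ∈ rs, x ∈ maximalIdeal B) ∧
      RingTheory.Sequence.IsRegular M rs ∧ (rs.length : WithBot ℕ∞) = ringKrullDim B)
    (β β' : ℕ → ℕ)
    (hβ : IsMinimalFreeResolutionBetti B M β)
    (hβ' : IsMinimalFreeResolutionBetti B (Module.Dual B M) β')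
    (n : ℕ) :
    limsup (fun i : ℕ => (β i : ENNReal) / (i : ENNReal) ^ n) atTop
      = limsup (fun i : ℕ => (β' i : ENNReal) / (i : ENNReal) ^ n) atTop := by
  let : Algebra A B := φ.toAlgebra
  have : IsScalarTower A B M := ⟨fun a b m => by
    rw [hcompat, Algebra.smul_def, mul_smul]
    rfl⟩
  obtain ⟨βA, ⟨d, ε, hε, h0, hd, -⟩, hβA⟩ :=
    exists_minimalFreeResolution_of_maximalCohenMacaulay A B hφ c f hreg hker M hfinresA hMCM
  exact limsup_betti_eq hφ f hf hreg.1 hker ⟨βA, ⟨d, ε, hε, h0, hd⟩, hβA⟩ hβ hβ' n
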